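/- Let f : [0,1] → [0,1] be a C^3 l-modal map with f(0) = 0, with negative Schwarzian derivative, non-flat at each critical point, and all of whose periodic points are repelling (|(f^n)'(p)| > 1 whenever f^n(p) = p). Then for all x, y ∈ [0,1]: x < y if and only if ι(x) ≺ ι(y); that is, the itinerary map ι : [0,1] → Σ is strictly increasing with respect to the signed lexicographic order. -/

import Mathlib

open Set Metric

noncomputable section

/-- Endpoints of the laps of an `l`-modal map with turning points `c`. -/
def lapPts (l : ℕ) (c : Fin l → ℝ) (i : Fin (l + 2)) : ℝ :=
  if h0 : (i : ℕ) = 0 then 0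
  else if hl : (i : ℕ) = l + 1 then 1
  else c ⟨(i : ℕ) - 1, by have := i.isLt; omega⟩

/-- The `i`-th (closed) lap of an `l`-modal map with turning points `c`. -/
def lap (l : ℕ) (c : Fin l → ℝ) (i : Fin (l + 1)) : Set ℝ :=
  Icc (lapPts l c i.castSucc) (lapPts l c i.succ)

/-- `f` is an `l`-modal map of `[0,1]` with turning points `c 0 < … < c (l-1)`. -/
def IsLModal (l : ℕ) (f : ℝ → ℝ) (c : Fin l → ℝ) : Prop :=
  StrictMono c ∧ (∀ i, c i ∈ Ioo (0:ℝ) 1) ∧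
  MapsTo f (Icc 0 1) (Icc 0 1) ∧
  f 0 ∈ ({0, 1} : Set ℝ) ∧ f 1 ∈ ({0, 1} : Set ℝ) ∧
  ∃ s : Fin (l + 1) → Bool,
    (∀ i : Fin l, s i.castSucc ≠ s i.succ) ∧
    (∀ i, if s i then StrictMonoOn f (lap l c i) else StrictAntiOn f (lap l c i))

/-- The Schwarzian derivative `f'''/f' - (3/2) (f''/f')²`. -/
def schwarzian (f : ℝ → ℝ) (x : ℝ) : ℝ :=
  iteratedDeriv 3 f x / deriv f x - 3/2 * (iteratedDeriv 2 f x / deriv f x) ^ 2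

/-- `f` is non-flat at `x`. -/
def NonFlatAt (f : ℝ → ℝ) (x : ℝ) : Prop :=
  ∃ φ : ℝ → ℝ, ∃ P : Polynomial ℝ, ∃ U ∈ nhds (0:ℝ),
    ContDiff ℝ 2 φ ∧ φ 0 = x ∧ (∀ t, deriv φ t ≠ 0) ∧
    ∀ t ∈ U, f (φ t) = P.eval t

/-- Symbols of the itinerary alphabet: lap symbols `I_1, …, I_{l+1}` (`Sum.inl`) and
critical symbols `c_1, …, c_l` (`Sum.inr`). -/
def MSym (l : ℕ) := Fin (l + 1) ⊕ Fin l

/-- Numerical value implementing the symbol ordering `I_1 < c_1 < I_2 < c_2 < … < I_{l+1}`. -/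
def symVal {l : ℕ} : MSym l → ℤ :=
  Sum.elim (fun j => 2 * (j : ℤ)) (fun j => 2 * (j : ℤ) + 1)

/-- The sign `ε` of a symbol: `ε(I_j) = (-1)^{j+1}` and `ε(c_j) = 0`. -/
def symSgn {l : ℕ} : MSym l → ℤ :=
  Sum.elim (fun j => (-1) ^ (j : ℕ)) (fun _ => 0)

/-- The symbol of the point `x` relative to the turning points `c`: the critical symbol
`c_j` if `x = c j`, and otherwise the lap symbol of the lap containing `x`. -/
def symAt (l : ℕ) (c : Fin l → ℝ) (x : ℝ) : MSym l :=
  letI := Classical.propDecidable (∃ j, x = c j)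
  if h : ∃ j, x = c j then Sum.inr h.choose
  else Sum.inl ⟨(Finset.univ.filter fun i => c i < x).card,
    Nat.lt_succ_of_le (le_trans (Finset.card_filter_le _ _) (by simp))⟩

/-- The itinerary of `x` under `f`. -/
def itin (l : ℕ) (c : Fin l → ℝ) (f : ℝ → ℝ) (x : ℝ) : ℕ → MSym l :=
  fun n => symAt l c (f^[n] x)

/-- The signed lexicographic (strict) order on itineraries. -/
def sigLexLt (l : ℕ) (u v : ℕ → MSym l) : Prop :=
  ∃ n : ℕ, (∀ i < n, u i = v i) ∧
    symVal (u n) * (∏ i ∈ Finset.range n, symSgn (u i)) <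
      symVal (v n) * (∏ i ∈ Finset.range n, symSgn (v i))

namespace WI

structure MM (f : ℝ → ℝ) (K : Finset ℝ) : Prop where
  smooth : ContDiff ℝ 3 f
  maps : MapsTo f (Icc 0 1) (Icc 0 1)
  sub : ∀ k ∈ K, k ∈ Ioo (0:ℝ) 1
  f0 : f 0 = 0
  f1 : f 1 = 0 ∨ f 1 = 1
  reg : ∀ x ∈ Icc (0:ℝ) 1, x ∉ K → deriv f x ≠ 0
  sch : ∀ x ∈ Icc (0:ℝ) 1, x ∉ K → schwarzian f x < 0
  fold : ∀ k ∈ K, ∀ a b, 0 ≤ a → a < k → k < b → b ≤ 1 → (∀ z ∈ K, a < z → z < b → z = k) →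
    (StrictMonoOn f (Icc a k) ∧ StrictAntiOn f (Icc k b)) ∨
    (StrictAntiOn f (Icc a k) ∧ StrictMonoOn f (Icc k b))
  nf : ∀ k ∈ K, NonFlatAt f k
  rep : ∀ p ∈ Icc (0:ℝ) 1, ∀ n : ℕ, 1 ≤ n → f^[n] p = p → 1 < |deriv (f^[n]) p|

theorem mono_of_hasDeriv {F F' : ℝ → ℝ} {u w : ℝ}
    (h : ∀ t ∈ Ioo u w, HasDerivAt F (F' t) t) (h0 : ∀ t ∈ Ioo u w, 0 ≤ F' t) :
    MonotoneOn F (Ioo u w) := by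
  apply monotoneOn_of_deriv_nonneg (convex_Ioo u w)
  · exact fun t ht => (h t ht).continuousAt.continuousWithinAt
  · rw [interior_Ioo]; exact fun t ht => (h t ht).differentiableAt.differentiableWithinAt
  · rw [interior_Ioo]; intro t ht; rw [(h t ht).deriv]; exact h0 t ht

theorem mono_of_hasDeriv' {F F' : ℝ → ℝ} {u w : ℝ}
    (h : ∀ t ∈ Ico u w, HasDerivAt F (F' t) t) (h0 : ∀ t ∈ Ioo u w, 0 ≤ F' t) :
    MonotoneOn F (Ico u w) := by
  apply monotoneOn_of_deriv_nonneg (convex_Ico u w)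
  · exact fun t ht => (h t ht).continuousAt.continuousWithinAt
  · rw [interior_Ico]
    exact fun t ht => (h t (Ioo_subset_Ico_self ht)).differentiableAt.differentiableWithinAt
  · rw [interior_Ico]; intro t ht; rw [(h t (Ioo_subset_Ico_self ht)).deriv]; exact h0 t ht

section CR
variable {F F1 F2 F3 : ℝ → ℝ} {u w : ℝ}

theorem cr_quad (h1 : ∀ t ∈ Ioo u w, HasDerivAt F (F1 t) t)
    (h2 : ∀ t ∈ Ioo u w, HasDerivAt F1 (F2 t) t)
    (h3 : ∀ t ∈ Ioo u w, HasDerivAt F2 (F3 t) t)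
    (hp : ∀ t ∈ Ioo u w, 0 < F1 t)
    (hS : ∀ t ∈ Ioo u w, F3 t * F1 t - 3/2 * F2 t ^ 2 ≤ 0)
    {x y : ℝ} (hux : u < x) (hxy : x < y) (hyw : y < w) :
    F1 x * F1 y * (y - x)^2 ≤ (F y - F x)^2 ∧ 0 < F y - F x := by
  set s : ℝ → ℝ := fun t => Real.sqrt (F1 t) with hs
  have hspos : ∀ t ∈ Ioo u w, 0 < s t := fun t ht => Real.sqrt_pos.2 (hp t ht)
  have hs2 : ∀ t ∈ Ioo u w, s t * s t = F1 t := fun t ht => Real.mul_self_sqrt (hp t ht).le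
  have hsd : ∀ t ∈ Ioo u w, HasDerivAt s (F2 t / (2 * s t)) t := fun t ht =>
    (h2 t ht).sqrt (hp t ht).ne'
  have hsub : ∀ t ∈ Ico x w, t ∈ Ioo u w := fun t ht => ⟨hux.trans_le ht.1, ht.2⟩
  have hx : x ∈ Ioo u w := hsub x ⟨le_rfl, hxy.trans hyw⟩
  set Q : ℝ → ℝ := fun t => 1 / s x - (s t)⁻¹ - (t - x) * (F2 t / (2 * s t ^ 3)) with hQ
  have hQd : ∀ t ∈ Ico x w, HasDerivAt Q
      ((t - x) * ((3/2 * F2 t ^ 2 - F3 t * F1 t) / (2 * s t ^ 5))) t := by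
    intro t ht
    have ht' := hsub t ht
    have hst := (hspos t ht').ne'
    have e1 := (hsd t ht').inv hst
    have e2 := ((hasDerivAt_id t).sub_const x).mul
      ((h3 t ht').div (((hsd t ht').pow 3).const_mul 2)
        (by simp only [Pi.pow_apply]; positivity))
    have e3 := (e1.const_sub (1 / s x)).sub e2
    refine e3.congr_deriv ?_
    rw [← hs2 t ht']
    simp only [id, Pi.pow_apply, Pi.div_apply]
    field_simp
    push_cast
    ring
  have hQm : ∀ t ∈ Ico x w, 0 ≤ Q t := by
    intro t ht
    have hm := mono_of_hasDeriv' hQd (by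
      intro r hr
      have hr' := hsub r (Ioo_subset_Ico_self hr)
      have := hS r hr'
      have := hspos r hr'
      have := hr.1
      apply mul_nonneg (by linarith) (div_nonneg (by linarith) (by positivity)))
    have := hm (⟨le_rfl, hxy.trans hyw⟩ : x ∈ Ico x w) ht ht.1
    have hQx : Q x = 0 := by simp [hQ]
    linarith
  have hHd : ∀ t ∈ Ico x w, HasDerivAt (fun t => F t - F x - (t - x) * (s x * s t))
      (s x * s t ^ 2 * Q t) t := by
    intro t ht
    have ht' := hsub t ht
    have hst := (hspos t ht').ne'
    have hsx := (hspos x hx).ne'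
    have e := ((h1 t ht').sub_const (F x)).sub
      (((hasDerivAt_id t).sub_const x).mul ((hsd t ht').const_mul (s x)))
    refine e.congr_deriv ?_
    rw [← hs2 t ht']
    simp only [id, hQ]
    field_simp
    ring
  have hm := mono_of_hasDeriv' hHd (by
    intro r hr
    have hr' := hsub r (Ioo_subset_Ico_self hr)
    have := hspos r hr'
    have := hspos x hx
    have := hQm r (Ioo_subset_Ico_self hr)
    positivity)
  have hxI : x ∈ Ico x w := ⟨le_rfl, hxy.trans hyw⟩
  have hyI : y ∈ Ico x w := ⟨hxy.le, hyw⟩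
  have key := hm hxI hyI hxy.le
  simp only [sub_self, zero_mul] at key
  have hpos : 0 < (y - x) * (s x * s y) :=
    mul_pos (by linarith) (mul_pos (hspos _ hx) (hspos _ (hsub y hyI)))
  refine ⟨?_, by linarith⟩
  rw [← hs2 x hx, ← hs2 y (hsub y hyI)]
  have : ((y - x) * (s x * s y))^2 ≤ (F y - F x)^2 := pow_le_pow_left₀ hpos.le (by linarith) 2
  linarith [this]

theorem cr_open (h1 : ∀ t ∈ Ioo u w, HasDerivAt F (F1 t) t)
    (h2 : ∀ t ∈ Ioo u w, HasDerivAt F1 (F2 t) t)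
    (h3 : ∀ t ∈ Ioo u w, HasDerivAt F2 (F3 t) t)
    (hp : ∀ t ∈ Ioo u w, 0 < F1 t)
    (hS : ∀ t ∈ Ioo u w, F3 t * F1 t - 3/2 * F2 t ^ 2 ≤ 0)
    {p x y q : ℝ} (hup : u < p) (hpx : p < x) (hxy : x < y) (hyq : y < q) (hqw : q < w) :
    (q - p) * (y - x) * ((F x - F p) * (F q - F y)) ≤
      ((F q - F p) * (F y - F x)) * ((x - p) * (q - y)) := by
  have qd := fun {x y : ℝ} (a : u < x) (b : x < y) (c : y < w) => cr_quad h1 h2 h3 hp hS a b c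
  -- comparison of logarithmic derivatives
  have hw : ∀ t, x < t → t < w →
      F1 t / (F t - F x) - 1 / (t - x) ≤ F1 t / (F t - F p) - 1 / (t - p) := by
    intro t hxt htw
    have hd : ∀ r ∈ Ioo u t, HasDerivAt (fun r => -(F1 t / (F t - F r) - 1 / (t - r)))
        (-(F1 t * F1 r / (F t - F r)^2 - 1 / (t - r)^2)) r := by
      intro r hr
      have hpos := (qd hr.1 hr.2 htw).2
      have h4 : t - r ≠ 0 := by have := hr.2; intro h; linarith
      have e1 := (hasDerivAt_const r (F1 t)).div ((h1 r ⟨hr.1, hr.2.trans htw⟩).const_sub (F t)) hpos.ne'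
      have e2 := (hasDerivAt_const r (1:ℝ)).div ((hasDerivAt_id r).const_sub t) h4
      refine (e1.sub e2).neg.congr_deriv ?_
      simp
    have hm := mono_of_hasDeriv hd (by
      intro r hr
      have q1 := qd hr.1 hr.2 htw
      have h4 : 0 < t - r := by have := hr.2; linarith
      have h5 := q1.2
      have : F1 t * F1 r / (F t - F r)^2 ≤ 1 / (t - r)^2 := by
        rw [div_le_div_iff₀ (by positivity) (by positivity)]
        linarith [q1.1]
      linarith)
    have := hm (⟨hup, hpx.trans hxt⟩ : p ∈ Ioo u t) ⟨hup.trans hpx, hxt⟩ hpx.le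
    simp only at this
    linarith
  have hx : u < x := hup.trans hpx
  set R : ℝ → ℝ := fun t => Real.log (F t - F p) - Real.log (t - p)
    - (Real.log (F t - F x) - Real.log (t - x)) with hR
  have hRd : ∀ t ∈ Ioo x w, HasDerivAt R ((F1 t / (F t - F p) - 1 / (t - p)) -
      (F1 t / (F t - F x) - 1 / (t - x))) t := by
    intro t ht
    have ht' : t ∈ Ioo u w := ⟨hx.trans ht.1, ht.2⟩
    have n1 := (qd hup (hpx.trans ht.1) ht.2).2.ne'
    have n2 := (qd hx ht.1 ht.2).2.ne'
    have n3 : t - p ≠ 0 := by have := ht.1; intro h; linarith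
    have n4 : t - x ≠ 0 := by have := ht.1; intro h; linarith
    exact ((((h1 t ht').sub_const _).log n1).sub (((hasDerivAt_id t).sub_const p).log n3)).sub
      ((((h1 t ht').sub_const _).log n2).sub (((hasDerivAt_id t).sub_const x).log n4))
  have hm := mono_of_hasDeriv hRd (fun t ht => by have := hw t ht.1 ht.2; linarith)
  have key := hm (⟨hxy, hyq.trans hqw⟩ : y ∈ Ioo x w) ⟨hxy.trans hyq, hqw⟩ hyq.le
  simp only [hR] at key
  have a1 := (qd hup (hpx.trans hxy) (hyq.trans hqw)).2
  have a2 := (qd hx hxy (hyq.trans hqw)).2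
  have a3 := (qd hup (hpx.trans (hxy.trans hyq)) hqw).2
  have a4 := (qd hx (hxy.trans hyq) hqw).2
  have b1 : 0 < y - p := by linarith
  have b2 : 0 < y - x := by linarith
  have b3 : 0 < q - p := by linarith
  have b4 : 0 < q - x := by linarith
  have key2 : Real.log ((F y - F p) * (y - x) * ((F q - F x) * (q - p))) ≤
      Real.log ((F q - F p) * (q - x) * ((F y - F x) * (y - p))) := by
    rw [Real.log_mul (by positivity) (by positivity), Real.log_mul (by positivity) (by positivity),
      Real.log_mul (by positivity) (by positivity), Real.log_mul (by positivity) (by positivity),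
      Real.log_mul (by positivity) (by positivity), Real.log_mul (by positivity) (by positivity)]
    linarith
  rw [Real.log_le_log_iff (by positivity) (by positivity)] at key2
  nlinarith [key2]

/-- The 4-point cross-ratio inequality for `h` on `[u,w]`. -/
def CRE (h : ℝ → ℝ) (u w : ℝ) : Prop := ∀ p x y q, u ≤ p → p < x → x < y → y < q → q ≤ w →
  (q - p) * (y - x) * (|h x - h p| * |h q - h y|) ≤
    (|h q - h p| * |h y - h x|) * ((x - p) * (q - y))

theorem CRE.mono {h : ℝ → ℝ} {u w u' w' : ℝ} (H : CRE h u w) (h1 : u ≤ u') (h2 : w' ≤ w) :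
    CRE h u' w' := fun p x y q a b c d e => H p x y q (h1.trans a) b c d (e.trans h2)

theorem cr_closed (hc : Continuous F) (h1 : ∀ t ∈ Ioo u w, HasDerivAt F (F1 t) t)
    (h2 : ∀ t ∈ Ioo u w, HasDerivAt F1 (F2 t) t)
    (h3 : ∀ t ∈ Ioo u w, HasDerivAt F2 (F3 t) t)
    (hp : ∀ t ∈ Ioo u w, 0 < F1 t)
    (hS : ∀ t ∈ Ioo u w, F3 t * F1 t - 3/2 * F2 t ^ 2 ≤ 0) : CRE F u w := by
  intro p x y q hup hpx hxy hyq hqw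
  have main : ∀ᶠ e in nhdsWithin (0:ℝ) (Ioi 0), (q - e - (p + e)) * (y - x) *
      ((|F x - F (p + e)|) * |F (q - e) - F y|) ≤
      (|F (q - e) - F (p + e)| * |F y - F x|) * ((x - (p + e)) * (q - e - y)) := by
    have : Ioo (0:ℝ) (min (x - p) (q - y)) ∈ nhdsWithin (0:ℝ) (Ioi 0) :=
      Ioo_mem_nhdsGT (lt_min (by linarith) (by linarith))
    filter_upwards [this] with e he
    have e1 := he.1
    have e2 := lt_of_lt_of_le he.2 (min_le_left _ _)
    have e3 := lt_of_lt_of_le he.2 (min_le_right _ _)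
    have up : u < p + e := by linarith
    have qw : q - e < w := by linarith
    have px : p + e < x := by linarith
    have yq : y < q - e := by linarith
    have c := cr_open h1 h2 h3 hp hS up px hxy yq qw
    have q1 := (cr_quad h1 h2 h3 hp hS up px (by linarith)).2
    have q2 := (cr_quad h1 h2 h3 hp hS (by linarith) hxy (by linarith : y < w)).2
    have q3 := (cr_quad h1 h2 h3 hp hS (by linarith) yq qw).2
    have q4 : 0 < F (q - e) - F (p + e) := by linarith
    rw [abs_of_pos q1, abs_of_pos q2, abs_of_pos q3, abs_of_pos q4]
    exact c
  have t1 : ContinuousAt (fun e : ℝ => (q - e - (p + e)) * (y - x) *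
      ((|F x - F (p + e)|) * |F (q - e) - F y|)) 0 := by
    apply Continuous.continuousAt; fun_prop
  have t2 : ContinuousAt (fun e : ℝ => (|F (q - e) - F (p + e)| * |F y - F x|) *
      ((x - (p + e)) * (q - e - y))) 0 := by
    apply Continuous.continuousAt; fun_prop
  have := le_of_tendsto_of_tendsto (t1.tendsto.mono_left nhdsWithin_le_nhds)
    (t2.tendsto.mono_left nhdsWithin_le_nhds) main
  simpa using this
end CR

section
variable {f : ℝ → ℝ} {K : Finset ℝ}

theorem MM.cont (M : MM f K) : Continuous f := M.smooth.continuous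
theorem MM.hd (M : MM f K) (x : ℝ) : HasDerivAt f (deriv f x) x :=
  (M.smooth.differentiable (by norm_num) x).hasDerivAt
theorem MM.hd2 (M : MM f K) (x : ℝ) : HasDerivAt (deriv f) (iteratedDeriv 2 f x) x := by
  have h := (M.smooth.differentiable_iteratedDeriv 1 (by norm_num)) x
  rw [iteratedDeriv_succ (n := 1)]
  rw [iteratedDeriv_one] at *
  exact h.hasDerivAt
theorem MM.hd3 (M : MM f K) (x : ℝ) : HasDerivAt (iteratedDeriv 2 f) (iteratedDeriv 3 f x) x := by
  have h := (M.smooth.differentiable_iteratedDeriv 2 (by norm_num)) x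
  rw [iteratedDeriv_succ (n := 2)]
  exact h.hasDerivAt
theorem MM.dcont (M : MM f K) : Continuous (deriv f) := by
  have : Differentiable ℝ (deriv f) := fun x => (M.hd2 x).differentiableAt
  exact this.continuous

theorem MM.signs (M : MM f K) {a b : ℝ} (ha : 0 ≤ a) (hb : b ≤ 1)
    (hK : ∀ z ∈ K, ¬ (a < z ∧ z < b)) :
    (∀ t ∈ Ioo a b, 0 < deriv f t) ∨ (∀ t ∈ Ioo a b, deriv f t < 0) := by
  have := hasDerivWithinAt_forall_lt_or_forall_gt_of_forall_ne (convex_Ioo a b)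
    (f := f) (f' := deriv f) (m := 0) (fun x hx => (M.hd x).hasDerivWithinAt)
    (fun x hx => M.reg x ⟨ha.trans hx.1.le, hx.2.le.trans hb⟩ (fun h => hK x h ⟨hx.1, hx.2⟩))
  exact this.symm

theorem MM.lapmono (M : MM f K) {a b : ℝ} (ha : 0 ≤ a) (hb : b ≤ 1)
    (hK : ∀ z ∈ K, ¬ (a < z ∧ z < b)) :
    StrictMonoOn f (Icc a b) ∨ StrictAntiOn f (Icc a b) := by
  rcases M.signs ha hb hK with h | h
  · left
    apply strictMonoOn_of_deriv_pos (convex_Icc a b) M.cont.continuousOn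
    rw [interior_Icc]; exact h
  · right
    apply strictAntiOn_of_deriv_neg (convex_Icc a b) M.cont.continuousOn
    rw [interior_Icc]; exact h

theorem MM.cre (M : MM f K) {a b : ℝ} (ha : 0 ≤ a) (hb : b ≤ 1)
    (hK : ∀ z ∈ K, ¬ (a < z ∧ z < b)) : CRE f a b := by
  have hS : ∀ t ∈ Ioo a b, iteratedDeriv 3 f t * deriv f t - 3/2 * iteratedDeriv 2 f t ^ 2 ≤ 0 := by
    intro t ht
    have m : t ∈ Icc (0:ℝ) 1 := ⟨ha.trans ht.1.le, ht.2.le.trans hb⟩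
    have n : t ∉ K := fun h => hK t h ⟨ht.1, ht.2⟩
    have h1 := M.sch t m n
    have h2 := M.reg t m n
    unfold schwarzian at h1
    have h3 : iteratedDeriv 3 f t * deriv f t - 3/2 * iteratedDeriv 2 f t ^ 2 =
      (iteratedDeriv 3 f t / deriv f t - 3/2 * (iteratedDeriv 2 f t / deriv f t) ^ 2) * deriv f t ^ 2 := by
      field_simp
    rw [h3]
    exact (mul_neg_of_neg_of_pos h1 (by positivity)).le
  rcases M.signs ha hb hK with h | h
  · exact cr_closed M.cont (fun t _ => M.hd t) (fun t _ => M.hd2 t) (fun t _ => M.hd3 t) h hS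
  · have := cr_closed (F := fun t => - f t) (u := a) (w := b) M.cont.neg (fun t _ => (M.hd t).neg)
      (fun t _ => (M.hd2 t).neg) (fun t _ => (M.hd3 t).neg) (fun t ht => by have := h t ht; linarith)
      (fun t ht => by have := hS t ht; linarith)
    intro p x y q h1 h2 h3 h4 h5
    have := this p x y q h1 h2 h3 h4 h5
    have e : ∀ s t : ℝ, |-s - -t| = |s - t| := fun s t => by rw [← abs_neg]; congr 1; ring
    simpa only [e] using this
end
end WI

namespace WI
section
variable {f : ℝ → ℝ} {K : Finset ℝ}

theorem CRE.comp {g h : ℝ → ℝ} {u w u' w' : ℝ} (hh : CRE h u w) (hg : CRE g u' w')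
    (hm : StrictMonoOn h (Icc u w) ∨ StrictAntiOn h (Icc u w))
    (hmt : MapsTo h (Icc u w) (Icc u' w')) : CRE (fun t => g (h t)) u w := by
  intro p x y q h1 h2 h3 h4 h5
  have mp : p ∈ Icc u w := ⟨h1, by linarith⟩
  have mx : x ∈ Icc u w := ⟨by linarith, by linarith⟩
  have my : y ∈ Icc u w := ⟨by linarith, by linarith⟩
  have mq : q ∈ Icc u w := ⟨by linarith, h5⟩
  have e1 := hh p x y q h1 h2 h3 h4 h5
  have e2 : (|h q - h p| * |h y - h x|) * (|g (h x) - g (h p)| * |g (h q) - g (h y)|) ≤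
    (|g (h q) - g (h p)| * |g (h y) - g (h x)|) * (|h x - h p| * |h q - h y|) := by
    rcases hm with hm | hm
    · have a1 := hm mp mx h2
      have a2 := hm mx my h3
      have a3 := hm my mq h4
      have := hg (h p) (h x) (h y) (h q) (hmt mp).1 a1 a2 a3 (hmt mq).2
      rw [abs_of_pos (by linarith : 0 < h q - h p), abs_of_pos (by linarith : 0 < h y - h x),
        abs_of_pos (by linarith : 0 < h x - h p), abs_of_pos (by linarith : 0 < h q - h y)]
      exact this
    · have a1 := hm mp mx h2
      have a2 := hm mx my h3
      have a3 := hm my mq h4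
      have := hg (h q) (h y) (h x) (h p) (hmt mq).1 a3 a2 a1 (hmt mp).2
      rw [abs_of_neg (by linarith : h q - h p < 0), abs_of_neg (by linarith : h y - h x < 0),
        abs_of_neg (by linarith : h x - h p < 0), abs_of_neg (by linarith : h q - h y < 0),
        abs_sub_comm (g (h q)) (g (h p)), abs_sub_comm (g (h y)) (g (h x)),
        abs_sub_comm (g (h x)) (g (h p)), abs_sub_comm (g (h q)) (g (h y))]
      linarith [this]
  have hA : 0 < |h q - h p| * |h y - h x| := by
    have i : InjOn h (Icc u w) := by rcases hm with hm | hm <;> exact hm.injOn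
    apply mul_pos <;> rw [abs_pos, sub_ne_zero]
    · intro e; have := i mq mp e; linarith
    · intro e; have := i my mx e; linarith
  refine le_of_mul_le_mul_left ?_ hA
  have p1 : 0 ≤ (q - p) * (y - x) := mul_nonneg (by linarith) (by linarith)
  have p2 : 0 ≤ |g (h q) - g (h p)| * |g (h y) - g (h x)| := by positivity
  calc _ = (q - p) * (y - x) * ((|h q - h p| * |h y - h x|) * (|g (h x) - g (h p)| * |g (h q) - g (h y)|)) := by ring
    _ ≤ (q - p) * (y - x) * ((|g (h q) - g (h p)| * |g (h y) - g (h x)|) * (|h x - h p| * |h q - h y|)) :=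
        mul_le_mul_of_nonneg_left e2 p1
    _ = (|g (h q) - g (h p)| * |g (h y) - g (h x)|) * ((q - p) * (y - x) * (|h x - h p| * |h q - h y|)) := by ring
    _ ≤ (|g (h q) - g (h p)| * |g (h y) - g (h x)|) * ((|h q - h p| * |h y - h x|) * ((x - p) * (q - y))) :=
        mul_le_mul_of_nonneg_left e1 p2
    _ = _ := by ring

open Asymptotics Filter Topology

theorem cont_theta {g : ℝ → ℝ} {a : ℝ} (hg : ContinuousAt g a) (h : g a ≠ 0) :
    g =Θ[𝓝 a] (fun _ => (1:ℝ)) := by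
  have : Tendsto (fun x => g x / (fun _ => (1:ℝ)) x) (𝓝 a) (𝓝 (g a)) := by simpa using hg.tendsto
  exact (isTheta_of_div_tendsto_nhds_ne_zero this h).symm

theorem MM.locallaw (M : MM f K) {a : ℝ} (ha : a ∈ Icc (0:ℝ) 1) :
    ∃ d : ℕ, deriv f =Θ[𝓝 a] (fun t => (t - a) ^ d) := by
  by_cases hK : a ∈ K
  · obtain ⟨φ, P, U, hU, hφ, hφ0, hφ', hP⟩ := M.nf a hK
    have hst : HasStrictDerivAt φ (deriv φ 0) 0 :=
      (hφ.contDiffAt).hasStrictDerivAt (by norm_num)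
    have hmap : map φ (𝓝 0) = 𝓝 a := by rw [← hφ0]; exact hst.map_nhds_eq (hφ' 0)
    have hdiff : Differentiable ℝ φ := hφ.differentiable (by norm_num)
    -- chain rule
    have hev : ∀ᶠ t in 𝓝 (0:ℝ), deriv f (φ t) * deriv φ t = P.derivative.eval t := by
      have : ∀ᶠ t in 𝓝 (0:ℝ), ∀ᶠ r in 𝓝 t, f (φ r) = P.eval r :=
        eventually_eventually_nhds.2 (Filter.eventually_of_mem hU hP)
      filter_upwards [this] with t ht
      have h1 := (M.hd (φ t)).comp t (hdiff t).hasDerivAt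
      have h2 : HasDerivAt (f ∘ φ) (P.derivative.eval t) t :=
        (P.hasDerivAt t).congr_of_eventuallyEq ht
      exact h1.unique h2
    have hP0 : P.derivative ≠ 0 := by
      intro h0
      have h1 : ∀ᶠ s in 𝓝 a, deriv f s = 0 := by
        rw [← hmap, eventually_map]
        filter_upwards [hev] with t ht
        rw [h0, Polynomial.eval_zero] at ht
        exact (mul_eq_zero.1 ht).resolve_right (hφ' t)
      have h2 : ∀ᶠ s in 𝓝[≠] a, s ∉ K := by
        have : (↑(K.erase a) : Set ℝ)ᶜ ∈ 𝓝 a :=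
          (K.erase a).finite_toSet.isClosed.isOpen_compl.mem_nhds (by simp)
        filter_upwards [nhdsWithin_le_nhds this, self_mem_nhdsWithin] with s h1 h2 h3
        exact h1 (by simpa using ⟨h3, h2⟩)
      have h3 : ∀ᶠ s in 𝓝[≠] a, s ∈ Icc (0:ℝ) 1 :=
        nhdsWithin_le_nhds (Icc_mem_nhds (M.sub a hK).1 (M.sub a hK).2)
      have h1' : ∀ᶠ s in 𝓝[≠] a, deriv f s = 0 := nhdsWithin_le_nhds h1
      obtain ⟨s, a1, a2, a3⟩ := (h1'.and (h2.and h3)).exists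
      exact M.reg s a3 a2 a1
    obtain ⟨R, hR, hRd⟩ := P.derivative.exists_eq_pow_rootMultiplicity_mul_and_not_dvd hP0 0
    set d := P.derivative.rootMultiplicity 0
    have hR0 : R.eval 0 ≠ 0 := by
      intro h; exact hRd (Polynomial.dvd_iff_isRoot.2 h)
    refine ⟨d, ?_⟩
    have hth1 : (fun t => R.eval t) =Θ[𝓝 0] (fun _ => (1:ℝ)) := cont_theta R.continuous.continuousAt hR0
    have hth2 : deriv φ =Θ[𝓝 0] (fun _ => (1:ℝ)) :=
      cont_theta (hφ.continuous_deriv (by norm_num)).continuousAt (hφ' 0)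
    have hth3 : (fun t => φ t - a) =Θ[𝓝 0] (fun t => t) := by
      have := (hdiff 0).hasDerivAt.isTheta_sub (hφ' 0)
      have := And.intro (isBigO_map.1 (by simpa using this.1)) (isBigO_map.1 (by simpa using this.2))
      simpa [hφ0, IsTheta, Function.comp_def] using this
    have h4 : (fun t => deriv f (φ t)) =Θ[𝓝 0] (fun t => (φ t - a)^d) := by
      have e : (fun t => deriv f (φ t)) =ᶠ[𝓝 0] (fun t => t ^ d * R.eval t / deriv φ t) := by
        filter_upwards [hev] with t ht
        rw [eq_div_iff (hφ' t), ht, hR]; simp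
      have := ((isTheta_refl (fun t : ℝ => t ^ d) (𝓝 0)).mul hth1).div hth2
      simp only [mul_one, div_one] at this
      exact (e.trans_isTheta this).trans (hth3.pow d).symm
    rw [← hmap]
    exact ⟨isBigO_map.2 h4.1, isBigO_map.2 h4.2⟩
  · exact ⟨0, by simpa using cont_theta M.dcont.continuousAt (M.reg a ha hK)⟩

theorem MM.lawc (M : MM f K) {a : ℝ} (ha : a ∈ Icc (0:ℝ) 1) :
    ∃ d : ℕ, ∃ A r : ℝ, 0 < A ∧ 0 < r ∧ ∀ t, |t - a| < r →
      |deriv f t| ≤ A * |t - a| ^ d ∧ |t - a| ^ d ≤ A * |deriv f t| := by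
  obtain ⟨d, h1, h2⟩ := M.locallaw ha
  obtain ⟨A1, p1, h1⟩ := h1.exists_pos
  obtain ⟨A2, p2, h2⟩ := h2.exists_pos
  rw [isBigOWith_iff] at h1 h2
  obtain ⟨r, hr, h⟩ := Metric.eventually_nhds_iff.1 (h1.and h2)
  refine ⟨d, max A1 A2, r, lt_max_of_lt_left p1, hr, fun t ht => ?_⟩
  have := h (y := t) (by rwa [Real.dist_eq])
  simp only [Real.norm_eq_abs, abs_pow] at this
  refine ⟨this.1.trans ?_, this.2.trans ?_⟩ <;> gcongr
  · exact le_max_left _ _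
  · exact le_max_right _ _

/-- absolute image length monotone in the interval -/
theorem abs_mono {g : ℝ → ℝ} {a b p x y q : ℝ}
    (hm : StrictMonoOn g (Icc a b) ∨ StrictAntiOn g (Icc a b))
    (h1 : a ≤ p) (h2 : p ≤ x) (h3 : x ≤ y) (h4 : y ≤ q) (h5 : q ≤ b) :
    |g y - g x| ≤ |g q - g p| := by
  have mp : p ∈ Icc a b := ⟨h1, by linarith⟩
  have mx : x ∈ Icc a b := ⟨by linarith, by linarith⟩
  have my : y ∈ Icc a b := ⟨by linarith, by linarith⟩
  have mq : q ∈ Icc a b := ⟨by linarith, h5⟩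
  rcases hm with hm | hm
  · have a1 := hm.monotoneOn mp mx h2
    have a2 := hm.monotoneOn mx my h3
    have a3 := hm.monotoneOn my mq h4
    rw [abs_of_nonneg (by linarith), abs_of_nonneg (by linarith)]; linarith
  · have a1 := hm.antitoneOn mp mx h2
    have a2 := hm.antitoneOn mx my h3
    have a3 := hm.antitoneOn my mq h4
    rw [abs_of_nonpos (by linarith), abs_of_nonpos (by linarith)]; linarith

theorem MM.lip (M : MM f K) : ∃ L : ℝ, 1 ≤ L ∧ (∀ z ∈ Icc (0:ℝ) 1, |deriv f z| ≤ L) ∧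
    ∀ s ∈ Icc (0:ℝ) 1, ∀ t ∈ Icc (0:ℝ) 1, |f s - f t| ≤ L * |s - t| := by
  obtain ⟨L, hL⟩ := isCompact_Icc.exists_bound_of_continuousOn (M.dcont.continuousOn (s := Icc (0:ℝ) 1))
  refine ⟨max L 1, le_max_right _ _, fun z hz => (hL z hz).trans (le_max_left _ _), fun s hs t ht => ?_⟩
  have := (convex_Icc (0:ℝ) 1).norm_image_sub_le_of_norm_deriv_le (f := f) (C := max L 1)
    (fun x _ => (M.hd x).differentiableAt) (fun x hx => (hL x hx).trans (le_max_left _ _)) ht hs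
  simpa using this

theorem MM.dist_local (M : MM f K) {a : ℝ} (ha : a ∈ Icc (0:ℝ) 1) :
    ∃ C r : ℝ, 0 < r ∧ ∀ x y, 0 ≤ x → x < y → y ≤ 1 → (∀ z ∈ K, ¬ (x < z ∧ z < y)) →
      |x - a| < r → |y - a| < r → ∀ z, x - (y - x) ≤ z → z ≤ y + (y - x) →
      |deriv f z| * (y - x) ≤ C * |f y - f x| := by
  obtain ⟨d, A, r, hA, hr, hlaw⟩ := M.lawc ha
  refine ⟨A * A * 6 ^ d * 4, r / 3, by positivity, ?_⟩
  intro x y hx hxy hy hK hxr hyr z hz1 hz2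
  set D := max |x - a| |y - a| with hD
  have hs : y - x ≤ 2 * D := by
    have h1 : |x - a| ≤ D := le_max_left _ _
    have h2 : |y - a| ≤ D := le_max_right _ _
    have := abs_le.1 h1; have := abs_le.1 h2; linarith
  have hDr : D < r / 3 := max_lt hxr hyr
  have hzD : |z - a| ≤ 3 * D := by
    have h1 : |x - a| ≤ D := le_max_left _ _
    have h2 : |y - a| ≤ D := le_max_right _ _
    have h1 := abs_le.1 h1; have h2 := abs_le.1 h2
    rw [abs_le]; constructor <;> linarith [h1.1, h1.2, h2.1, h2.2]
  have hD0 : 0 < D := by linarith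
  have hup : |deriv f z| ≤ A * (3 * D) ^ d := by
    refine (hlaw z (by linarith)).1.trans ?_
    gcongr
  -- the outer piece
  have hlow : (D / 2) ^ d * ((y - x) / 4) ≤ A * |f y - f x| := by
    have hlm := M.lapmono hx hy hK
    have piece : ∀ m n, x ≤ m → m < n → n ≤ y → n - m = (y - x) / 4 →
        (∀ t ∈ Ioo m n, D / 2 ≤ |t - a|) → (D / 2) ^ d * ((y - x) / 4) ≤ A * |f y - f x| := by
      intro m n h1 h2 h3 h4 h5
      obtain ⟨ξ, hξ, he⟩ := exists_deriv_eq_slope f h2 M.cont.continuousOn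
        (fun t _ => (M.hd t).differentiableAt.differentiableWithinAt)
      have h6 : |f n - f m| = |deriv f ξ| * (n - m) := by
        rw [he, abs_div, abs_of_pos (by linarith : 0 < n - m), div_mul_cancel₀]
        exact (by linarith : 0 < n - m).ne'
      have h7 := abs_mono hlm le_rfl h1 h2.le h3 le_rfl
      have h8 : |ξ - a| < r := by
        have g1 : |x - a| ≤ D := le_max_left _ _
        have g2 : |y - a| ≤ D := le_max_right _ _
        have g1 := abs_le.1 g1; have g2 := abs_le.1 g2
        have := hξ.1; have := hξ.2
        rw [abs_lt]; constructor <;> linarith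
      have h9 := (hlaw ξ h8).2
      have h10 : (D/2)^d ≤ |ξ - a| ^ d := by gcongr; exact h5 ξ hξ
      calc (D / 2) ^ d * ((y - x) / 4) ≤ (A * |deriv f ξ|) * ((y - x)/4) := by
            apply mul_le_mul_of_nonneg_right (h10.trans h9); linarith
        _ = A * |f n - f m| := by rw [h6, h4]; ring
        _ ≤ _ := by gcongr
    rcases le_total |x - a| |y - a| with h | h
    · have hDy : D = |y - a| := max_eq_right h
      have hya : a < y := by
        by_contra hc
        rw [abs_of_nonpos (by linarith), abs_of_nonpos (by linarith)] at h
        linarith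
      rw [abs_of_pos (by linarith)] at hDy
      refine piece (y - (y-x)/4) y (by linarith) (by linarith) le_rfl (by ring) ?_
      intro t ht
      have := ht.1
      exact le_trans (by linarith) (le_abs_self _)
    · have hDy : D = |x - a| := max_eq_left h
      have hya : x < a := by
        by_contra hc
        rw [abs_of_nonneg (by linarith), abs_of_nonneg (by linarith)] at h
        linarith
      rw [abs_of_neg (by linarith)] at hDy
      refine piece x (x + (y-x)/4) (by linarith) (by linarith) (by linarith) (by ring) ?_
      intro t ht
      have := ht.2
      exact le_trans (by linarith) (neg_le_abs _)
  have e : (3 * D)^d = 6 ^ d * (D/2)^d := by rw [← mul_pow]; congr 1; ring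
  calc |deriv f z| * (y - x) ≤ A * (3 * D) ^ d * (y - x) := by
        apply mul_le_mul_of_nonneg_right hup; linarith
    _ = A * 6 ^ d * 4 * ((D/2)^d * ((y - x)/4)) := by rw [e]; ring
    _ ≤ A * 6 ^ d * 4 * (A * |f y - f x|) := by gcongr
    _ = _ := by ring

theorem MM.dist (M : MM f K) : ∃ C : ℝ, 1 ≤ C ∧ ∀ x y, 0 ≤ x → x < y → y ≤ 1 →
    (∀ z ∈ K, ¬ (x < z ∧ z < y)) → ∀ z ∈ Icc (0:ℝ) 1, x - (y - x) ≤ z → z ≤ y + (y - x) →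
      |deriv f z| * (y - x) ≤ C * |f y - f x| := by
  obtain ⟨L, hL1, hL, -⟩ := M.lip
  let p : Set (ℝ × ℝ) → Prop := fun S => ∃ C : ℝ, 1 ≤ C ∧ ∀ q ∈ S, 0 ≤ q.1 → q.1 < q.2 → q.2 ≤ 1 →
    (∀ z ∈ K, ¬ (q.1 < z ∧ z < q.2)) → ∀ z ∈ Icc (0:ℝ) 1, q.1 - (q.2 - q.1) ≤ z →
      z ≤ q.2 + (q.2 - q.1) → |deriv f z| * (q.2 - q.1) ≤ C * |f q.2 - f q.1|
  have key : p (Icc (0:ℝ) 1 ×ˢ Icc (0:ℝ) 1) := by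
    refine (isCompact_Icc.prod isCompact_Icc).induction_on (p := p) ?_ ?_ ?_ ?_
    · exact ⟨1, le_rfl, by simp⟩
    · rintro s t hst ⟨C, h1, h2⟩
      exact ⟨C, h1, fun q hq => h2 q (hst hq)⟩
    · rintro s t ⟨C, h1, h2⟩ ⟨C', h1', h2'⟩
      refine ⟨max C C', h1.trans (le_max_left _ _), ?_⟩
      rintro q (hq | hq) a b c d z e g h
      · exact (h2 q hq a b c d z e g h).trans (by gcongr; exact le_max_left _ _)
      · exact (h2' q hq a b c d z e g h).trans (by gcongr; exact le_max_right _ _)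
    · rintro ⟨a, b⟩ ⟨ha, hb⟩
      simp only at ha hb
      rcases lt_trichotomy a b with hab | hab | hab
      · by_cases hK : ∃ z ∈ K, a < z ∧ z < b
        · obtain ⟨z, hz, h1, h2⟩ := hK
          refine ⟨Iio z ×ˢ Ioi z, mem_nhdsWithin_of_mem_nhds
            (prod_mem_nhds (Iio_mem_nhds h1) (Ioi_mem_nhds h2)), 1, le_rfl, ?_⟩
          rintro q ⟨h3, h4⟩ _ _ _ h5
          exact absurd ⟨h3, h4⟩ (h5 z hz)
        · push Not at hK
          have hl := M.lapmono ha.1 hb.2 (fun z hz h => by have := hK z hz h.1; linarith [h.2])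
          have hne : 0 < |f b - f a| := by
            rw [abs_pos, sub_ne_zero]
            have i : InjOn f (Icc a b) := by rcases hl with hm | hm <;> exact hm.injOn
            intro e; have := i (right_mem_Icc.2 hab.le) (left_mem_Icc.2 hab.le) e; linarith
          have hc : ContinuousAt (fun q : ℝ × ℝ => |f q.2 - f q.1|) (a, b) := by
            have := M.cont
            apply Continuous.continuousAt; fun_prop
          have hev : ∀ᶠ q in 𝓝 (a, b), |f b - f a| / 2 < |f q.2 - f q.1| :=
            hc.eventually (lt_mem_nhds (by simpa using hne))
          refine ⟨_, mem_nhdsWithin_of_mem_nhds hev, max 1 (L * 2 / |f b - f a|), le_max_left _ _, ?_⟩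
          intro q hq h1 h2 h3 h4 z hz h5 h6
          change |f b - f a| / 2 < |f q.2 - f q.1| at hq
          calc |deriv f z| * (q.2 - q.1) ≤ L * 1 := by
                apply mul_le_mul (hL z hz) (by linarith) (by linarith) (by linarith)
            _ = L * 2 / |f b - f a| * (|f b - f a| / 2) := by field_simp
            _ ≤ max 1 (L * 2 / |f b - f a|) * |f q.2 - f q.1| := by
                apply mul_le_mul (le_max_right _ _) hq.le (by positivity)
                exact le_trans zero_le_one (le_max_left _ _)
      · subst hab
        obtain ⟨C, r, hr, h⟩ := M.dist_local ha
        refine ⟨ball a r ×ˢ ball a r, mem_nhdsWithin_of_mem_nhds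
            (prod_mem_nhds (ball_mem_nhds a hr) (ball_mem_nhds a hr)), max 1 C, le_max_left _ _, ?_⟩
        rintro q ⟨h3, h4⟩ h5 h6 h7 h8 z _ h9 h10
        rw [mem_ball, Real.dist_eq] at h3 h4
        exact (h q.1 q.2 h5 h6 h7 h8 h3 h4 z h9 h10).trans (by gcongr; exact le_max_right _ _)
      · obtain ⟨z, h1, h2⟩ := exists_between hab
        refine ⟨Ioi z ×ˢ Iio z, mem_nhdsWithin_of_mem_nhds
            (prod_mem_nhds (Ioi_mem_nhds h2) (Iio_mem_nhds h1)), 1, le_rfl, ?_⟩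
        rintro q ⟨h3, h4⟩ _ h5
        simp only [mem_Ioi, mem_Iio] at h3 h4
        linarith
  obtain ⟨C, h1, h2⟩ := key
  exact ⟨C, h1, fun x y a b c d z e g h =>
    h2 (x, y) ⟨⟨a, by simp only; linarith⟩, ⟨by simp only; linarith, c⟩⟩ a b c d z e g h⟩

/-- Consequence of the distortion bound via the mean value theorem. -/
theorem MM.dist2 (M : MM f K) : ∃ C : ℝ, 1 ≤ C ∧ ∀ x y, 0 ≤ x → x < y → y ≤ 1 →
    (∀ z ∈ K, ¬ (x < z ∧ z < y)) → ∀ s ∈ Icc (0:ℝ) 1, ∀ t ∈ Icc (0:ℝ) 1,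
      x - (y - x) ≤ s → s ≤ y + (y - x) → x - (y - x) ≤ t → t ≤ y + (y - x) →
      |f s - f t| * (y - x) ≤ C * |f y - f x| * |s - t| := by
  obtain ⟨C, hC, h⟩ := M.dist
  refine ⟨C, hC, fun x y hx hxy hy hK s hs t ht h1 h2 h3 h4 => ?_⟩
  have h5 : ∀ z ∈ Icc (max 0 (x - (y - x))) (min 1 (y + (y - x))),
      ‖deriv f z‖ ≤ C * |f y - f x| / (y - x) := by
    intro z hz
    rw [le_div_iff₀ (by linarith), Real.norm_eq_abs]
    exact h x y hx hxy hy hK z ⟨(le_max_left _ _).trans hz.1, hz.2.trans (min_le_left _ _)⟩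
      ((le_max_right _ _).trans hz.1) (hz.2.trans (min_le_right _ _))
  have := (convex_Icc _ _).norm_image_sub_le_of_norm_deriv_le (f := f)
    (fun x _ => (M.hd x).differentiableAt) h5 (x := t) (y := s)
    ⟨max_le ht.1 h3, le_min ht.2 h4⟩ ⟨max_le hs.1 h1, le_min hs.2 h2⟩
  rw [Real.norm_eq_abs, Real.norm_eq_abs, div_mul_eq_mul_div, le_div_iff₀ (by linarith)] at this
  exact this
end
end WI

namespace WI
section
variable {f : ℝ → ℝ} {K : Finset ℝ}
open Filter Topology

theorem MM.itmaps (M : MM f K) (n : ℕ) : MapsTo (f^[n]) (Icc 0 1) (Icc 0 1) := M.maps.iterate n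
theorem MM.itcont (M : MM f K) (n : ℕ) : Continuous (f^[n]) := M.cont.iterate n
theorem MM.itdiff (M : MM f K) (n : ℕ) : Differentiable ℝ (f^[n]) :=
  Differentiable.iterate (M.smooth.differentiable (by norm_num)) n

theorem MM.itlip (M : MM f K) : ∃ L : ℝ, 1 ≤ L ∧ ∀ n, ∀ s ∈ Icc (0:ℝ) 1, ∀ t ∈ Icc (0:ℝ) 1,
    |f^[n] s - f^[n] t| ≤ L ^ n * |s - t| := by
  obtain ⟨L, h1, -, h2⟩ := M.lip
  refine ⟨L, h1, fun n => ?_⟩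
  induction n with
  | zero => intro s _ t _; simp
  | succ n ih =>
    intro s hs t ht
    rw [Function.iterate_succ_apply', Function.iterate_succ_apply']
    refine (h2 _ (M.itmaps n hs) _ (M.itmaps n ht)).trans ?_
    rw [pow_succ, mul_comm (L ^ n), mul_assoc]
    exact mul_le_mul_of_nonneg_left (ih s hs t ht) (by linarith)

/-- no iterate of `Y` crosses a critical point. -/
def NC (f : ℝ → ℝ) (K : Finset ℝ) (Y : Set ℝ) : Prop :=
  ∀ t, ∀ a ∈ Y, ∀ b ∈ Y, ∀ z ∈ K, ¬ (f^[t] a < z ∧ z < f^[t] b)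

theorem NC.mono {Y Z : Set ℝ} (h : NC f K Z) (hs : Y ⊆ Z) : NC f K Y :=
  fun t a ha b hb => h t a (hs ha) b (hs hb)

theorem NC.image {Y : Set ℝ} (h : NC f K Y) : NC f K (f '' Y) := by
  rintro t _ ⟨a, ha, rfl⟩ _ ⟨b, hb, rfl⟩ z hz hc
  exact h (t+1) a ha b hb z hz hc

theorem MM.nc_mono (M : MM f K) {Y : Set ℝ} (hY : Y ⊆ Icc 0 1) (h : NC f K Y) (t : ℕ) :
    StrictMonoOn (f^[t]) Y ∨ StrictAntiOn (f^[t]) Y := by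
  induction t with
  | zero => left; intro a _ b _ hab; simpa using hab
  | succ t ih =>
    rcases Y.eq_empty_or_nonempty with rfl | ⟨p, hp⟩
    · left; intro a ha; exact absurd ha (by simp)
    set Z := f^[t] '' Y
    have hZ : Z ⊆ Icc 0 1 := by rintro _ ⟨a, ha, rfl⟩; exact M.itmaps t (hY ha)
    have hne : Z.Nonempty := ⟨_, p, hp, rfl⟩
    have hb : BddBelow Z := ⟨0, fun a ha => (hZ ha).1⟩
    have ha : BddAbove Z := ⟨1, fun a ha => (hZ ha).2⟩
    have hl := M.lapmono (a := sInf Z) (b := sSup Z) (le_csInf hne fun a ha => (hZ ha).1)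
      (csSup_le hne fun a ha => (hZ ha).2) (by
        rintro z hz ⟨h1, h2⟩
        obtain ⟨_, ⟨a, ha', rfl⟩, h3⟩ := exists_lt_of_csInf_lt hne h1
        obtain ⟨_, ⟨b, hb', rfl⟩, h4⟩ := exists_lt_of_lt_csSup hne h2
        exact h t a ha' b hb' z hz ⟨h3, h4⟩)
    have hm : MapsTo (f^[t]) Y (Icc (sInf Z) (sSup Z)) := fun a ha' =>
      ⟨csInf_le hb ⟨a, ha', rfl⟩, le_csSup ha ⟨a, ha', rfl⟩⟩
    rw [Function.iterate_succ']
    rcases hl with hl | hl <;> rcases ih with ih | ih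
    · left; exact hl.comp ih hm
    · right; exact hl.comp_strictAntiOn ih hm
    · right; exact hl.comp_strictMonoOn ih hm
    · left; exact hl.comp ih hm

theorem expand {G : ℝ → ℝ} {D z : ℝ} (h : HasDerivAt G D z) (hD : 1 < |D|) :
    ∃ r lam : ℝ, 0 < r ∧ 1 < lam ∧ ∀ t, |t - z| < r → lam * |t - z| ≤ |G t - G z| := by
  have h1 : 0 < (|D| - 1) / 2 := by linarith
  have h2 := (hasDerivAt_iff_isLittleO.1 h).def h1
  obtain ⟨r, hr, h3⟩ := Metric.eventually_nhds_iff.1 h2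
  refine ⟨r, (|D| + 1) / 2, hr, by linarith, fun t ht => ?_⟩
  have h4 := h3 (y := t) (by rwa [Real.dist_eq])
  simp only [Real.norm_eq_abs, smul_eq_mul] at h4
  have h5 : |(t - z) * D| ≤ |G t - G z| + |G t - G z - (t - z) * D| := by
    have := abs_sub (G t - G z) (G t - G z - (t - z) * D)
    simpa using this
  rw [abs_mul] at h5
  nlinarith [abs_nonneg (t - z)]

theorem MM.expand (M : MM f K) {z : ℝ} (hz : z ∈ Icc (0:ℝ) 1) {n : ℕ} (hn : 1 ≤ n)
    (h : f^[n] z = z) :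
    ∃ r lam : ℝ, 0 < r ∧ 1 < lam ∧ ∀ t, |t - z| < r → lam * |t - z| ≤ |f^[n] t - z| := by
  have := WI.expand (M.itdiff n z).hasDerivAt (M.rep z hz n hn h)
  rwa [h] at this

theorem MM.lemmaP (M : MM f K) {Y : Set ℝ} (hY : Y ⊆ Icc 0 1) (hc : Y.OrdConnected)
    {a b : ℝ} (ha : a ∈ Y) (hb : b ∈ Y) (hab : a < b) (h : NC f K Y) {m : ℕ} (hm : 1 ≤ m)
    (hmt : MapsTo (f^[m]) Y Y) : False := by
  have hG : MapsTo (f^[m+m]) Y Y := by rw [Function.iterate_add]; exact hmt.comp hmt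
  have hGm : StrictMonoOn (f^[m+m]) Y := by
    rw [Function.iterate_add]
    rcases M.nc_mono hY h m with h1 | h1
    · exact h1.comp h1 hmt
    · exact h1.comp h1 hmt
  by_cases hid : ∀ s ∈ Y, f^[m+m] s = s
  · obtain ⟨p, h1, h2⟩ := exists_between hab
    have hpY : p ∈ Y := hc.out ha hb ⟨h1.le, h2.le⟩
    obtain ⟨r, lam, hr, hl, he⟩ := M.expand (hY hpY) (by omega : 1 ≤ m + m) (hid p hpY)
    have hq : p + min (r / 2) (b - p) ∈ Y :=
      hc.out ha hb ⟨by have : 0 < min (r/2) (b-p) := lt_min (by linarith) (by linarith); linarith,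
        by have := min_le_right (r/2) (b-p); linarith⟩
    have hpos : 0 < min (r/2) (b-p) := lt_min (by linarith) (by linarith)
    have := he (p + min (r / 2) (b - p)) (by
      rw [add_sub_cancel_left, abs_of_pos hpos]; have := min_le_left (r/2) (b-p); linarith)
    rw [hid _ hq, add_sub_cancel_left, abs_of_pos hpos] at this
    nlinarith
  · push Not at hid
    obtain ⟨s, hs, hne⟩ := hid
    set G := f^[m+m]
    set q : ℕ → ℝ := fun i => G^[i] s with hq
    have hqY : ∀ i, q i ∈ Y := fun i => hG.iterate i hs
    have hqs : ∀ i, q (i+1) = G (q i) := fun i => Function.iterate_succ_apply' _ _ _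
    have fin : ∀ z, Tendsto q atTop (𝓝 z) → (∀ i, q i ≠ z) → (∀ i, |q (i+1) - z| ≤ |q i - z|) →
        z ∈ Icc (0:ℝ) 1 → False := by
      intro z hz h1 h2 h3
      have hfix : G z = z := by
        have e1 : Tendsto (fun i => q (i+1)) atTop (𝓝 z) := (tendsto_add_atTop_iff_nat 1).2 hz
        have e2 : Tendsto (fun i => G (q i)) atTop (𝓝 (G z)) :=
          ((M.itcont _).tendsto z).comp hz
        simp_rw [hqs] at e1
        exact tendsto_nhds_unique e2 e1
      obtain ⟨r, lam, hr, hl, he⟩ := M.expand h3 (by omega : 1 ≤ m + m) hfix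
      obtain ⟨i, hi⟩ := (Metric.tendsto_nhds.1 hz r hr).exists
      rw [Real.dist_eq] at hi
      have e3 := he _ hi
      have e4 := h2 i
      rw [hqs] at e4
      have : 0 < |q i - z| := abs_pos.2 (sub_ne_zero.2 (h1 i))
      nlinarith
    rcases lt_or_gt_of_ne hne with hlt | hgt
    · have hanti : StrictAnti q := strictAnti_nat_of_succ_lt fun i => by
        induction i with
        | zero => rw [hqs]; exact hlt
        | succ i ih =>
          rw [hqs (i+1)]
          have := hGm (hqY _) (hqY _) ih
          rwa [← hqs i] at this
      have hbdd : BddBelow (range q) := ⟨0, by rintro _ ⟨i, rfl⟩; exact (hY (hqY i)).1⟩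
      have ht := tendsto_atTop_ciInf hanti.antitone hbdd
      have hlt' : ∀ i, (⨅ i, q i) < q i := fun i =>
        lt_of_le_of_lt (ciInf_le hbdd (i+1)) (hanti (Nat.lt_succ_self i))
      refine fin _ ht (fun i => (hlt' i).ne') (fun i => ?_) ?_
      · rw [abs_of_pos (sub_pos.2 (hlt' _)), abs_of_pos (sub_pos.2 (hlt' _))]
        have := hanti (Nat.lt_succ_self i); simp only [Nat.succ_eq_add_one] at this; linarith
      · exact isClosed_Icc.mem_of_tendsto ht (Eventually.of_forall fun i => hY (hqY i))
    · have hmono : StrictMono q := strictMono_nat_of_lt_succ fun i => by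
        induction i with
        | zero => rw [hqs]; exact hgt
        | succ i ih =>
          rw [hqs (i+1)]
          have := hGm (hqY _) (hqY _) ih
          rwa [← hqs i] at this
      have hbdd : BddAbove (range q) := ⟨1, by rintro _ ⟨i, rfl⟩; exact (hY (hqY i)).2⟩
      have ht := tendsto_atTop_ciSup hmono.monotone hbdd
      have hlt' : ∀ i, q i < (⨆ i, q i) := fun i =>
        lt_of_lt_of_le (hmono (Nat.lt_succ_self i)) (le_ciSup hbdd (i+1))
      refine fin _ ht (fun i => (hlt' i).ne) (fun i => ?_) ?_
      · rw [abs_of_neg (sub_neg.2 (hlt' _)), abs_of_neg (sub_neg.2 (hlt' _))]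
        have := hmono (Nat.lt_succ_self i); simp only [Nat.succ_eq_add_one] at this; linarith
      · exact isClosed_Icc.mem_of_tendsto ht (Eventually.of_forall fun i => hY (hqY i))

theorem exists_gap (K : Finset ℝ) (a : ℝ) : ∃ e > 0, ∀ z ∈ K, ¬ (a < z ∧ z < a + e) := by
  have : (↑(K.erase a) : Set ℝ)ᶜ ∈ 𝓝 a :=
    (K.erase a).finite_toSet.isClosed.isOpen_compl.mem_nhds (by simp)
  obtain ⟨e, he, h⟩ := Metric.mem_nhds_iff.1 this
  refine ⟨e, he, fun z hz ⟨h1, h2⟩ => ?_⟩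
  have := h (show z ∈ ball a e by rw [mem_ball, Real.dist_eq, abs_of_pos] <;> linarith)
  exact this (by simp [hz, ne_of_gt h1])

/-- iterates are not constant on nondegenerate intervals -/
theorem MM.nonconst (M : MM f K) (n : ℕ) : ∀ a b, 0 ≤ a → a < b → b ≤ 1 →
    ∃ s ∈ Icc a b, f^[n] s ≠ f^[n] a := by
  induction n with
  | zero => intro a b _ hab _; exact ⟨b, right_mem_Icc.2 hab.le, by simpa using hab.ne'⟩
  | succ n ih =>
    intro a b ha hab hb
    obtain ⟨e, he, h⟩ := exists_gap K a
    set b' := min b (a + e)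
    have hb' : a < b' := lt_min hab (by linarith)
    have hl := M.lapmono ha ((min_le_left _ _).trans hb : b' ≤ 1)
      (fun z hz hc => h z hz ⟨hc.1, hc.2.trans_le (min_le_right _ _)⟩)
    have sub : Icc a b' ⊆ Icc a b := Icc_subset_Icc_right (min_le_left _ _)
    have hbm : f b' ∈ Icc (0:ℝ) 1 := M.maps ⟨ha.trans hb'.le, (min_le_left _ _).trans hb⟩
    have ham : f a ∈ Icc (0:ℝ) 1 := M.maps ⟨ha, hab.le.trans hb⟩
    have iv := intermediate_value_uIcc (M.cont.continuousOn (s := uIcc a b'))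
    rw [uIcc_of_le hb'.le] at iv
    rcases hl with hl | hl
    · have lt := hl (left_mem_Icc.2 hb'.le) (right_mem_Icc.2 hb'.le) hb'
      rw [uIcc_of_le lt.le] at iv
      obtain ⟨s, hs, hne⟩ := ih (f a) (f b') ham.1 lt hbm.2
      obtain ⟨r, hr, rfl⟩ := iv hs
      exact ⟨r, sub hr, hne⟩
    · have lt := hl (left_mem_Icc.2 hb'.le) (right_mem_Icc.2 hb'.le) hb'
      by_contra hcon
      push Not at hcon
      rw [uIcc_of_ge lt.le] at iv
      obtain ⟨s, hs, hne⟩ := ih (f b') (f a) hbm.1 lt ham.2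
      obtain ⟨r, hr, rfl⟩ := iv hs
      exact hne ((hcon r (sub hr)).trans (hcon b' (sub (right_mem_Icc.2 hb'.le))).symm)

/-- the `k`-th image of `S` has diameter less than `e`. -/
def Sm (f : ℝ → ℝ) (S : Set ℝ) (k : ℕ) (e : ℝ) : Prop :=
  ∀ a ∈ S, ∀ b ∈ S, |f^[k] a - f^[k] b| < e

theorem Sm.mono {S S' : Set ℝ} {k : ℕ} {e : ℝ} (h : Sm f S' k e) (hs : S ⊆ S') : Sm f S k e :=
  fun a ha b hb => h a (hs ha) b (hs hb)

theorem MM.cp (M : MM f K) {a b : ℝ} (ha : 0 ≤ a) (hab : a < b) (hb : b ≤ 1) {r p : ℕ} (hp : 1 ≤ p)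
    {s0 t0 : ℝ} (hs0 : s0 ∈ Icc a b) (ht0 : t0 ∈ Icc a b) (heq : f^[r] s0 = f^[r+p] t0)
    (hsm : ∀ e > 0, ∃ k, Sm f (Icc a b) k e) : False := by
  obtain ⟨L, hL, hLip⟩ := M.itlip
  have sub : Icc a b ⊆ Icc 0 1 := Icc_subset_Icc ha hb
  -- small images along the arithmetic progression
  have small : ∀ e > 0, ∃ j, Sm f (Icc a b) (r + p * j) e := by
    intro e he
    obtain ⟨k, hk⟩ := hsm (e / L ^ (r + p)) (by positivity)
    refine ⟨k / p + 1, fun s hs t ht => ?_⟩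
    have h1 : r + p * (k / p + 1) = (r + (p - k % p)) + k := by
      have := Nat.div_add_mod k p
      have := Nat.mod_lt k hp
      rw [Nat.mul_add]; omega
    rw [h1, Function.iterate_add_apply, Function.iterate_add_apply (f) _ k]
    refine (hLip _ _ (M.itmaps k (sub hs)) _ (M.itmaps k (sub ht))).trans_lt ?_
    have h2 := hk s hs t ht
    rw [lt_div_iff₀ (by positivity)] at h2
    have h3 : L ^ (r + (p - k % p)) ≤ L ^ (r + p) := pow_le_pow_right₀ hL (by omega)
    nlinarith [abs_nonneg (f^[k] s - f^[k] t)]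
  choose j hj using fun n : ℕ => small (1 / ((n:ℝ) + 1)) (by positivity)
  have haI : a ∈ Icc a b := left_mem_Icc.2 hab.le
  obtain ⟨z, hz, φ, hφ, hlim⟩ := isCompact_Icc.tendsto_subseq
    (fun n => M.itmaps (r + p * j n) (sub haI))
  -- the images accumulate on z
  have acc : ∀ e > 0, ∃ n, ∀ t ∈ Icc a b, |f^[r + p * j n] t - z| < e := by
    intro e he
    have h1 := Metric.tendsto_nhds.1 hlim (e/2) (by linarith)
    have h2 : ∀ᶠ n in atTop, 1 / (((φ n : ℕ):ℝ) + 1) < e / 2 :=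
      hφ.tendsto_atTop.eventually (tendsto_one_div_add_atTop_nhds_zero_nat.eventually (gt_mem_nhds (by linarith)))
    obtain ⟨n, h3, h4⟩ := (h1.and h2).exists
    refine ⟨φ n, fun t ht => ?_⟩
    have h5 := hj (φ n) t ht a haI
    rw [Real.dist_eq] at h3
    have := abs_sub_le (f^[r + p * j (φ n)] t) (f^[r + p * j (φ n)] a) z
    simp only [Function.comp] at h3
    linarith
  -- consecutive images intersect
  have inter : ∀ i, f^[r + p * i] s0 = f^[p] (f^[r + p * i] t0) := by
    intro i
    rw [← Function.iterate_add_apply, show p + (r + p * i) = p * i + (r + p) by ring,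
      show r + p * i = p * i + r by ring, Function.iterate_add_apply, heq,
      ← Function.iterate_add_apply]
  have hfix : f^[p] z = z := by
    by_contra hne
    have hd : 0 < |f^[p] z - z| := abs_pos.2 (sub_ne_zero.2 hne)
    obtain ⟨e, he, hc⟩ := Metric.continuous_iff.1 (M.itcont p) z (|f^[p] z - z| / 2) (by linarith)
    obtain ⟨n, hn⟩ := acc (min e (|f^[p] z - z| / 2)) (lt_min he (by linarith))
    have h1 := hn s0 hs0
    have h2 := hc _ (by rw [Real.dist_eq]; exact (hn t0 ht0).trans_le (min_le_left _ _))
    rw [← inter, Real.dist_eq] at h2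
    have h3 := h1.trans_le (min_le_right _ _)
    have := abs_sub_le (f^[p] z) (f^[r + p * j n] s0) z
    rw [abs_sub_comm (f^[p] z) (f^[r + p * j n] s0)] at this
    linarith
  obtain ⟨R, lam, hR, hlam, hexp⟩ := M.expand hz hp hfix
  have down : ∀ e, 0 < e → e < R → ∀ i, (∀ t ∈ Icc a b, |f^[r + p * i] t - z| < e) →
      ∀ t ∈ Icc a b, |f^[r] t - z| < e := by
    intro e he heR i
    induction i with
    | zero => intro h; simpa using h
    | succ i ih =>
      intro h
      apply ih
      have key : ∀ t, f^[r + p * (i+1)] t = f^[p] (f^[r + p * i] t) := fun t => by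
        rw [← Function.iterate_add_apply, show p + (r + p * i) = r + p * (i + 1) by ring]
      by_contra hcon
      push Not at hcon
      obtain ⟨t, ht, hte⟩ := hcon
      have hs := h t0 ht0
      rw [key, ← inter] at hs
      have hcont : ContinuousOn (fun q => |f^[r + p * i] q - z|) (uIcc s0 t) := by
        have := M.itcont (r + p * i)
        apply Continuous.continuousOn; fun_prop
      obtain ⟨q, hq, hqe⟩ := intermediate_value_uIcc hcont (show e ∈ uIcc _ _ from
        by rw [uIcc_of_le (hs.le.trans hte)]; exact ⟨hs.le, hte⟩)
      simp only at hqe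
      have hqI : q ∈ Icc a b := ordConnected_Icc.uIcc_subset hs0 ht hq
      have h1 := h q hqI
      rw [key] at h1
      have h2 := hexp (f^[r + p * i] q) (by rw [hqe]; exact heR)
      rw [hqe] at h2
      nlinarith
  obtain ⟨s, hs, hne⟩ := M.nonconst r a b ha hab hb
  have hd : 0 < |f^[r] s - f^[r] a| := abs_pos.2 (sub_ne_zero.2 hne)
  set e := min (R / 2) (|f^[r] s - f^[r] a| / 2)
  have he : 0 < e := lt_min (by linarith) (by linarith)
  obtain ⟨n, hn⟩ := acc e he
  have hR2 : e ≤ R / 2 := min_le_left _ _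
  have h1 := down e he (by linarith) _ hn
  have h2 := h1 s hs
  have h3 := h1 a haI
  have h4 : e ≤ |f^[r] s - f^[r] a| / 2 := min_le_right _ _
  have := abs_sub_le (f^[r] s) z (f^[r] a)
  rw [abs_sub_comm z] at this
  linarith

theorem MM.nc_of_avoid (M : MM f K) {a b : ℝ} (h : ∀ t, ∀ s ∈ Icc a b, f^[t] s ∉ K) :
    NC f K (Icc a b) := by
  intro t p hp q hq z hz ⟨h1, h2⟩
  obtain ⟨s, hs, e⟩ := intermediate_value_uIcc ((M.itcont t).continuousOn (s := uIcc p q))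
    (show z ∈ uIcc _ _ by rw [uIcc_of_le (h1.trans h2).le]; exact ⟨h1.le, h2.le⟩)
  exact h t s (ordConnected_Icc.uIcc_subset hp hq hs) (e ▸ hz)

structure WSeq (f : ℝ → ℝ) (K : Finset ℝ) (x y : ℕ → ℝ) : Prop where
  pos : ∀ i, 0 < x i
  lt : ∀ i, x i < y i
  lt1 : ∀ i, y i < 1
  noK : ∀ i, ∀ z ∈ K, z ∉ Icc (x i) (y i)
  endp : ∀ i, (f (x i) = x (i+1) ∧ f (y i) = y (i+1)) ∨ (f (x i) = y (i+1) ∧ f (y i) = x (i+1))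
  max : ∀ i a b, 0 ≤ a → b ≤ 1 → a ≤ x i → y i ≤ b → NC f K (Icc a b) → a = x i ∧ b = y i
  disj : ∀ i j, i ≠ j → Disjoint (Icc (x i) (y i)) (Icc (x j) (y j))

variable {x y : ℕ → ℝ}

theorem WSeq.sub (W : WSeq f K x y) (i : ℕ) : Icc (x i) (y i) ⊆ Icc 0 1 :=
  Icc_subset_Icc (W.pos i).le (W.lt1 i).le

theorem MM.wmaps (M : MM f K) (W : WSeq f K x y) (i : ℕ) :
    MapsTo f (Icc (x i) (y i)) (Icc (x (i+1)) (y (i+1))) := by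
  intro t ht
  have hx := left_mem_Icc.2 (W.lt i).le
  have hy := right_mem_Icc.2 (W.lt i).le
  have l := W.lt (i+1)
  rcases M.lapmono (W.pos i).le (W.lt1 i).le (fun z hz h => W.noK i z hz ⟨h.1.le, h.2.le⟩) with h | h
  · have a1 := h.monotoneOn hx ht ht.1
    have a2 := h.monotoneOn ht hy ht.2
    rcases W.endp i with ⟨e1, e2⟩ | ⟨e1, e2⟩ <;> rw [e1] at a1 <;> rw [e2] at a2
    · exact ⟨a1, a2⟩
    · linarith
  · have a1 := h.antitoneOn hx ht ht.1
    have a2 := h.antitoneOn ht hy ht.2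
    rcases W.endp i with ⟨e1, e2⟩ | ⟨e1, e2⟩ <;> rw [e1] at a1 <;> rw [e2] at a2
    · linarith
    · exact ⟨a2, a1⟩

theorem MM.wmaps_it (M : MM f K) (W : WSeq f K x y) (i k : ℕ) :
    MapsTo (f^[k]) (Icc (x i) (y i)) (Icc (x (i+k)) (y (i+k))) := by
  induction k with
  | zero => intro t ht; simpa using ht
  | succ k ih => rw [Function.iterate_succ']; exact (M.wmaps W (i+k)).comp ih

theorem MM.wmax (M : MM f K) (W : WSeq f K x y) {i : ℕ} {a b : ℝ} (ha : 0 ≤ a) (hb : b ≤ 1)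
    (hax : a ≤ x i) (hyb : y i ≤ b) (hne : a < x i ∨ y i < b) :
    ∃ ρ > 0, ∀ k, ¬ Sm f (Icc a b) k ρ := by
  by_contra hcon
  push Not at hcon
  have hab : a < b := by have := W.lt i; linarith
  by_cases hInter : ∃ r p, 1 ≤ p ∧ ∃ s ∈ Icc a b, ∃ t ∈ Icc a b, f^[r] s = f^[r+p] t
  · obtain ⟨r, p, hp, s, hs, t, ht, e⟩ := hInter
    exact M.cp ha hab hb hp hs ht e hcon
  push Not at hInter
  have hfin : ∀ z ∈ K, ∃ N, ∀ n ≥ N, ∀ s ∈ Icc a b, f^[n] s ≠ z := by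
    intro z _
    by_cases h : ∃ n, ∃ s ∈ Icc a b, f^[n] s = z
    · obtain ⟨n, s, hs, e⟩ := h
      refine ⟨n+1, fun m hm t ht e' => ?_⟩
      exact hInter n (m - n) (by omega) s hs t ht (by rw [e, ← e']; congr 2; omega)
    · push Not at h; exact ⟨0, fun n _ s hs => h n s hs⟩
  choose! N hN using hfin
  set N0 := K.sup N
  have hN0 : ∀ n ≥ N0, ∀ s ∈ Icc a b, f^[n] s ∉ K := fun n hn s hs hk =>
    hN _ hk n ((Finset.le_sup hk).trans hn) s hs rfl
  have hopen : IsOpen {q : ℝ | ∀ t ∈ Finset.range N0, f^[t] q ∉ K} := by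
    have : {q : ℝ | ∀ t ∈ Finset.range N0, f^[t] q ∉ K} =
        ⋂ t ∈ Finset.range N0, (f^[t]) ⁻¹' (↑K : Set ℝ)ᶜ := by ext; simp
    rw [this]
    exact isOpen_biInter_finset fun t _ => K.finite_toSet.isClosed.isOpen_compl.preimage (M.itcont t)
  have hJ : ∀ q ∈ Icc (x i) (y i), q ∈ {q : ℝ | ∀ t ∈ Finset.range N0, f^[t] q ∉ K} :=
    fun q hq t _ hk => W.noK _ _ hk (M.wmaps_it W i t hq)
  obtain ⟨e1, he1, h1⟩ := Metric.isOpen_iff.1 hopen _ (hJ _ (left_mem_Icc.2 (W.lt i).le))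
  obtain ⟨e2, he2, h2⟩ := Metric.isOpen_iff.1 hopen _ (hJ _ (right_mem_Icc.2 (W.lt i).le))
  have sub : Icc (max a (x i - e1/2)) (min b (y i + e2/2)) ⊆ Icc a b :=
    Icc_subset_Icc (le_max_left _ _) (min_le_left _ _)
  have := W.max i (max a (x i - e1/2)) (min b (y i + e2/2)) (ha.trans (le_max_left _ _))
    ((min_le_left _ _).trans hb) (max_le hax (by linarith)) (le_min hyb (by linarith)) (by
      apply M.nc_of_avoid
      intro t s hs
      by_cases ht : t < N0
      · have hs1 := (le_max_right a _).trans hs.1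
        have hs2 := hs.2.trans (min_le_right b _)
        refine (?_ : s ∈ {q : ℝ | ∀ t ∈ Finset.range N0, f^[t] q ∉ K}) t (Finset.mem_range.2 ht)
        by_cases c1 : s < x i
        · apply h1; rw [mem_ball, Real.dist_eq, abs_of_neg] <;> linarith
        by_cases c2 : y i < s
        · apply h2; rw [mem_ball, Real.dist_eq, abs_of_pos] <;> linarith
        · exact hJ s ⟨not_lt.1 c1, not_lt.1 c2⟩
      · exact hN0 t (not_lt.1 ht) s (sub hs))
  rcases hne with h | h
  · have : max a (x i - e1/2) < x i := max_lt h (by linarith)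
    linarith
  · have : y i < min b (y i + e2/2) := lt_min h (by linarith)
    linarith
end
end WI

namespace WI
section
variable {f : ℝ → ℝ} {K : Finset ℝ}
open Filter Topology

def Nc (f : ℝ → ℝ) (K : Finset ℝ) (p : ℝ) : Set ℝ := {q | q ∈ Icc (0:ℝ) 1 ∧ NC f K (uIcc p q)}

def Reg (f : ℝ → ℝ) (K : Finset ℝ) (p : ℝ) : Prop := ∀ t, f^[t] p ∉ K

theorem nc_Nc {p : ℝ} (hp : Reg f K p) : NC f K (Nc f K p) := by
  rintro t a ⟨_, ha⟩ b ⟨_, hb⟩ z hz ⟨h1, h2⟩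
  rcases lt_trichotomy (f^[t] p) z with h | h | h
  · exact hb t p left_mem_uIcc b right_mem_uIcc z hz ⟨h, h2⟩
  · exact hp t (h ▸ hz)
  · exact ha t a right_mem_uIcc p left_mem_uIcc z hz ⟨h1, h⟩

theorem oc_Nc {p : ℝ} : (Nc f K p).OrdConnected := by
  constructor
  rintro q ⟨hq, hq'⟩ r ⟨hr, hr'⟩ s ⟨h1, h2⟩
  refine ⟨⟨hq.1.trans h1, h2.trans hr.2⟩, ?_⟩
  rcases le_total p s with h | h
  · refine hr'.mono ?_
    rw [uIcc_of_le h, uIcc_of_le (h.trans h2)]; exact Icc_subset_Icc_right h2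
  · refine hq'.mono ?_
    rw [uIcc_of_ge h, uIcc_of_ge (h1.trans h)]; exact Icc_subset_Icc_left h1

theorem sub_Nc {p : ℝ} {S : Set ℝ} (h1 : S.OrdConnected) (h2 : p ∈ S) (h3 : S ⊆ Icc 0 1)
    (h4 : NC f K S) : S ⊆ Nc f K p :=
  fun q hq => ⟨h3 hq, h4.mono (h1.uIcc_subset h2 hq)⟩

theorem nc_single {p : ℝ} : NC f K (uIcc p p) := by
  intro t a ha b hb z _ h
  simp at ha hb; subst ha hb
  linarith [h.1, h.2]

theorem self_Nc {p : ℝ} (hp : p ∈ Icc (0:ℝ) 1) : p ∈ Nc f K p := ⟨hp, nc_single⟩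

theorem MM.nc_closure (M : MM f K) {S : Set ℝ} (h : NC f K S) : NC f K (closure S) := by
  intro t a ha b hb z hz ⟨h1, h2⟩
  obtain ⟨a', h3, h4⟩ := mem_closure_iff.1 ha _ (isOpen_Iio.preimage (M.itcont t)) h1
  obtain ⟨b', h5, h6⟩ := mem_closure_iff.1 hb _ (isOpen_Ioi.preimage (M.itcont t)) h2
  exact h t a' h4 b' h6 z hz ⟨h3, h5⟩

theorem MM.Nc_Icc (M : MM f K) {p : ℝ} (hp : p ∈ Icc (0:ℝ) 1) (hr : Reg f K p) :
    ∃ a b, a ≤ b ∧ 0 ≤ a ∧ b ≤ 1 ∧ Nc f K p = Icc a b := by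
  have hsub : Nc f K p ⊆ Icc 0 1 := fun q hq => hq.1
  have hcl : IsClosed (Nc f K p) := by
    apply isClosed_of_closure_subset
    apply sub_Nc
    · exact (oc_Nc.isPreconnected.closure).ordConnected
    · exact subset_closure (self_Nc hp)
    · exact closure_minimal hsub isClosed_Icc
    · exact M.nc_closure (nc_Nc hr)
  have hc : IsCompact (Nc f K p) := isCompact_Icc.of_isClosed_subset hcl hsub
  have e := eq_Icc_of_connected_compact ⟨⟨p, self_Nc hp⟩, oc_Nc.isPreconnected⟩ hc
  have hp' := self_Nc (f := f) (K := K) hp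
  rw [e] at hp'
  have hle := hp'.1.trans hp'.2
  refine ⟨_, _, hle, ?_, ?_, e⟩
  · have : sInf (Nc f K p) ∈ Nc f K p := by
      have h := left_mem_Icc.2 hle
      rw [← e] at h; exact h
    exact (hsub this).1
  · have : sSup (Nc f K p) ∈ Nc f K p := by
      have h := right_mem_Icc.2 hle
      rw [← e] at h; exact h
    exact (hsub this).2

theorem MM.reg_interior (M : MM f K) {a b p : ℝ} (ha : 0 ≤ a) (hb : b ≤ 1) (h : NC f K (Icc a b))
    (h1 : a < p) (h2 : p < b) : Reg f K p := by
  intro t hk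
  have ma := left_mem_Icc.2 (h1.trans h2).le
  have mb := right_mem_Icc.2 (h1.trans h2).le
  have mp : p ∈ Icc a b := ⟨h1.le, h2.le⟩
  rcases M.nc_mono (Icc_subset_Icc ha hb) h t with hm | hm
  · exact h t a ma b mb _ hk ⟨hm ma mp h1, hm mp mb h2⟩
  · exact h t b mb a ma _ hk ⟨hm mp mb h2, hm ma mp h1⟩

theorem Reg.it {p : ℝ} (h : Reg f K p) (n : ℕ) : Reg f K (f^[n] p) := fun t => by
  rw [← Function.iterate_add_apply]; exact h _

theorem eq_Nc {p s : ℝ} (hp : p ∈ Icc (0:ℝ) 1) (hpr : Reg f K p) (hsr : Reg f K s)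
    (h : s ∈ Nc f K p) : Nc f K s = Nc f K p := by
  have h1 : Nc f K p ⊆ Nc f K s := sub_Nc oc_Nc h (fun q hq => hq.1) (nc_Nc hpr)
  exact Subset.antisymm (sub_Nc oc_Nc (h1 (self_Nc hp)) (fun q hq => hq.1) (nc_Nc hsr)) h1

theorem MM.exists_wseq (M : MM f K) {a b : ℝ} (ha : 0 ≤ a) (hab : a < b) (hb : b ≤ 1)
    (hnc : NC f K (Icc a b)) : ∃ x y, WSeq f K x y := by
  obtain ⟨p, hp1, hp2⟩ := exists_between hab
  have hpI : p ∈ Icc (0:ℝ) 1 := ⟨ha.trans hp1.le, hp2.le.trans hb⟩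
  have hpr : Reg f K p := M.reg_interior ha hb hnc hp1 hp2
  have hI : ∀ n, f^[n] p ∈ Icc (0:ℝ) 1 := fun n => M.itmaps n hpI
  choose α β hle h0 h1 hN using fun n => M.Nc_Icc (hI n) (hpr.it n)
  have hNC : ∀ n, NC f K (Icc (α n) (β n)) := fun n => hN n ▸ nc_Nc (hpr.it n)
  have hpm : ∀ n, f^[n] p ∈ Icc (α n) (β n) := fun n => hN n ▸ self_Nc (hI n)
  have hmax : ∀ n (S : Set ℝ), S.OrdConnected → f^[n] p ∈ S → S ⊆ Icc 0 1 → NC f K S →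
      S ⊆ Icc (α n) (β n) := fun n S s1 s2 s3 s4 => hN n ▸ sub_Nc s1 s2 s3 s4
  have hmapsto : ∀ n, MapsTo f (Icc (α n) (β n)) (Icc (α (n+1)) (β (n+1))) := by
    intro n q hq
    refine hmax (n+1) (f '' Icc (α n) (β n)) ?_ ?_ ?_ ?_ ⟨q, hq, rfl⟩
    · exact (isPreconnected_Icc.image f M.cont.continuousOn).ordConnected
    · exact ⟨_, hpm n, (Function.iterate_succ_apply' f n p).symm⟩
    · rintro _ ⟨s, hs, rfl⟩; exact M.maps ⟨(h0 n).trans hs.1, hs.2.trans (h1 n)⟩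
    · exact (hNC n).image
  have hmapsto' : ∀ n k, MapsTo (f^[k]) (Icc (α n) (β n)) (Icc (α (n+k)) (β (n+k))) := by
    intro n k
    induction k with
    | zero => intro q hq; simpa using hq
    | succ k ih => rw [Function.iterate_succ']; exact (hmapsto _).comp ih
  have hlt : ∀ n, α n < β n := by
    have h00 : α 0 < β 0 := by
      have := hmax 0 (Icc a b) ordConnected_Icc ⟨hp1.le, hp2.le⟩ (Icc_subset_Icc ha hb) hnc
      have s1 := this (left_mem_Icc.2 hab.le)
      have s2 := this (right_mem_Icc.2 hab.le)
      linarith [s1.1, s2.2]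
    intro n
    have m1 := hmapsto' 0 n (left_mem_Icc.2 h00.le)
    have m2 := hmapsto' 0 n (right_mem_Icc.2 h00.le)
    rw [zero_add] at m1 m2
    have hm := M.nc_mono (Icc_subset_Icc (h0 0) (h1 0)) (hNC 0) n
    rcases hm with hm | hm
    · have := hm (left_mem_Icc.2 h00.le) (right_mem_Icc.2 h00.le) h00
      linarith [m1.1, m2.2]
    · have := hm (left_mem_Icc.2 h00.le) (right_mem_Icc.2 h00.le) h00
      linarith [m2.1, m1.2]
  -- no regular common point
  have hno' : ∀ n m, n < m → ∀ s, s ∈ Icc (α n) (β n) → s ∈ Icc (α m) (β m) → Reg f K s → False := by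
    intro n m hnm s hs1 hs2 hsr
    rw [← hN n] at hs1
    rw [← hN m] at hs2
    have e : Icc (α n) (β n) = Icc (α m) (β m) := by
      rw [← hN n, ← hN m, ← eq_Nc (hI n) (hpr.it n) hsr hs1, eq_Nc (hI m) (hpr.it m) hsr hs2]
    have mt := hmapsto' n (m - n)
    rw [show n + (m - n) = m by omega, ← e] at mt
    exact M.lemmaP (Icc_subset_Icc (h0 n) (h1 n)) ordConnected_Icc (left_mem_Icc.2 (hlt n).le)
      (right_mem_Icc.2 (hlt n).le) (hlt n) (hNC n) (by omega) mt
  have hno : ∀ n m, n ≠ m → ∀ s, s ∈ Icc (α n) (β n) → s ∈ Icc (α m) (β m) → Reg f K s → False := by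
    intro n m hnm s hs1 hs2 hsr
    rcases lt_or_gt_of_ne hnm with h | h
    · exact hno' n m h s hs1 hs2 hsr
    · exact hno' m n h s hs2 hs1 hsr
  have hfin : ∀ e : ℝ, {n | e ∈ Icc (α n) (β n)}.Finite := by
    intro e
    refine Set.Finite.of_injOn (f := fun n => e = α n) (t := univ) (fun _ _ => mem_univ _) ?_ finite_univ
    intro n hn m hm hnm
    change e ∈ Icc (α n) (β n) at hn
    change e ∈ Icc (α m) (β m) at hm
    have hnm' : (e = α n) = (e = α m) := hnm
    by_contra hne
    by_cases hc : e = α n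
    · have hc' : e = α m := hnm'.mp hc
      obtain ⟨s, s1, s2⟩ := exists_between (lt_min (hlt n) (hc ▸ hc' ▸ hlt m : α n < β m))
      have s3 := s2.trans_le (min_le_left _ _)
      have s4 := s2.trans_le (min_le_right _ _)
      have s5 : α m < s := by rw [← hc', hc]; exact s1
      exact hno n m hne s ⟨s1.le, s3.le⟩ ⟨s5.le, s4.le⟩ (M.reg_interior (h0 n) (h1 n) (hNC n) s1 s3)
    · have hc' : ¬ e = α m := fun h => hc (hnm'.mpr h)
      have l1 := lt_of_le_of_ne hn.1 (Ne.symm hc)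
      have l2 := lt_of_le_of_ne hm.1 (Ne.symm hc')
      obtain ⟨s, s1, s2⟩ := exists_between (max_lt l1 l2)
      have s3 := (le_max_left _ _).trans_lt s1
      have s4 := (le_max_right _ _).trans_lt s1
      exact hno n m hne s ⟨s3.le, s2.le.trans hn.2⟩ ⟨s4.le, s2.le.trans hm.2⟩
        (M.reg_interior (h0 n) (h1 n) (hNC n) s3 (s2.trans_le hn.2))
  have hall : {n | ∃ e ∈ insert 0 (insert 1 K), e ∈ Icc (α n) (β n)}.Finite := by
    have : {n | ∃ e ∈ insert 0 (insert 1 K), e ∈ Icc (α n) (β n)} =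
      ⋃ e ∈ insert 0 (insert 1 K), {n | e ∈ Icc (α n) (β n)} := by
      ext n; simp only [mem_iUnion, exists_prop]; rfl
    rw [this]
    exact Set.Finite.biUnion (Finset.finite_toSet _) (fun e _ => hfin e)
  obtain ⟨N, hNb⟩ := hall.bddAbove
  have hav : ∀ n, N < n → ∀ e ∈ insert 0 (insert 1 K), e ∉ Icc (α n) (β n) := by
    intro n hn e he hme
    have : n ≤ N := hNb ⟨e, he, hme⟩
    omega
  have hK : ∀ n, N < n → ∀ z ∈ K, z ∉ Icc (α n) (β n) := fun n hn z hz =>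
    hav n hn z (by simp [hz])
  have ha0 : ∀ n, N < n → 0 < α n := fun n hn => lt_of_le_of_ne (h0 n) (fun h =>
    hav n hn 0 (by simp) ⟨h.symm.le, (h0 n).trans (hle n)⟩)
  have hb1 : ∀ n, N < n → β n < 1 := fun n hn => lt_of_le_of_ne (h1 n) (fun h =>
    hav n hn 1 (by simp) ⟨(hle n).trans (h1 n), h.symm.le⟩)
  -- endpoints go to endpoints
  have hend : ∀ n, N < n → ∀ e, e = α n ∨ e = β n → f e ∉ Ioo (α (n+1)) (β (n+1)) := by
    intro n hn e he hfe
    have heI : e ∈ Icc (α n) (β n) := by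
      rcases he with rfl | rfl
      · exact left_mem_Icc.2 (hle n)
      · exact right_mem_Icc.2 (hle n)
    have hnb : f ⁻¹' Ioo (α (n+1)) (β (n+1)) ∩ ((↑K : Set ℝ)ᶜ ∩ Ioo 0 1) ∈ 𝓝 e := by
      refine inter_mem (M.cont.continuousAt.preimage_mem_nhds (isOpen_Ioo.mem_nhds hfe))
        (inter_mem (K.finite_toSet.isClosed.isOpen_compl.mem_nhds (fun h => hK n hn e h heI))
          (isOpen_Ioo.mem_nhds ⟨(ha0 n hn).trans_le heI.1, heI.2.trans_lt (hb1 n hn)⟩))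
    obtain ⟨ε, hε, hball⟩ := Metric.mem_nhds_iff.1 hnb
    -- the enlarged interval
    have key : ∀ S : Set ℝ, S.OrdConnected → Icc (α n) (β n) ⊆ S →
        S ⊆ Icc (α n) (β n) ∪ ball e ε → S ⊆ Icc (α n) (β n) := by
      intro S s1 s2 s3
      have inn : ∀ s ∈ S, s ∈ Icc (0:ℝ) 1 ∧ s ∉ K ∧ f s ∈ Icc (α (n+1)) (β (n+1)) := by
        intro s hs
        rcases s3 hs with h | h
        · exact ⟨⟨(h0 n).trans h.1, h.2.trans (h1 n)⟩, fun hk => hK n hn s hk h, hmapsto n h⟩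
        · obtain ⟨b1, b2, b3⟩ := hball h
          exact ⟨Ioo_subset_Icc_self b3, b2, Ioo_subset_Icc_self b1⟩
      refine hmax n S s1 (s2 (hpm n)) (fun s hs => (inn s hs).1) ?_
      intro t a ha b hb z hz hc
      cases t with
      | zero =>
        simp at hc
        exact (inn z (s1.out ha hb ⟨hc.1.le, hc.2.le⟩)).2.1 hz
      | succ t => exact hNC (n+1) t _ (inn a ha).2.2 _ (inn b hb).2.2 z hz hc
    rcases he with rfl | rfl
    · have := key (Icc (α n - ε/2) (β n)) ordConnected_Icc (Icc_subset_Icc_left (by linarith)) (by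
        intro s hs
        by_cases h : α n ≤ s
        · left; exact ⟨h, hs.2⟩
        · right; rw [mem_ball, Real.dist_eq, abs_of_neg] <;> linarith [hs.1])
        (left_mem_Icc.2 (by linarith [hle n]))
      linarith [this.1]
    · have := key (Icc (α n) (β n + ε/2)) ordConnected_Icc (Icc_subset_Icc_right (by linarith)) (by
        intro s hs
        by_cases h : s ≤ β n
        · left; exact ⟨hs.1, h⟩
        · right; rw [mem_ball, Real.dist_eq, abs_of_pos] <;> linarith [hs.2])
        (right_mem_Icc.2 (by linarith [hle n]))
      linarith [this.2]
  have hend' : ∀ n, N < n → ∀ e, e = α n ∨ e = β n → f e = α (n+1) ∨ f e = β (n+1) := by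
    intro n hn e he
    have h1 := hend n hn e he
    have h2 : f e ∈ Icc (α (n+1)) (β (n+1)) := hmapsto n (by
      rcases he with rfl | rfl
      · exact left_mem_Icc.2 (hle n)
      · exact right_mem_Icc.2 (hle n))
    by_contra hc
    push Not at hc
    exact h1 ⟨lt_of_le_of_ne h2.1 (Ne.symm hc.1), lt_of_le_of_ne h2.2 hc.2⟩
  refine ⟨fun i => α (N+1+i), fun i => β (N+1+i), ?_⟩
  refine ⟨fun i => ha0 _ (by omega), fun i => hlt _, fun i => hb1 _ (by omega),
    fun i => hK _ (by omega), ?_, ?_, ?_⟩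
  · intro i
    have hn : N < N+1+i := by omega
    have hne : f (α (N+1+i)) ≠ f (β (N+1+i)) := by
      have hl := M.lapmono (h0 (N+1+i)) (h1 (N+1+i)) (fun z hz h => hK _ hn z hz ⟨h.1.le, h.2.le⟩)
      have inj : InjOn f (Icc (α (N+1+i)) (β (N+1+i))) := by
        rcases hl with hm | hm <;> exact hm.injOn
      intro h
      exact (hlt (N+1+i)).ne (inj (left_mem_Icc.2 (hle _)) (right_mem_Icc.2 (hle _)) h)
    have c1 := hend' _ hn _ (Or.inl rfl)
    have c2 := hend' _ hn _ (Or.inr rfl)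
    rw [show N + 1 + i + 1 = N + 1 + (i+1) by ring] at c1 c2
    rcases c1 with c1 | c1 <;> rcases c2 with c2 | c2
    · exact absurd (c1.trans c2.symm) hne
    · exact Or.inl ⟨c1, c2⟩
    · exact Or.inr ⟨c1, c2⟩
    · exact absurd (c1.trans c2.symm) hne
  · intro i a b ha hb hax hyb hn
    have hs : Icc (α (N+1+i)) (β (N+1+i)) ⊆ Icc a b := Icc_subset_Icc hax hyb
    have := hmax (N+1+i) (Icc a b) ordConnected_Icc (hs (hpm _)) (Icc_subset_Icc ha hb) hn
    have hab' : a ≤ b := hax.trans ((hle _).trans hyb)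
    have u1 := (this (left_mem_Icc.2 hab')).1
    have u2 := (this (right_mem_Icc.2 hab')).2
    exact ⟨le_antisymm hax u1, le_antisymm u2 hyb⟩
  · intro i j hij
    rw [Set.disjoint_left]
    intro s hs1 hs2
    refine hno (N+1+i) (N+1+j) (by omega) s hs1 hs2 (fun t hk => ?_)
    exact hK (N+1+i+t) (by omega) _ hk (hmapsto' _ t hs1)
end
end WI

namespace WI
section
variable {f : ℝ → ℝ} {K : Finset ℝ}
open Filter Topology

def lo (K : Finset ℝ) (t : ℝ) : ℝ := sSup {k | (k = 0 ∨ k ∈ K) ∧ k < t}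
def hi (K : Finset ℝ) (t : ℝ) : ℝ := sInf {k | (k = 1 ∨ k ∈ K) ∧ t < k}

theorem lo_fin (t : ℝ) : {k | (k = 0 ∨ k ∈ K) ∧ k < t}.Finite := by
  refine (Finset.finite_toSet (insert 0 K)).subset ?_
  rintro k ⟨h, _⟩
  simpa using h

theorem hi_fin (t : ℝ) : {k | (k = 1 ∨ k ∈ K) ∧ t < k}.Finite := by
  refine (Finset.finite_toSet (insert 1 K)).subset ?_
  rintro k ⟨h, _⟩
  simpa using h

theorem lo_spec {t : ℝ} (ht : 0 < t) : (lo K t = 0 ∨ lo K t ∈ K) ∧ lo K t < t :=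
  by
  have hne : {k | (k = 0 ∨ k ∈ K) ∧ k < t}.Nonempty := ⟨0, Or.inl rfl, ht⟩
  exact hne.csSup_mem (lo_fin t)

theorem hi_spec {t : ℝ} (ht : t < 1) : (hi K t = 1 ∨ hi K t ∈ K) ∧ t < hi K t :=
  by
  have hne : {k | (k = 1 ∨ k ∈ K) ∧ t < k}.Nonempty := ⟨1, Or.inl rfl, ht⟩
  exact hne.csInf_mem (hi_fin t)

theorem le_lo {t z : ℝ} (hz : z ∈ K) (h : z < t) : z ≤ lo K t :=
  le_csSup (lo_fin t).bddAbove ⟨Or.inr hz, h⟩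

theorem hi_le {t z : ℝ} (hz : z ∈ K) (h : t < z) : hi K t ≤ z :=
  csInf_le (hi_fin t).bddBelow ⟨Or.inr hz, h⟩

theorem lo_nonneg {t : ℝ} (ht : 0 < t) : 0 ≤ lo K t :=
  le_csSup (lo_fin t).bddAbove ⟨Or.inl rfl, ht⟩

theorem hi_le1 {t : ℝ} (ht : t < 1) : hi K t ≤ 1 :=
  csInf_le (hi_fin t).bddBelow ⟨Or.inl rfl, ht⟩

/-- level neighbourhoods -/
def S (f : ℝ → ℝ) (K : Finset ℝ) (z e : ℝ) : Set ℝ :=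
  {t | lo K z < t ∧ t < hi K z ∧ |f t - f z| < e}

theorem S_mono {z e e' : ℝ} (h : e ≤ e') : S f K z e ⊆ S f K z e' :=
  fun _ ht => ⟨ht.1, ht.2.1, ht.2.2.trans_le h⟩

theorem MM.near (M : MM f K) {z : ℝ} (hz : z ∈ K) :
    0 ≤ lo K z ∧ lo K z < z ∧ z < hi K z ∧ hi K z ≤ 1 ∧ 0 < z ∧ z < 1 :=
  have h := M.sub z hz
  ⟨lo_nonneg h.1, (lo_spec h.1).2, (hi_spec h.2).2, hi_le1 h.2, h.1, h.2⟩

theorem only {z w : ℝ} (hw : w ∈ K) (h1 : lo K z < w) (h2 : w < hi K z) : w = z := by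
  rcases lt_trichotomy w z with h | h | h
  · linarith [le_lo hw h]
  · exact h
  · linarith [hi_le hw h]

theorem MM.lev (M : MM f K) {z : ℝ} (hz : z ∈ K) :
    StrictAntiOn (fun t => |f t - f z|) (Icc (lo K z) z) ∧
    StrictMonoOn (fun t => |f t - f z|) (Icc z (hi K z)) ∧
    ((∀ t ∈ Icc (lo K z) (hi K z), |f t - f z| = f t - f z) ∨
     (∀ t ∈ Icc (lo K z) (hi K z), |f t - f z| = f z - f t)) := by
  obtain ⟨h1, h2, h3, h4, -, -⟩ := M.near hz
  have zl : z ∈ Icc (lo K z) z := ⟨h2.le, le_rfl⟩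
  have zr : z ∈ Icc z (hi K z) := ⟨le_rfl, h3.le⟩
  rcases M.fold z hz _ _ h1 h2 h3 h4 (fun w hw a b => only hw a b) with ⟨a, b⟩ | ⟨a, b⟩
  · have key : ∀ t ∈ Icc (lo K z) (hi K z), |f t - f z| = f z - f t := by
      intro t ht
      rw [abs_of_nonpos]
      · ring
      rcases le_total t z with h | h
      · linarith [a.monotoneOn ⟨ht.1, h⟩ zl h]
      · linarith [b.antitoneOn zr ⟨h, ht.2⟩ h]
    refine ⟨?_, ?_, Or.inr key⟩
    · intro s hs t ht hst
      have := a hs ht hst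
      simp only [key s ⟨hs.1, hs.2.trans h3.le⟩, key t ⟨ht.1, ht.2.trans h3.le⟩]; linarith
    · intro s hs t ht hst
      have := b hs ht hst
      simp only [key s ⟨h2.le.trans hs.1, hs.2⟩, key t ⟨h2.le.trans ht.1, ht.2⟩]; linarith
  · have key : ∀ t ∈ Icc (lo K z) (hi K z), |f t - f z| = f t - f z := by
      intro t ht
      rw [abs_of_nonneg]
      rcases le_total t z with h | h
      · linarith [a.antitoneOn ⟨ht.1, h⟩ zl h]
      · linarith [b.monotoneOn zr ⟨h, ht.2⟩ h]
    refine ⟨?_, ?_, Or.inl key⟩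
    · intro s hs t ht hst
      have := a hs ht hst
      simp only [key s ⟨hs.1, hs.2.trans h3.le⟩, key t ⟨ht.1, ht.2.trans h3.le⟩]; linarith
    · intro s hs t ht hst
      have := b hs ht hst
      simp only [key s ⟨h2.le.trans hs.1, hs.2⟩, key t ⟨h2.le.trans ht.1, ht.2⟩]; linarith

/-- shape of level neighbourhoods -/
theorem MM.S_Ioo (M : MM f K) {z e : ℝ} (hz : z ∈ K) (he : 0 < e) : ∃ u v, S f K z e = Ioo u v ∧
    lo K z ≤ u ∧ u < z ∧ z < v ∧ v ≤ hi K z ∧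
    ((u = lo K z ∧ |f u - f z| ≤ e) ∨ |f u - f z| = e) ∧
    ((v = hi K z ∧ |f v - f z| ≤ e) ∨ |f v - f z| = e) := by
  obtain ⟨h1, h2, h3, h4, -, -⟩ := M.near hz
  obtain ⟨l1, l2, -⟩ := M.lev hz
  have cont : Continuous (fun t => |f t - f z|) := (M.cont.sub continuous_const).abs
  have hzz : |f z - f z| = 0 := by simp
  have zl : z ∈ Icc (lo K z) z := ⟨h2.le, le_rfl⟩
  have zr : z ∈ Icc z (hi K z) := ⟨le_rfl, h3.le⟩
  have left : ∃ u, lo K z ≤ u ∧ u < z ∧ ((u = lo K z ∧ |f u - f z| ≤ e) ∨ |f u - f z| = e) ∧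
      ∀ t, lo K z < t → t ≤ z → (|f t - f z| < e ↔ u < t) := by
    by_cases hc : |f (lo K z) - f z| ≤ e
    · refine ⟨lo K z, le_rfl, h2, Or.inl ⟨rfl, hc⟩, fun t ht ht' => ⟨fun _ => ht, fun _ => ?_⟩⟩
      exact (l1 ⟨le_rfl, h2.le⟩ ⟨ht.le, ht'⟩ ht).trans_le hc
    · push Not at hc
      obtain ⟨u, hu, hu'⟩ := intermediate_value_Icc' h2.le cont.continuousOn
        (show e ∈ Icc _ _ from ⟨by simpa using he.le, hc.le⟩)
      simp only at hu'
      refine ⟨u, hu.1, lt_of_le_of_ne hu.2 ?_, Or.inr hu', fun t ht ht' => ?_⟩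
      · rintro rfl; rw [hzz] at hu'; linarith
      · rw [← hu']
        exact l1.lt_iff_gt ⟨ht.le, ht'⟩ hu
  have right : ∃ v, z < v ∧ v ≤ hi K z ∧ ((v = hi K z ∧ |f v - f z| ≤ e) ∨ |f v - f z| = e) ∧
      ∀ t, z ≤ t → t < hi K z → (|f t - f z| < e ↔ t < v) := by
    by_cases hc : |f (hi K z) - f z| ≤ e
    · refine ⟨hi K z, h3, le_rfl, Or.inl ⟨rfl, hc⟩, fun t ht ht' => ⟨fun _ => ht', fun _ => ?_⟩⟩
      exact (l2 ⟨ht, ht'.le⟩ ⟨h3.le, le_rfl⟩ ht').trans_le hc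
    · push Not at hc
      obtain ⟨u, hu, hu'⟩ := intermediate_value_Icc h3.le cont.continuousOn
        (show e ∈ Icc _ _ from ⟨by simpa using he.le, hc.le⟩)
      simp only at hu'
      refine ⟨u, lt_of_le_of_ne hu.1 ?_, hu.2, Or.inr hu', fun t ht ht' => ?_⟩
      · rintro rfl; rw [hzz] at hu'; linarith
      · rw [← hu']
        exact l2.lt_iff_lt ⟨ht, ht'.le⟩ hu
  obtain ⟨u, u1, u2, u3, u4⟩ := left
  obtain ⟨v, v1, v2, v3, v4⟩ := right
  refine ⟨u, v, ?_, u1, u2, v1, v2, u3, v3⟩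
  ext t
  constructor
  · rintro ⟨t1, t2, t3⟩
    rcases le_total t z with h | h
    · exact ⟨(u4 t t1 h).1 t3, by linarith⟩
    · exact ⟨by linarith, (v4 t h t2).1 t3⟩
  · rintro ⟨t1, t2⟩
    refine ⟨by linarith, by linarith, ?_⟩
    rcases le_total t z with h | h
    · exact (u4 t (by linarith) h).2 t1
    · exact (v4 t h (by linarith)).2 t2

variable {x y : ℕ → ℝ}

theorem WSeq.nolap (W : WSeq f K x y) (i : ℕ) : ∀ z ∈ K, ¬ (lo K (x i) < z ∧ z < hi K (x i)) := by
  rintro z hz ⟨h1, h2⟩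
  have := only hz h1 h2
  exact W.noK i z hz ⟨this.symm.le, this.le.trans (W.lt i).le⟩

theorem WSeq.lapb (W : WSeq f K x y) (i : ℕ) : 0 ≤ lo K (x i) ∧ lo K (x i) < x i ∧ y i < hi K (x i) ∧
    hi K (x i) ≤ 1 := by
  have h1 : x i < 1 := (W.lt i).trans (W.lt1 i)
  refine ⟨lo_nonneg (W.pos i), (lo_spec (W.pos i)).2, ?_, hi_le1 h1⟩
  obtain ⟨h2 | h2, h3⟩ := hi_spec (K := K) h1
  · rw [h2]; exact W.lt1 i
  · by_contra hc
    exact W.noK i _ h2 ⟨h3.le, not_lt.1 hc⟩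

/-- uniform lap constant -/
theorem MM.lapconst (M : MM f K) (W : WSeq f K x y) :
    ∃ ρ > 0, ∀ i k, ¬ Sm f (Icc (lo K (x i)) (hi K (x i))) k ρ := by
  have hfin : (Set.range fun i => (lo K (x i), hi K (x i))).Finite := by
    refine ((Finset.finite_toSet (insert 0 K)).prod (Finset.finite_toSet (insert 1 K))).subset ?_
    rintro _ ⟨i, rfl⟩
    refine ⟨?_, ?_⟩
    · have := (lo_spec (K := K) (W.pos i)).1
      simpa using this
    · have := (hi_spec (K := K) ((W.lt i).trans (W.lt1 i))).1
      simpa using this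
  have : ∀ q ∈ hfin.toFinset, ∃ ρ > 0, ∀ k, ¬ Sm f (Icc q.1 q.2) k ρ := by
    intro q hq
    rw [hfin.mem_toFinset] at hq
    obtain ⟨i, rfl⟩ := hq
    obtain ⟨a, b, c, d⟩ := W.lapb i
    exact M.wmax W a d b.le c.le (Or.inl b)
  choose! r hr hr' using this
  rcases hfin.toFinset.eq_empty_or_nonempty with he | hne
  · exfalso
    have : (lo K (x 0), hi K (x 0)) ∈ hfin.toFinset := by rw [hfin.mem_toFinset]; exact ⟨0, rfl⟩
    rw [he] at this; simp at this
  · refine ⟨hfin.toFinset.inf' hne r, ?_, ?_⟩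
    · obtain ⟨q, hq, e⟩ := Finset.exists_mem_eq_inf' hne r
      rw [e]; exact hr q hq
    · intro i k h
      have hm : (lo K (x i), hi K (x i)) ∈ hfin.toFinset := by rw [hfin.mem_toFinset]; exact ⟨i, rfl⟩
      refine hr' _ hm k (fun a ha b hb => (h a ha b hb).trans_le (Finset.inf'_le _ hm))

/-- no critical point quickly seen inside two-sided gaps -/
theorem MM.gapconst (M : MM f K) : ∃ d > 0, ∀ z ∈ K, d ≤ z - lo K z ∧ d ≤ hi K z - z := by
  have : ∀ z ∈ K, ∃ d > 0, d ≤ z - lo K z ∧ d ≤ hi K z - z := by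
    intro z hz
    obtain ⟨h1, h2, h3, -⟩ := M.near hz
    exact ⟨min (z - lo K z) (hi K z - z), lt_min (by linarith) (by linarith), min_le_left _ _, min_le_right _ _⟩
  choose! r hr hr' using this
  rcases K.eq_empty_or_nonempty with he | hne
  · exact ⟨1, one_pos, by simp [he]⟩
  · refine ⟨K.inf' hne r, ?_, ?_⟩
    · obtain ⟨q, hq, e⟩ := Finset.exists_mem_eq_inf' hne r
      rw [e]; exact hr q hq
    · intro z hz
      exact ⟨(Finset.inf'_le _ hz).trans (hr' z hz).1, (Finset.inf'_le _ hz).trans (hr' z hz).2⟩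

end
end WI

namespace WI
section
variable {f : ℝ → ℝ} {K : Finset ℝ} {x y : ℕ → ℝ}
open Filter Topology

structure Trap (f : ℝ → ℝ) (x y : ℕ → ℝ) (Y : Set ℝ) (m : ℕ) : Prop where
  sub : Y ⊆ Icc 0 1
  oc : Y.OrdConnected
  one : 1 ≤ m
  mt : MapsTo (f^[m]) Y Y
  ex : ∃ i, Icc (x i) (y i) ⊆ Y

def Cross (f : ℝ → ℝ) (Y : Set ℝ) (z : ℝ) : Prop := ∃ t, ∃ a ∈ Y, ∃ b ∈ Y, f^[t] a < z ∧ z < f^[t] b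

open Classical in
def Cr (f : ℝ → ℝ) (K : Finset ℝ) (Y : Set ℝ) : Finset ℝ := K.filter (Cross f Y)

theorem mem_Cr {Y : Set ℝ} {z : ℝ} : z ∈ Cr f K Y ↔ z ∈ K ∧ Cross f Y z := by simp [Cr]

theorem Trap.mtk {Y : Set ℝ} {m : ℕ} (T : Trap f x y Y m) (k : ℕ) : MapsTo (f^[m*k]) Y Y := by
  rw [Function.iterate_mul]; exact T.mt.iterate k

theorem cross_image {Y : Set ℝ} {z : ℝ} {j : ℕ} (h : Cross f (f^[j] '' Y) z) : Cross f Y z := by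
  obtain ⟨t, _, ⟨a, ha, rfl⟩, _, ⟨b, hb, rfl⟩, h1⟩ := h
  refine ⟨t+j, a, ha, b, hb, ?_⟩
  rw [Function.iterate_add_apply, Function.iterate_add_apply]; exact h1

theorem MM.trap_inter (M : MM f K) (W : WSeq f K x y) {Y Z : Set ℝ} {m p : ℕ} (TY : Trap f x y Y m)
    (TZ : Trap f x y Z p) : ∃ Q q, Trap f x y Q q ∧ ∀ z, Cross f Q z → Cross f Y z ∧ Cross f Z z := by
  obtain ⟨i, hi⟩ := TY.ex
  obtain ⟨j, hj⟩ := TZ.ex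
  refine ⟨f^[j] '' Y ∩ f^[i] '' Z, m * p, ?_, ?_⟩
  · refine ⟨?_, ?_, ?_, ?_, i + j, ?_⟩
    · rintro _ ⟨⟨a, ha, rfl⟩, _⟩; exact M.itmaps j (TY.sub ha)
    · exact ((TY.oc.isPreconnected.image _ (M.itcont j).continuousOn).ordConnected).inter
        ((TZ.oc.isPreconnected.image _ (M.itcont i).continuousOn).ordConnected)
    · exact Nat.mul_pos TY.one TZ.one
    · rintro s ⟨⟨a, ha, rfl⟩, ⟨b, hb, h⟩⟩
      refine ⟨⟨f^[m*p] a, TY.mtk p ha, ?_⟩, ⟨f^[m*p] b, ?_, ?_⟩⟩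
      · rw [← Function.iterate_add_apply, ← Function.iterate_add_apply, add_comm]
      · rw [mul_comm]; exact TZ.mtk m hb
      · rw [← h, ← Function.iterate_add_apply, ← Function.iterate_add_apply, add_comm]
    · -- J_{i+j} is the image of J_i under f^[j]
      have surj : ∀ i k, Icc (x (i+k)) (y (i+k)) ⊆ f^[k] '' Icc (x i) (y i) := by
        intro i k
        have e : (f^[k] (x i) = x (i+k) ∧ f^[k] (y i) = y (i+k)) ∨
            (f^[k] (x i) = y (i+k) ∧ f^[k] (y i) = x (i+k)) := by
          induction k with
          | zero => left; simp
          | succ k ih =>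
            rw [Function.iterate_succ_apply', Function.iterate_succ_apply']
            rcases ih with ⟨a, b⟩ | ⟨a, b⟩ <;> rw [a, b]
            · exact W.endp (i+k)
            · exact (W.endp (i+k)).symm.imp And.symm And.symm
        have oc : (f^[k] '' Icc (x i) (y i)).OrdConnected :=
          (isPreconnected_Icc.image _ (M.itcont k).continuousOn).ordConnected
        have m1 : f^[k] (x i) ∈ f^[k] '' Icc (x i) (y i) := ⟨_, left_mem_Icc.2 (W.lt i).le, rfl⟩
        have m2 : f^[k] (y i) ∈ f^[k] '' Icc (x i) (y i) := ⟨_, right_mem_Icc.2 (W.lt i).le, rfl⟩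
        rcases e with ⟨a, b⟩ | ⟨a, b⟩ <;> rw [a] at m1 <;> rw [b] at m2
        · exact oc.out m1 m2
        · exact oc.out m2 m1
      refine subset_inter ?_ ?_
      · exact (surj i j).trans (image_mono hi)
      · rw [add_comm]; exact (surj j i).trans (image_mono hj)
  · rintro z ⟨t, a, ha, b, hb, h⟩
    exact ⟨cross_image ⟨t, a, ha.1, b, hb.1, h⟩, cross_image ⟨t, a, ha.2, b, hb.2, h⟩⟩

theorem MM.core (M : MM f K) (W : WSeq f K x y) :
    ∃ c ∈ K, ∀ Y m, Trap f x y Y m → Cross f Y c := by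
  classical
  have hex : ∃ n, ∃ Y m, Trap f x y Y m ∧ (Cr f K Y).card = n :=
    ⟨_, Icc 0 1, 1, ⟨Subset.rfl, ordConnected_Icc, le_rfl, M.maps, 0, W.sub 0⟩, rfl⟩
  obtain ⟨Y, m, T, hc⟩ := Nat.find_spec hex
  have hmin : ∀ Z p, Trap f x y Z p → (Cr f K Y).card ≤ (Cr f K Z).card := by
    intro Z p TZ
    rw [hc]; exact Nat.find_min' hex ⟨Z, p, TZ, rfl⟩
  have hne : (Cr f K Y).Nonempty := by
    rw [Finset.nonempty_iff_ne_empty]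
    intro he
    obtain ⟨i, hi⟩ := T.ex
    refine M.lemmaP T.sub T.oc (hi (left_mem_Icc.2 (W.lt i).le)) (hi (right_mem_Icc.2 (W.lt i).le))
      (W.lt i) ?_ T.one T.mt
    intro t a ha b hb z hz h
    have : z ∈ Cr f K Y := mem_Cr.2 ⟨hz, t, a, ha, b, hb, h⟩
    rw [he] at this; simp at this
  obtain ⟨c, hcY⟩ := hne
  refine ⟨c, (mem_Cr.1 hcY).1, fun Z p TZ => ?_⟩
  obtain ⟨Q, q, TQ, hQ⟩ := M.trap_inter W T TZ
  have hsub : Cr f K Q ⊆ Cr f K Y := fun z hz =>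
    mem_Cr.2 ⟨(mem_Cr.1 hz).1, (hQ z (mem_Cr.1 hz).2).1⟩
  have := Finset.eq_of_subset_of_card_le hsub (hmin Q q TQ)
  rw [← this] at hcY
  exact (hQ c (mem_Cr.1 hcY).2).2

end
end WI

namespace WI
section
variable {f : ℝ → ℝ} {K : Finset ℝ} {x y : ℕ → ℝ}
open Filter Topology

def Sp (β u x y w : ℝ) : Prop := (w - u) * (y - x) ≤ β * ((x - u) * (w - y))

def NPs (f : ℝ → ℝ) (K : Finset ℝ) (U V U' V' : ℝ) : Prop :=
  (∀ z ∈ K, ¬ (U < z ∧ z < V)) ∧ ((f U = U' ∧ f V = V') ∨ (f U = V' ∧ f V = U'))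

def Ps (f : ℝ → ℝ) (K : Finset ℝ) (x y U V U' V' : ℝ) : Prop :=
  ∃ z ∈ K, ∃ e, 0 < e ∧ Ioo U V = S f K z e ∧ lo K z ≤ U ∧ U < z ∧ z < V ∧ V ≤ hi K z ∧
    ((z < x ∧ |f V - f z| = e ∧ (f V = U' ∨ f V = V') ∧ (U = lo K z ∨ |f U - f z| = e)) ∨
     (y < z ∧ |f U - f z| = e ∧ (f U = U' ∨ f U = V') ∧ (V = hi K z ∨ |f V - f z| = e)))

def StepC (f : ℝ → ℝ) (K : Finset ℝ) (x y U V U' V' : ℝ) : Prop :=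
  0 ≤ U ∧ V ≤ 1 ∧ U < x ∧ y < V ∧ MapsTo f (Ioo U V) (Ioo U' V') ∧
    (NPs f K U V U' V' ∨ Ps f K x y U V U' V')

theorem MM.pass (M : MM f K) (W : WSeq f K x y) {i : ℕ} {U' V' z : ℝ} (hx : U' < x (i+1))
    (hy : y (i+1) < V') (hz : z ∈ K) (hfz : f z ∈ Ioo U' V') (h1 : lo K z < x i) (h2 : y i < hi K z)
    (hout : (z < x i ∧ f (hi K z) ∉ Ioo U' V') ∨ (y i < z ∧ f (lo K z) ∉ Ioo U' V')) :
    ∃ U V, StepC f K (x i) (y i) U V U' V' := by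
  obtain ⟨n1, n2, n3, n4, -, -⟩ := M.near hz
  have hlt := W.lt i
  have main : ∀ e, 0 < e → (∀ t ∈ Icc (lo K z) (hi K z), |f t - f z| < e ↔ f t ∈ Ioo U' V') →
      (∀ t ∈ Icc (lo K z) (hi K z), |f t - f z| = e → f t = U' ∨ f t = V') →
      ∃ U V, StepC f K (x i) (y i) U V U' V' := by
    intro e he hiff hend
    obtain ⟨U, V, s1, s2, s3, s4, s5, s6, s7⟩ := M.S_Ioo hz he
    have memJ : ∀ t ∈ Icc (x i) (y i), t ∈ Ioo U V := by
      intro t ht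
      rw [← s1]
      have b1 : lo K z < t := by linarith [ht.1]
      have b2 : t < hi K z := by linarith [ht.2]
      have := M.wmaps W i ht
      exact ⟨b1, b2, (hiff t ⟨b1.le, b2.le⟩).2 ⟨by linarith [this.1], by linarith [this.2]⟩⟩
    have jx := memJ _ (left_mem_Icc.2 hlt.le)
    have jy := memJ _ (right_mem_Icc.2 hlt.le)
    refine ⟨U, V, n1.trans s2, s5.trans n4, jx.1, jy.2, ?_, Or.inr ?_⟩
    · intro t ht
      rw [← s1] at ht
      exact (hiff t ⟨ht.1.le, ht.2.1.le⟩).1 ht.2.2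
    · refine ⟨z, hz, e, he, s1.symm, s2, s3, s4, s5, ?_⟩
      rcases hout with ⟨o1, o2⟩ | ⟨o1, o2⟩
      · left
        have hV : |f V - f z| = e := by
          rcases s7 with ⟨rfl, h⟩ | h
          · refine le_antisymm h (not_lt.1 fun hc => o2 ((hiff _ ⟨by linarith, le_rfl⟩).1 hc))
          · exact h
        exact ⟨o1, hV, hend V ⟨by linarith, s5⟩ hV, s6.imp And.left id⟩
      · right
        have hV : |f U - f z| = e := by
          rcases s6 with ⟨rfl, h⟩ | h
          · refine le_antisymm h (not_lt.1 fun hc => o2 ((hiff _ ⟨le_rfl, by linarith⟩).1 hc))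
          · exact h
        exact ⟨o1, hV, hend U ⟨s2, by linarith⟩ hV, s7.imp And.left id⟩
  rcases (M.lev hz).2.2 with h | h
  · refine main (V' - f z) (by linarith [hfz.2]) (fun t ht => ?_) (fun t ht he => ?_)
    · rw [h t ht]
      have := abs_nonneg (f t - f z)
      rw [h t ht] at this
      exact ⟨fun q => ⟨by linarith [hfz.1], by linarith⟩, fun q => by linarith [q.2]⟩
    · rw [h t ht] at he; right; linarith
  · refine main (f z - U') (by linarith [hfz.1]) (fun t ht => ?_) (fun t ht he => ?_)
    · rw [h t ht]
      have := abs_nonneg (f t - f z)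
      rw [h t ht] at this
      exact ⟨fun q => ⟨by linarith, by linarith [hfz.2]⟩, fun q => by linarith [q.1]⟩
    · rw [h t ht] at he; left; linarith

theorem hi_lo {t : ℝ} (h0 : 0 < t) (h1 : t < 1) (hn : t ∉ K) : hi K (lo K t) = hi K t := by
  have a := lo_spec (K := K) h0
  have b := hi_spec (K := K) h1
  have a1 : lo K t < 1 := by linarith [a.2]
  have c := hi_spec (K := K) a1
  apply le_antisymm
  · rcases b.1 with h | h
    · rw [h]; exact hi_le1 a1
    · exact hi_le h (by linarith [a.2, b.2])
  · rcases c.1 with h | h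
    · rw [h]; exact hi_le1 h1
    · rcases lt_trichotomy (hi K (lo K t)) t with q | q | q
      · linarith [le_lo h q, c.2]
      · exact absurd (q ▸ h) hn
      · exact hi_le h q

theorem lo_hi {t : ℝ} (h0 : 0 < t) (h1 : t < 1) (hn : t ∉ K) : lo K (hi K t) = lo K t := by
  have a := lo_spec (K := K) h0
  have b := hi_spec (K := K) h1
  have a1 : 0 < hi K t := by linarith [b.2]
  have c := lo_spec (K := K) a1
  apply le_antisymm
  · rcases c.1 with h | h
    · rw [h]; exact lo_nonneg h0
    · rcases lt_trichotomy (lo K (hi K t)) t with q | q | q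
      · exact le_lo h q
      · exact absurd (q ▸ h) hn
      · linarith [hi_le h q, c.2]
  · rcases a.1 with h | h
    · rw [h]; exact lo_nonneg a1
    · exact le_lo h (by linarith [a.2, b.2])

theorem MM.step (M : MM f K) (W : WSeq f K x y) {ρ : ℝ}
    (hρ : ∀ i k, ¬ Sm f (Icc (lo K (x i)) (hi K (x i))) k ρ) {i k : ℕ} {U' V' : ℝ} (hU : 0 ≤ U')
    (hV : V' ≤ 1) (hx : U' < x (i+1)) (hy : y (i+1) < V') (hsm : Sm f (Ioo U' V') k ρ) :
    ∃ U V, StepC f K (x i) (y i) U V U' V' := by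
  obtain ⟨b1, b2, b3, b4⟩ := W.lapb i
  have hlt := W.lt i
  have hxK : x i ∉ K := fun h => W.noK i _ h ⟨le_rfl, hlt.le⟩
  have hx1 : x i < 1 := hlt.trans (W.lt1 i)
  have hmono := M.lapmono b1 b4 (W.nolap i)
  have mp : lo K (x i) ∈ Icc (lo K (x i)) (hi K (x i)) := ⟨le_rfl, by linarith⟩
  have mr : hi K (x i) ∈ Icc (lo K (x i)) (hi K (x i)) := ⟨by linarith, le_rfl⟩
  have mx : x i ∈ Icc (lo K (x i)) (hi K (x i)) := ⟨by linarith, by linarith⟩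
  have my : y i ∈ Icc (lo K (x i)) (hi K (x i)) := ⟨by linarith, by linarith⟩
  have fx := M.wmaps W i (left_mem_Icc.2 hlt.le)
  have fy := M.wmaps W i (right_mem_Icc.2 hlt.le)
  by_cases hp : f (lo K (x i)) ∈ Ioo U' V'
  · by_cases hr : f (hi K (x i)) ∈ Ioo U' V'
    · exfalso
      refine hρ i (k+1) ?_
      have : MapsTo f (Icc (lo K (x i)) (hi K (x i))) (Ioo U' V') := by
        intro t ht
        rcases hmono with h | h
        · exact ⟨by linarith [h.monotoneOn mp ht ht.1, hp.1], by linarith [h.monotoneOn ht mr ht.2, hr.2]⟩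
        · exact ⟨by linarith [h.antitoneOn ht mr ht.2, hr.1], by linarith [h.antitoneOn mp ht ht.1, hp.2]⟩
      intro a ha b hb
      rw [Function.iterate_succ_apply, Function.iterate_succ_apply]
      exact hsm _ (this ha) _ (this hb)
    · rcases (lo_spec (K := K) (W.pos i)).1 with h | h
      · rw [h, M.f0] at hp; linarith [hp.1]
      · have e := hi_lo (W.pos i) hx1 hxK
        refine M.pass W hx hy h hp ?_ (by rw [e]; exact b3) (Or.inl ⟨b2, by rw [e]; exact hr⟩)
        linarith [(M.near h).2.1]
  · by_cases hr : f (hi K (x i)) ∈ Ioo U' V'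
    · rcases (hi_spec (K := K) hx1).1 with h | h
      · rw [h] at hr
        rcases M.f1 with e | e <;> rw [e] at hr
        · linarith [hr.1]
        · linarith [hr.2]
      · have e := lo_hi (W.pos i) hx1 hxK
        refine M.pass W hx hy h hr (by rw [e]; exact b2) ?_ (Or.inr ⟨b3, by rw [e]; exact hp⟩)
        linarith [(M.near h).2.2.1]
    · rcases hmono with h | h
      · have p1 : f (lo K (x i)) ≤ U' := by
          by_contra hc; exact hp ⟨not_le.1 hc, by linarith [h mp mx b2, fx.2]⟩
        have r1 : V' ≤ f (hi K (x i)) := by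
          by_contra hc; exact hr ⟨by linarith [h my mr b3, fy.1], not_le.1 hc⟩
        obtain ⟨U, u1, u2⟩ := intermediate_value_Icc b2.le M.cont.continuousOn (show U' ∈ Icc _ _ from ⟨p1, by linarith [fx.1]⟩)
        obtain ⟨V, v1, v2⟩ := intermediate_value_Icc b3.le M.cont.continuousOn (show V' ∈ Icc _ _ from ⟨by linarith [fy.2], r1⟩)
        refine ⟨U, V, by linarith [u1.1], by linarith [v1.2], ?_, ?_, ?_, Or.inl ⟨?_, Or.inl ⟨u2, v2⟩⟩⟩
        · refine lt_of_le_of_ne u1.2 ?_; rintro rfl; linarith [fx.1]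
        · refine lt_of_le_of_ne v1.1 ?_; rintro rfl; linarith [fy.2]
        · intro t ht
          have mt : t ∈ Icc (lo K (x i)) (hi K (x i)) := ⟨by linarith [u1.1, ht.1], by linarith [v1.2, ht.2]⟩
          rw [← u2, ← v2]
          exact ⟨h ⟨u1.1, by linarith [u1.2]⟩ mt ht.1, h mt ⟨by linarith [v1.1], v1.2⟩ ht.2⟩
        · intro z hz hc; exact W.nolap i z hz ⟨by linarith [u1.1, hc.1], by linarith [v1.2, hc.2]⟩
      · have p1 : V' ≤ f (lo K (x i)) := by
          by_contra hc; exact hp ⟨by linarith [h mp mx b2, fx.1], not_le.1 hc⟩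
        have r1 : f (hi K (x i)) ≤ U' := by
          by_contra hc; exact hr ⟨not_le.1 hc, by linarith [h my mr b3, fy.2]⟩
        obtain ⟨U, u1, u2⟩ := intermediate_value_Icc' b2.le M.cont.continuousOn (show V' ∈ Icc _ _ from ⟨by linarith [fx.2], p1⟩)
        obtain ⟨V, v1, v2⟩ := intermediate_value_Icc' b3.le M.cont.continuousOn (show U' ∈ Icc _ _ from ⟨r1, by linarith [fy.1]⟩)
        refine ⟨U, V, by linarith [u1.1], by linarith [v1.2], ?_, ?_, ?_, Or.inl ⟨?_, Or.inr ⟨u2, v2⟩⟩⟩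
        · refine lt_of_le_of_ne u1.2 ?_; rintro rfl; linarith [fx.2]
        · refine lt_of_le_of_ne v1.1 ?_; rintro rfl; linarith [fy.1]
        · intro t ht
          have mt : t ∈ Icc (lo K (x i)) (hi K (x i)) := ⟨by linarith [u1.1, ht.1], by linarith [v1.2, ht.2]⟩
          rw [← u2, ← v2]
          exact ⟨h mt ⟨by linarith [v1.1], v1.2⟩ ht.2, h ⟨u1.1, by linarith [u1.2]⟩ mt ht.1⟩
        · intro z hz hc; exact W.nolap i z hz ⟨by linarith [u1.1, hc.1], by linarith [v1.2, hc.2]⟩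

/-- pull-back chains -/
structure Chain (f : ℝ → ℝ) (K : Finset ℝ) (x y : ℕ → ℝ) (n : ℕ) (U V : ℕ → ℝ) : Prop where
  st : ∀ i < n, StepC f K (x i) (y i) (U i) (V i) (U (i+1)) (V (i+1))
  top : 0 ≤ U n ∧ V n ≤ 1 ∧ U n < x n ∧ y n < V n

theorem MM.exists_chain (M : MM f K) (W : WSeq f K x y) {ρ : ℝ}
    (hρ : ∀ i k, ¬ Sm f (Icc (lo K (x i)) (hi K (x i))) k ρ) (n : ℕ) : ∀ {k : ℕ} {U' V' : ℝ}, 0 ≤ U' →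
    V' ≤ 1 → U' < x n → y n < V' → Sm f (Ioo U' V') k ρ →
    ∃ U V, Chain f K x y n U V ∧ U n = U' ∧ V n = V' := by
  induction n with
  | zero =>
    intro k U' V' h1 h2 h3 h4 _
    exact ⟨fun _ => U', fun _ => V', ⟨by simp, h1, h2, h3, h4⟩, rfl, rfl⟩
  | succ n ih =>
    intro k U' V' h1 h2 h3 h4 h5
    obtain ⟨u, v, hs⟩ := M.step W hρ h1 h2 h3 h4 h5
    have hs' := hs
    obtain ⟨s1, s2, s3, s4, s5, -⟩ := hs
    have sm : Sm f (Ioo u v) (k+1) ρ := by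
      intro a ha b hb
      rw [Function.iterate_succ_apply, Function.iterate_succ_apply]
      exact h5 _ (s5 ha) _ (s5 hb)
    obtain ⟨U, V, c, e1, e2⟩ := ih s1 s2 s3 s4 sm
    refine ⟨fun i => if i ≤ n then U i else U', fun i => if i ≤ n then V i else V', ⟨?_, ?_⟩, ?_, ?_⟩
    · intro i hi
      rcases Nat.lt_succ_iff_lt_or_eq.1 hi with h | rfl
      · have := c.st i h
        simp only [if_pos h.le, if_pos (show i + 1 ≤ n from h)]
        exact this
      · simp only [le_refl, if_true, if_neg (Nat.not_succ_le_self i), e1, e2]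
        exact hs'
    · simp; exact ⟨h1, h2, h3, h4⟩
    · simp
    · simp

variable {n : ℕ} {U V : ℕ → ℝ}

theorem Chain.bd (C : Chain f K x y n U V) {i : ℕ} (hi : i ≤ n) :
    0 ≤ U i ∧ V i ≤ 1 ∧ U i < x i ∧ y i < V i := by
  rcases hi.lt_or_eq with h | rfl
  · obtain ⟨a, b, c, d, -⟩ := C.st i h; exact ⟨a, b, c, d⟩
  · exact C.top

theorem Chain.mt (C : Chain f K x y n U V) {i : ℕ} (k : ℕ) (hi : i + k ≤ n) :
    MapsTo (f^[k]) (Ioo (U i) (V i)) (Ioo (U (i+k)) (V (i+k))) := by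
  induction k with
  | zero => intro t ht; simpa using ht
  | succ k ih =>
    rw [Function.iterate_succ']
    exact (C.st (i+k) (by omega)).2.2.2.2.1.comp (ih (by omega))

theorem Chain.J (C : Chain f K x y n U V) {i : ℕ} (hi : i ≤ n) :
    Icc (x i) (y i) ⊆ Ioo (U i) (V i) := by
  obtain ⟨-, -, a, b⟩ := C.bd hi
  intro t ht
  exact ⟨by linarith [ht.1], by linarith [ht.2]⟩

theorem Chain.sub (C : Chain f K x y n U V) {i : ℕ} (hi : i ≤ n) : Ioo (U i) (V i) ⊆ Icc 0 1 := by
  obtain ⟨a, b, -, -⟩ := C.bd hi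
  intro t ht
  exact ⟨by linarith [ht.1], by linarith [ht.2]⟩

theorem Chain.isS (M : MM f K) (C : Chain f K x y n U V) {i : ℕ} (hi : i < n) {z : ℝ} (hz : z ∈ K)
    (h : z ∈ Ioo (U i) (V i)) : ∃ e, 0 < e ∧ Ioo (U i) (V i) = S f K z e := by
  obtain ⟨-, -, -, -, -, h1 | ⟨w, hw, e, he, s, a, b, c, d, -⟩⟩ := C.st i hi
  · exact absurd h (h1.1 z hz)
  · have : z = w := only hz (by linarith [h.1]) (by linarith [h.2])
    exact ⟨e, he, this ▸ s⟩

/-- J_m is never in the top interval -/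
def Fresh (x y : ℕ → ℝ) (n : ℕ) (T : Set ℝ) : Prop := ∀ m < n, ¬ Icc (x m) (y m) ⊆ T

theorem Fresh.lower (M : MM f K) (W : WSeq f K x y) (C : Chain f K x y n U V)
    (F : Fresh x y n (Ioo (U n) (V n))) {j : ℕ} (hj : j ≤ n) : Fresh x y j (Ioo (U j) (V j)) := by
  intro m hm h
  refine F (m + (n - j)) (by omega) ?_
  have e1 : j + (n - j) = n := by omega
  have h1 := C.mt (i := j) (n - j) (by omega)
  rw [e1] at h1
  have e := W.endp
  -- endpoints of J_m travel to endpoints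
  have key : ∀ k, (f^[k] (x m) = x (m+k) ∧ f^[k] (y m) = y (m+k)) ∨
            (f^[k] (x m) = y (m+k) ∧ f^[k] (y m) = x (m+k)) := by
    intro k
    induction k with
    | zero => left; simp
    | succ k ih =>
      rw [Function.iterate_succ_apply', Function.iterate_succ_apply']
      rcases ih with ⟨a, b⟩ | ⟨a, b⟩ <;> rw [a, b]
      · exact W.endp (m+k)
      · exact (W.endp (m+k)).symm.imp And.symm And.symm
  have a1 := h1 (h (left_mem_Icc.2 (W.lt m).le))
  have a2 := h1 (h (right_mem_Icc.2 (W.lt m).le))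
  intro t ht
  rcases key (n - j) with ⟨p, q⟩ | ⟨p, q⟩ <;> rw [p] at a1 <;> rw [q] at a2
  · exact ⟨by linarith [a1.1, ht.1], by linarith [a2.2, ht.2]⟩
  · exact ⟨by linarith [a2.1, ht.1], by linarith [a1.2, ht.2]⟩

/-- trapping from a nested repetition -/
theorem cross_mod {Y : Set ℝ} {m : ℕ} (hm : 1 ≤ m) (hmt : MapsTo (f^[m]) Y Y) {c : ℝ} (h : Cross f Y c) :
    ∃ r < m, ∃ a ∈ Y, ∃ b ∈ Y, f^[r] a < c ∧ c < f^[r] b := by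
  obtain ⟨t, a, ha, b, hb, h1⟩ := h
  have hk : ∀ k, MapsTo (f^[m*k]) Y Y := fun k => by
    rw [Function.iterate_mul]; exact hmt.iterate k
  refine ⟨t % m, Nat.mod_lt _ hm, f^[m*(t/m)] a, hk _ ha, f^[m*(t/m)] b, hk _ hb, ?_⟩
  rw [← Function.iterate_add_apply, ← Function.iterate_add_apply, Nat.mod_add_div]
  exact h1

theorem MM.norepeat (M : MM f K) (W : WSeq f K x y) {c : ℝ}
    (hc : ∀ Y m, Trap f x y Y m → Cross f Y c) (C : Chain f K x y n U V)
    (F : Fresh x y n (Ioo (U n) (V n))) {s0 : ℕ} (hno : ∀ i, s0 ≤ i → i < n → c ∉ Ioo (U i) (V i))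
    {i j : ℕ} (hs : s0 ≤ i) (hij : i < j) (hj : j < n) {z : ℝ} (hz : z ∈ K)
    (h1 : z ∈ Ioo (U i) (V i)) (h2 : z ∈ Ioo (U j) (V j)) : False := by
  obtain ⟨e1, -, s1⟩ := C.isS M (hij.trans hj) hz h1
  obtain ⟨e2, -, s2⟩ := C.isS M hj hz h2
  have hFj := Fresh.lower M W C F hj.le
  have hlt : e2 ≤ e1 := by
    by_contra hcon
    push Not at hcon
    refine hFj i hij ?_
    rw [s2]
    refine (C.J (hij.trans hj).le).trans ?_
    rw [s1]; exact S_mono hcon.le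
  have hsub : Ioo (U j) (V j) ⊆ Ioo (U i) (V i) := by rw [s1, s2]; exact S_mono hlt
  have e : i + (j - i) = j := by omega
  have hmt : MapsTo (f^[j-i]) (Ioo (U i) (V i)) (Ioo (U i) (V i)) := by
    have := C.mt (i := i) (j - i) (by omega)
    rw [e] at this
    exact this.mono_right hsub
  have hcr := hc _ (j-i) ⟨C.sub (by omega), ordConnected_Ioo, by omega, hmt, i, C.J (by omega)⟩
  obtain ⟨r, hr, a, ha, b, hb, hab⟩ := cross_mod (by omega) hmt hcr
  have ma := C.mt (i := i) r (by omega) ha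
  have mb := C.mt (i := i) r (by omega) hb
  exact hno (i+r) (by omega) (by omega) ⟨ma.1.trans hab.1, hab.2.trans mb.2⟩

end
end WI

namespace WI
section
variable {f : ℝ → ℝ} {K : Finset ℝ} {x y : ℕ → ℝ}
open Filter Topology

theorem Sp.mono {β β' u a b w : ℝ} (h : Sp β u a b w) (hb : β ≤ β') (h1 : u < a) (h2 : b < w) :
    Sp β' u a b w := by
  unfold Sp at *
  have : 0 ≤ (a - u) * (w - b) := mul_nonneg (by linarith) (by linarith)
  nlinarith

theorem Sp.left {β u a b w : ℝ} (h : Sp β u a b w) (h1 : u < a) (h0 : a < b) (h2 : b < w) :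
    b - a ≤ β * (a - u) := by
  unfold Sp at h
  have h3 : (w - b) * (b - a) ≤ (w - b) * (β * (a - u)) := by nlinarith
  exact le_of_mul_le_mul_left h3 (by linarith)

theorem Sp.right {β u a b w : ℝ} (h : Sp β u a b w) (h1 : u < a) (h0 : a < b) (h2 : b < w) :
    b - a ≤ β * (w - b) := by
  unfold Sp at h
  have h3 : (a - u) * (b - a) ≤ (a - u) * (β * (w - b)) := by nlinarith
  exact le_of_mul_le_mul_left h3 (by linarith)

theorem Sp.of {b u a c w : ℝ} (hb : 0 ≤ b) (h1 : u < a) (h0 : a < c) (h2 : c < w)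
    (hl : c - a ≤ b * (a - u)) (hr : c - a ≤ b * (w - c)) : Sp (2 * b + b ^ 2) u a c w := by
  unfold Sp
  have hL : 0 < a - u := by linarith
  have hR : 0 < w - c := by linarith
  have hJ : 0 < c - a := by linarith
  have e1 : (a - u) * (c - a) ≤ (a - u) * (b * (w - c)) := mul_le_mul_of_nonneg_left hr hL.le
  have e2 : (w - c) * (c - a) ≤ (w - c) * (b * (a - u)) := mul_le_mul_of_nonneg_left hl hR.le
  have e3 : (c - a) * (c - a) ≤ (b * (a - u)) * (b * (w - c)) :=
    mul_le_mul hl hr hJ.le (mul_nonneg hb hL.le)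
  nlinarith

/-- pull back through a CRE map sending ends to ends -/
theorem Sp.pull {h : ℝ → ℝ} {β u a b w u' a' b' w' : ℝ} (H : CRE h u w) (h1 : u < a) (h0 : a < b)
    (h2 : b < w) (h1' : u' < a') (h2' : b' < w')
    (he : (h u = u' ∧ h a = a' ∧ h b = b' ∧ h w = w') ∨ (h u = w' ∧ h a = b' ∧ h b = a' ∧ h w = u'))
    (h0' : a' < b') (hs : Sp β u' a' b' w') : Sp β u a b w := by
  have k := H u a b w le_rfl h1 h0 h2 le_rfl
  unfold Sp at *
  have key : (w - u) * (b - a) * ((a' - u') * (w' - b')) ≤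
      ((w' - u') * (b' - a')) * ((a - u) * (w - b)) := by
    rcases he with ⟨e1, e2, e3, e4⟩ | ⟨e1, e2, e3, e4⟩
    · rw [e1, e2, e3, e4, abs_of_pos (by linarith : 0 < a' - u'), abs_of_pos (by linarith : 0 < w' - b'),
        abs_of_pos (by linarith : 0 < w' - u'), abs_of_pos (by linarith : 0 < b' - a')] at k
      exact k
    · rw [e1, e2, e3, e4, abs_of_neg (by linarith : b' - w' < 0), abs_of_neg (by linarith : u' - a' < 0),
        abs_of_neg (by linarith : u' - w' < 0), abs_of_neg (by linarith : a' - b' < 0)] at k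
      calc _ = (w - u) * (b - a) * (-(b' - w') * -(u' - a')) := by ring
        _ ≤ _ := k
        _ = _ := by ring
  have p' : 0 < (a' - u') * (w' - b') := mul_pos (by linarith) (by linarith)
  have p : 0 < (a - u) * (w - b) := mul_pos (by linarith) (by linarith)
  have : (w - u) * (b - a) * ((a' - u') * (w' - b')) ≤
      (β * ((a - u) * (w - b))) * ((a' - u') * (w' - b')) := by
    refine key.trans ?_
    have := mul_le_mul_of_nonneg_right hs p.le
    linarith
  exact le_of_mul_le_mul_right this p'

theorem MM.sp_np (M : MM f K) (W : WSeq f K x y) {i : ℕ} {U V U' V' β : ℝ}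
    (hst : StepC f K (x i) (y i) U V U' V') (hnp : NPs f K U V U' V') (h1 : U' < x (i+1)) (h2 : y (i+1) < V')
    (hs : Sp β U' (x (i+1)) (y (i+1)) V') : Sp β U (x i) (y i) V := by
  obtain ⟨s1, s2, s3, s4, s5, -⟩ := hst
  obtain ⟨k1, k2⟩ := hnp
  have hlt := W.lt i
  have hlt' := W.lt (i+1)
  have cre := M.cre s1 s2 k1
  refine Sp.pull cre s3 hlt s4 h1 h2 ?_ hlt' hs
  have mU : U ∈ Icc U V := ⟨le_rfl, by linarith⟩
  have mV : V ∈ Icc U V := ⟨by linarith, le_rfl⟩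
  have mx : x i ∈ Icc U V := ⟨by linarith, by linarith⟩
  have my : y i ∈ Icc U V := ⟨by linarith, by linarith⟩
  rcases M.lapmono s1 s2 k1 with m | m
  · have a1 := m mU mx s3
    have a2 := m mx my hlt
    have a3 := m my mV s4
    rcases k2 with ⟨q1, q2⟩ | ⟨q1, q2⟩ <;> rcases W.endp i with ⟨e1, e2⟩ | ⟨e1, e2⟩
    · exact Or.inl ⟨q1, e1, e2, q2⟩
    all_goals linarith
  · have a1 := m mU mx s3
    have a2 := m mx my hlt
    have a3 := m my mV s4
    rcases k2 with ⟨q1, q2⟩ | ⟨q1, q2⟩ <;> rcases W.endp i with ⟨e1, e2⟩ | ⟨e1, e2⟩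
    pick_goal 4
    · exact Or.inr ⟨q1, e1, e2, q2⟩
    all_goals linarith

theorem enl {X c B g : ℝ} (h : X ≤ c * g) (h1 : c ≤ B) (h2 : 0 ≤ g) : X ≤ B * g :=
  h.trans (mul_le_mul_of_nonneg_right h1 h2)

/-- pass estimate -/
theorem MM.passest (M : MM f K) : ∃ Ψ : ℝ → ℝ, (∀ β, 0 ≤ β → β ≤ Ψ β) ∧
    (∀ α β, 0 ≤ α → α ≤ β → Ψ α ≤ Ψ β) ∧
    ∀ a b z e U V β : ℝ, 0 ≤ β → z ∈ K → a < b → lo K z ≤ U → U < z → z < V → V ≤ hi K z → U < a → b < V →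
      ((z < a ∧ |f V - f z| = e ∧ (U = lo K z ∨ |f U - f z| = e) ∧ |f b - f a| ≤ β * |f V - f b|) ∨
       (b < z ∧ |f U - f z| = e ∧ (V = hi K z ∨ |f V - f z| = e) ∧ |f b - f a| ≤ β * |f U - f a|)) →
      Sp (Ψ β) U a b V := by
  obtain ⟨C, hC, hd⟩ := M.dist2
  obtain ⟨d, hd0, hgap⟩ := M.gapconst
  refine ⟨fun β => 2 * (1 + C * β + C + 1 / d) + (1 + C * β + C + 1 / d) ^ 2, ?_, ?_, ?_⟩
  · intro β hβ
    have : 0 < 1 / d := by positivity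
    have : β ≤ C * β := by nlinarith
    nlinarith [sq_nonneg (1 + C * β + C + 1 / d)]
  · intro α β hα hαβ
    have h0 : 0 < 1 / d := by positivity
    have h1 : C * α ≤ C * β := by nlinarith
    have h2 : 0 ≤ C * α := by positivity
    have : (1 + C * α + C + 1 / d) ^ 2 ≤ (1 + C * β + C + 1 / d) ^ 2 := by gcongr
    dsimp only; linarith
  · intro a b z e U V β hβ hz hab hU hUz hzV hV hUa hbV hcase
    obtain ⟨n1, n2, n3, n4, n5, n6⟩ := M.near hz
    obtain ⟨l1, l2, -⟩ := M.lev hz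
    have hid : 0 < 1 / d := by positivity
    have hCβ : 0 ≤ C * β := by positivity
    obtain ⟨g1, g2⟩ := hgap z hz
    have d1 : 1 = (1 / d) * d := by field_simp
    have nK : ∀ p q, lo K z ≤ p → q ≤ hi K z → (z ≤ p ∨ q ≤ z) → ∀ w ∈ K, ¬ (p < w ∧ w < q) := by
      rintro p q h1 h2 h3 w hw ⟨h4, h5⟩
      have := only hw (by linarith) (by linarith)
      rcases h3 with h | h <;> linarith
    rcases hcase with ⟨hza, hVe, hUe, hb⟩ | ⟨hza, hUe, hVe, hb⟩
    · refine Sp.of (by positivity) hUa hab hbV ?_ ?_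
      · -- inner (left) side
        rcases hUe with rfl | hUe
        · have : d ≤ a - lo K z := by linarith
          have : (1/d) * d ≤ (1/d) * (a - lo K z) := by gcongr
          exact enl (c := 1/d) (by linarith) (by linarith) (by linarith)
        · by_cases hc : b - z ≤ z - U
          · exact enl (c := 1) (by linarith) (by linarith) (by linarith)
          · push Not at hc
            have q := hd z b n5.le (by linarith) (by linarith) (nK _ _ n2.le (by linarith) (Or.inl le_rfl)) U
              ⟨by linarith, by linarith⟩ z ⟨n5.le, n6.le⟩ (by linarith) (by linarith) (by linarith) (by linarith)
            rw [hUe, abs_of_neg (by linarith : U - z < 0)] at q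
            have lt : |f b - f z| < e := by
              rw [← hVe]; exact l2 ⟨by linarith, by linarith⟩ ⟨hzV.le, hV⟩ hbV
            have e0 : 0 < e := (abs_nonneg _).trans_lt lt
            have : e * (b - z) ≤ e * (C * (z - U)) := by
              have : C * |f b - f z| * (z - U) ≤ C * e * (z - U) := by gcongr
              linarith
            have := le_of_mul_le_mul_left this e0
            have m : C * (z - U) ≤ C * (a - U) := by gcongr
            exact enl (c := C) (by linarith) (by linarith) (by linarith)
      · by_cases hc : b - a ≤ V - b
        · exact enl (c := 1) (by linarith) (by linarith) (by linarith)
        · push Not at hc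
          have q := hd a b (by linarith) hab (by linarith) (nK _ _ (by linarith) (by linarith) (Or.inl hza.le)) V
            ⟨by linarith, by linarith⟩ b ⟨by linarith, by linarith⟩ (by linarith) (by linarith) (by linarith) (by linarith)
          rw [abs_of_pos (by linarith : 0 < V - b)] at q
          have lt : |f b - f z| < |f V - f z| := l2 ⟨by linarith, by linarith⟩ ⟨hzV.le, hV⟩ hbV
          have pos : 0 < |f V - f b| := by
            rw [abs_pos]; intro h0; rw [sub_eq_zero.1 h0] at lt; exact lt_irrefl _ lt
          have : |f V - f b| * (b - a) ≤ |f V - f b| * (C * β * (V - b)) := by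
            have : C * |f b - f a| * (V - b) ≤ C * (β * |f V - f b|) * (V - b) := by gcongr
            linarith
          have := le_of_mul_le_mul_left this pos
          exact enl this (by linarith) (by linarith)
    · refine Sp.of (by positivity) hUa hab hbV ?_ ?_
      · by_cases hc : b - a ≤ a - U
        · exact enl (c := 1) (by linarith) (by linarith) (by linarith)
        · push Not at hc
          have q := hd a b (by linarith) hab (by linarith) (nK _ _ (by linarith) (by linarith) (Or.inr hza.le)) U
            ⟨by linarith, by linarith⟩ a ⟨by linarith, by linarith⟩ (by linarith) (by linarith) (by linarith) (by linarith)
          rw [abs_of_neg (by linarith : U - a < 0)] at q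
          have lt : |f a - f z| < |f U - f z| := l1 ⟨by linarith, by linarith⟩ ⟨by linarith, by linarith⟩ hUa
          have pos : 0 < |f U - f a| := by
            rw [abs_pos]; intro h0; rw [sub_eq_zero.1 h0] at lt; exact lt_irrefl _ lt
          have : |f U - f a| * (b - a) ≤ |f U - f a| * (C * β * (a - U)) := by
            have : C * |f b - f a| * (a - U) ≤ C * (β * |f U - f a|) * (a - U) := by gcongr
            linarith
          have := le_of_mul_le_mul_left this pos
          exact enl this (by linarith) (by linarith)
      · rcases hVe with rfl | hVe
        · have : d ≤ hi K z - b := by linarith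
          have : (1/d) * d ≤ (1/d) * (hi K z - b) := by gcongr
          exact enl (c := 1/d) (by linarith) (by linarith) (by linarith)
        · by_cases hc : z - a ≤ V - z
          · exact enl (c := 1) (by linarith) (by linarith) (by linarith)
          · push Not at hc
            have q := hd a z (by linarith) (by linarith) (by linarith) (nK _ _ (by linarith) (by linarith) (Or.inr le_rfl)) V
              ⟨by linarith, by linarith⟩ z ⟨n5.le, n6.le⟩ (by linarith) (by linarith) (by linarith) (by linarith)
            rw [hVe, abs_of_pos (by linarith : 0 < V - z), abs_sub_comm] at q
            have lt : |f a - f z| < e := by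
              rw [← hUe]; exact l1 ⟨by linarith, by linarith⟩ ⟨by linarith, by linarith⟩ hUa
            have e0 : 0 < e := (abs_nonneg _).trans_lt lt
            have : e * (z - a) ≤ e * (C * (V - z)) := by
              have : C * |f a - f z| * (V - z) ≤ C * e * (V - z) := by gcongr
              linarith
            have := le_of_mul_le_mul_left this e0
            have m : C * (V - z) ≤ C * (V - b) := by gcongr
            exact enl (c := C) (by linarith) (by linarith) (by linarith)

end
end WI

namespace WI
section
variable {f : ℝ → ℝ} {K : Finset ℝ} {x y : ℕ → ℝ}
open Filter Topology

theorem run_half {h : ℝ → ℝ} {u w a b s t B θ : ℝ} (H : CRE h u w) (hm : StrictMonoOn h (Icc u w))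
    (hus : u ≤ s) (hst : s < t) (htm : t ≤ (a + b) / 2) (hab : a < b) (hbw : b < w) (hua : u ≤ a)
    (hθ : 0 ≤ θ) (hsa : a - θ * (b - a) ≤ s) (hB : 0 ≤ B) (hJ : h b - h a ≤ B * (h w - h b))
    (h1 : θ * (B + 1) ≤ 1 / 2) : (h t - h s) * (b - a) ≤ (8 * B + 4) * (h b - h a) * (t - s) := by
  have htb : t < b := by linarith
  have ms : s ∈ Icc u w := ⟨hus, by linarith⟩
  have mt : t ∈ Icc u w := ⟨by linarith, by linarith⟩
  have ma : a ∈ Icc u w := ⟨by linarith, by linarith⟩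
  have mb : b ∈ Icc u w := ⟨by linarith, by linarith⟩
  have mw : w ∈ Icc u w := ⟨by linarith, le_rfl⟩
  have R0 : 0 < h w - h b := by linarith [hm mb mw hbw]
  have J0 : 0 < h b - h a := by linarith [hm ma mb hab]
  set R := h w - h b with hR
  set J := h b - h a with hJd
  have key : h b - h s ≤ 2 * J := by
    rcases le_or_gt a s with h' | h'
    · linarith [hm.monotoneOn ma ms h']
    · have D0 : 0 < h a - h s := by linarith [hm ms ma h']
      have k := H s a b w hus h' hab hbw le_rfl
      rw [abs_of_pos D0, abs_of_pos (by linarith : 0 < h w - h b), abs_of_pos (by linarith : 0 < h w - h s),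
        abs_of_pos (by linarith : 0 < h b - h a)] at k
      set D := h a - h s with hD
      have e : h w - h s = D + J + R := by rw [hD, hJd, hR]; ring
      rw [← hR, ← hJd, e] at k
      have p : 0 < (w - s) * (b - a) := mul_pos (by linarith) (by linarith)
      have k2 : (w - s) * (b - a) * (D * R) ≤ (w - s) * (b - a) * ((D + J + R) * J * θ) := by
        refine k.trans ?_
        have : (a - s) * (w - b) ≤ (θ * (b - a)) * (w - s) :=
          mul_le_mul (by linarith) (by linarith) (by linarith) (mul_nonneg hθ (by linarith))
        have := mul_le_mul_of_nonneg_left this (show 0 ≤ (D + J + R) * J by positivity)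
        linarith
      have k3 := le_of_mul_le_mul_left k2 p
      have t1 : J * (D + J) ≤ B * R * (D + J) := mul_le_mul_of_nonneg_right hJ (by positivity)
      have t2 : θ * (J * (D + J)) ≤ θ * (B * R * (D + J)) := mul_le_mul_of_nonneg_left t1 hθ
      have t3 : θ * (B + 1) * (R * (D + J)) ≤ 1 / 2 * (R * (D + J)) := mul_le_mul_of_nonneg_right h1 (by positivity)
      have t4 : 0 ≤ θ * R * D := by positivity
      have : R * D ≤ R * J := by nlinarith
      have := le_of_mul_le_mul_left this R0
      linarith
  have k := H s t b w hus hst htb hbw le_rfl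
  have T0 : 0 < h t - h s := by linarith [hm ms mt hst]
  have B0 : 0 < h b - h t := by linarith [hm mt mb htb]
  rw [abs_of_pos T0, abs_of_pos (by linarith : 0 < h w - h b), abs_of_pos (by linarith : 0 < h w - h s),
        abs_of_pos B0, ← hR] at k
  have w0 : 0 < w - b := by linarith
  have k2 : (w - b) * ((b - a) / 2 * ((h t - h s) * R)) ≤ (w - b) * (((1 + 2 * B) * R) * (2 * J) * (t - s)) := by
    calc _ ≤ (w - s) * (b - t) * ((h t - h s) * R) := by
          have : (w - b) * ((b - a) / 2) ≤ (w - s) * (b - t) :=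
            mul_le_mul (by linarith) (by linarith) (by linarith) (by linarith)
          have := mul_le_mul_of_nonneg_right this (show 0 ≤ (h t - h s) * R by positivity)
          linarith
      _ ≤ _ := k
      _ ≤ ((1 + 2 * B) * R) * (2 * J) * ((t - s) * (w - b)) := by
          refine mul_le_mul_of_nonneg_right (mul_le_mul (by linarith) (by linarith) B0.le (by positivity)) ?_
          exact mul_nonneg (by linarith) (by linarith)
      _ = _ := by ring
  have k3 := le_of_mul_le_mul_left k2 w0
  have k4 : R * ((h t - h s) * (b - a)) ≤ R * ((8 * B + 4) * J * (t - s)) := by linarith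
  exact le_of_mul_le_mul_left k4 R0

theorem CRE.neg {h : ℝ → ℝ} {u w : ℝ} (H : CRE h u w) : CRE (fun t => - h t) u w := by
  intro p a b q h1 h2 h3 h4 h5
  have := H p a b q h1 h2 h3 h4 h5
  have e : ∀ s t, |-h s - -h t| = |h s - h t| := fun s t => by rw [← abs_neg]; congr 1; ring
  simp only [e]; exact this

theorem CRE.refl {h : ℝ → ℝ} {u w : ℝ} (H : CRE h u w) : CRE (fun t => - h (-t)) (-w) (-u) := by
  intro p a b q h1 h2 h3 h4 h5
  have := H (-q) (-b) (-a) (-p) (by linarith) (by linarith) (by linarith) (by linarith) (by linarith)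
  have e : ∀ s t, |-h s - -h t| = |h t - h s| := fun s t => by congr 1; ring
  simp only [e]
  calc _ = (-p - -q) * (-a - -b) * (|h (-b) - h (-q)| * |h (-p) - h (-a)|) := by
        rw [abs_sub_comm (h (-p)), abs_sub_comm (h (-b))]
        rw [abs_sub_comm (h (-a)), abs_sub_comm (h (-q))]; ring
    _ ≤ _ := this
    _ = _ := by rw [abs_sub_comm (h (-p)), abs_sub_comm (h (-a))]; rw [abs_sub_comm (h (-q)), abs_sub_comm (h (-b))]; ring

theorem run_mono {h : ℝ → ℝ} {u w a b s t B θ : ℝ} (H : CRE h u w) (hm : StrictMonoOn h (Icc u w))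
    (hus : u ≤ s) (hst : s ≤ t) (htw : t ≤ w) (hab : a < b) (hbw : b < w) (hua : u < a)
    (hθ : 0 ≤ θ) (hsa : a - θ * (b - a) ≤ s) (htb : t ≤ b + θ * (b - a)) (hB : 0 ≤ B)
    (hJ : h b - h a ≤ B * (h w - h b)) (hJ' : h b - h a ≤ B * (h a - h u))
    (h1 : θ * (B + 1) ≤ 1 / 2) : (h t - h s) * (b - a) ≤ (8 * B + 4) * (h b - h a) * (t - s) := by
  have left : ∀ s t, u ≤ s → s ≤ t → t ≤ (a+b)/2 → a - θ * (b - a) ≤ s →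
      (h t - h s) * (b - a) ≤ (8 * B + 4) * (h b - h a) * (t - s) := by
    intro s t hus hst htm hsa
    rcases hst.eq_or_lt with rfl | hlt
    · simp
    · exact run_half H hm hus hlt htm hab hbw hua.le hθ hsa hB hJ h1
  have right : ∀ s t, s ≤ t → t ≤ w → (a+b)/2 ≤ s → t ≤ b + θ * (b - a) →
      (h t - h s) * (b - a) ≤ (8 * B + 4) * (h b - h a) * (t - s) := by
    intro s t hst htw hsm htb
    rcases hst.eq_or_lt with rfl | hlt
    · simp
    · have hm' : StrictMonoOn (fun t => - h (-t)) (Icc (-w) (-u)) := by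
        intro p hp q hq hpq
        have := hm (a := -q) (b := -p) ⟨by linarith [hq.2], by linarith [hq.1]⟩ ⟨by linarith [hp.2], by linarith [hp.1]⟩ (by linarith)
        simp only; linarith
      have := run_half (s := -t) (t := -s) (a := -b) (b := -a) H.refl hm' (by linarith) (by linarith) (by linarith) (by linarith)
        (by linarith) (by linarith) hθ (by linarith) hB (by simp only [neg_neg]; linarith) h1
      simp only [neg_neg] at this
      linarith
  rcases le_total t ((a+b)/2) with h' | h'
  · exact left s t hus hst h' hsa
  · rcases le_total s ((a+b)/2) with h'' | h''
    · have e1 := left s ((a+b)/2) hus h'' le_rfl hsa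
      have e2 := right ((a+b)/2) t h' htw le_rfl htb
      linarith
    · exact right s t hst htw h'' htb

theorem run_abs {h : ℝ → ℝ} {u w a b s t B θ : ℝ} (H : CRE h u w)
    (hm : StrictMonoOn h (Icc u w) ∨ StrictAntiOn h (Icc u w))
    (hs : s ∈ Icc u w) (ht : t ∈ Icc u w) (hab : a < b) (hbw : b < w) (hua : u < a)
    (hθ : 0 ≤ θ) (hs' : s ∈ Icc (a - θ * (b - a)) (b + θ * (b - a)))
    (ht' : t ∈ Icc (a - θ * (b - a)) (b + θ * (b - a))) (hB : 0 ≤ B)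
    (hJ : |h b - h a| ≤ B * |h w - h b|) (hJ' : |h b - h a| ≤ B * |h a - h u|)
    (h1 : θ * (B + 1) ≤ 1 / 2) : |h t - h s| * (b - a) ≤ (8 * B + 4) * |h b - h a| * |t - s| := by
  wlog hst : s ≤ t generalizing s t
  · have := this ht hs ht' hs' (le_of_not_ge hst)
    rwa [abs_sub_comm, abs_sub_comm t s]
  have ma : a ∈ Icc u w := ⟨by linarith, by linarith⟩
  have mb : b ∈ Icc u w := ⟨by linarith, by linarith⟩
  have mu : u ∈ Icc u w := ⟨by linarith, by linarith⟩
  have mw : w ∈ Icc u w := ⟨by linarith, by linarith⟩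
  rw [abs_of_nonneg (sub_nonneg.2 hst)]
  rcases hm with hm | hm
  · rw [abs_of_nonneg (sub_nonneg.2 (hm.monotoneOn hs ht hst))]
    rw [abs_of_pos (sub_pos.2 (hm ma mb hab))] at *
    rw [abs_of_pos (sub_pos.2 (hm mb mw hbw))] at hJ
    rw [abs_of_pos (sub_pos.2 (hm mu ma hua))] at hJ'
    exact run_mono H hm hs.1 hst ht.2 hab hbw hua hθ hs'.1 ht'.2 hB hJ hJ' h1
  · have hm' : StrictMonoOn (fun t => - h t) (Icc u w) := hm.neg
    rw [abs_sub_comm, abs_of_nonneg (sub_nonneg.2 (hm.antitoneOn hs ht hst))]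
    rw [abs_sub_comm (h b), abs_of_pos (sub_pos.2 (hm ma mb hab))] at *
    rw [abs_sub_comm, abs_of_pos (sub_pos.2 (hm mb mw hbw))] at hJ
    rw [abs_sub_comm (h a), abs_of_pos (sub_pos.2 (hm mu ma hua))] at hJ'
    have := run_mono H.neg hm' hs.1 hst ht.2 hab hbw hua hθ hs'.1 ht'.2 hB (by linarith) (by linarith) h1
    linarith

end
end WI

namespace WI
section
variable {f : ℝ → ℝ} {K : Finset ℝ} {x y : ℕ → ℝ}
open Filter Topology

theorem WSeq.it_endp (W : WSeq f K x y) (m k : ℕ) : (f^[k] (x m) = x (m+k) ∧ f^[k] (y m) = y (m+k)) ∨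
            (f^[k] (x m) = y (m+k) ∧ f^[k] (y m) = x (m+k)) := by
  induction k with
  | zero => left; simp
  | succ k ih =>
    rw [Function.iterate_succ_apply', Function.iterate_succ_apply']
    rcases ih with ⟨a, b⟩ | ⟨a, b⟩ <;> rw [a, b]
    · exact W.endp (m+k)
    · exact (W.endp (m+k)).symm.imp And.symm And.symm

theorem WSeq.abs_endp (W : WSeq f K x y) (m : ℕ) : |f (y m) - f (x m)| = y (m+1) - x (m+1) := by
  have := W.lt (m+1)
  rcases W.endp m with ⟨a, b⟩ | ⟨a, b⟩ <;> rw [a, b]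
  · exact abs_of_pos (by linarith)
  · rw [abs_sub_comm]; exact abs_of_pos (by linarith)

/-- pass estimate property of a function Ψ -/
def PE (f : ℝ → ℝ) (K : Finset ℝ) (Ψ : ℝ → ℝ) : Prop := (∀ β, 0 ≤ β → β ≤ Ψ β) ∧
    (∀ α β, 0 ≤ α → α ≤ β → Ψ α ≤ Ψ β) ∧
    ∀ a b z e U V β : ℝ, 0 ≤ β → z ∈ K → a < b → lo K z ≤ U → U < z → z < V → V ≤ hi K z → U < a → b < V →
      ((z < a ∧ |f V - f z| = e ∧ (U = lo K z ∨ |f U - f z| = e) ∧ |f b - f a| ≤ β * |f V - f b|) ∨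
       (b < z ∧ |f U - f z| = e ∧ (V = hi K z ∨ |f V - f z| = e) ∧ |f b - f a| ≤ β * |f U - f a|)) →
      Sp (Ψ β) U a b V

theorem PE.sp_pass {Ψ : ℝ → ℝ} (P : PE f K Ψ) (W : WSeq f K x y) {i : ℕ} {U V U' V' β : ℝ}
    (hβ : 0 ≤ β)
    (hst : StepC f K (x i) (y i) U V U' V') (hps : Ps f K (x i) (y i) U V U' V')
    (h1 : U' < x (i+1)) (h2 : y (i+1) < V')
    (hs : Sp β U' (x (i+1)) (y (i+1)) V') : Sp (Ψ β) U (x i) (y i) V := by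
  obtain ⟨z, hz, e, he, hS, q1, q2, q3, q4, q5⟩ := hps
  have hlt := W.lt (i+1)
  have hL := hs.left h1 hlt h2
  have hR := hs.right h1 hlt h2
  have gen : ∀ p q, ((q = y (i+1)) ∨ (q = x (i+1))) → (p = U' ∨ p = V') →
      |f (y i) - f (x i)| ≤ β * |p - q| := by
    intro p q hq hp
    rw [W.abs_endp]
    rcases hp with rfl | rfl
    · refine hL.trans (mul_le_mul_of_nonneg_left ?_ hβ)
      rw [abs_sub_comm]; refine le_trans ?_ (le_abs_self _)
      rcases hq with rfl | rfl <;> linarith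
    · refine hR.trans (mul_le_mul_of_nonneg_left ?_ hβ)
      refine le_trans ?_ (le_abs_self _)
      rcases hq with rfl | rfl <;> linarith
  have ex : f (x i) = y (i+1) ∨ f (x i) = x (i+1) := by
    rcases W.endp i with ⟨a, b⟩ | ⟨a, b⟩ <;> simp [a]
  have ey : f (y i) = y (i+1) ∨ f (y i) = x (i+1) := by
    rcases W.endp i with ⟨a, b⟩ | ⟨a, b⟩ <;> simp [b]
  refine P.2.2 (x i) (y i) z e U V β hβ hz (W.lt i) q1 q2 q3 q4 hst.2.2.1 hst.2.2.2.1 ?_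
  rcases q5 with ⟨a, b, c, d⟩ | ⟨a, b, c, d⟩
  · exact Or.inl ⟨a, b, d, gen _ _ ey c⟩
  · exact Or.inr ⟨a, b, d, gen _ _ ex c⟩

variable {n : ℕ} {U V : ℕ → ℝ}

def NRep (K : Finset ℝ) (U V : ℕ → ℝ) (s0 n : ℕ) : Prop :=
  ∀ i j, s0 ≤ i → i < j → j < n → ∀ z ∈ K, z ∈ Ioo (U i) (V i) → z ∈ Ioo (U j) (V j) → False

open Classical in
def PS (K : Finset ℝ) (U V : ℕ → ℝ) (n i : ℕ) : Finset ℝ :=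
  K.filter (fun z => ∃ j, i ≤ j ∧ j < n ∧ z ∈ Ioo (U j) (V j))

theorem PS_anti {i j : ℕ} (h : i ≤ j) : PS K U V n j ⊆ PS K U V n i := by
  intro z hz
  simp only [PS, Finset.mem_filter] at *
  obtain ⟨a, k, b, c, d⟩ := hz
  exact ⟨a, k, h.trans b, c, d⟩

theorem PS_lt {s0 i : ℕ} (N : NRep K U V s0 n) (h : s0 ≤ i) (hi : i < n) {z : ℝ} (hz : z ∈ K)
    (hzi : z ∈ Ioo (U i) (V i)) : (PS K U V n (i+1)).card + 1 ≤ (PS K U V n i).card := by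
  have h1 : z ∉ PS K U V n (i+1) := by
    simp only [PS, Finset.mem_filter]
    rintro ⟨-, k, b, c, d⟩
    exact N i k h (by omega) c z hz hzi d
  rw [← Finset.card_insert_of_notMem h1]
  apply Finset.card_le_card
  intro w hw
  rcases Finset.mem_insert.1 hw with rfl | hw
  · simp only [PS, Finset.mem_filter]; exact ⟨hz, i, le_rfl, hi, hzi⟩
  · exact PS_anti (Nat.le_succ i) hw

theorem PE.it_le {Ψ : ℝ → ℝ} (P : PE f K Ψ) {β : ℝ} (hβ : 0 ≤ β) (k : ℕ) : β ≤ Ψ^[k] β := by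
  induction k with
  | zero => simp
  | succ k ih =>
    rw [Function.iterate_succ_apply']
    exact ih.trans (P.1 _ (hβ.trans ih))

theorem PE.it_mono {Ψ : ℝ → ℝ} (P : PE f K Ψ) {β : ℝ} (hβ : 0 ≤ β) {k m : ℕ} (h : k ≤ m) :
    Ψ^[k] β ≤ Ψ^[m] β := by
  obtain ⟨d, rfl⟩ := Nat.exists_eq_add_of_le h
  rw [add_comm, Function.iterate_add_apply]
  exact P.it_le (hβ.trans (P.it_le hβ k)) d

theorem MM.spchain (M : MM f K) (W : WSeq f K x y) {Ψ : ℝ → ℝ} (P : PE f K Ψ)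
    (C : Chain f K x y n U V) {s0 : ℕ} (N : NRep K U V s0 n) {β : ℝ} (hβ : 0 ≤ β)
    (hs : Sp β (U n) (x n) (y n) (V n)) {i : ℕ} (h0 : s0 ≤ i) (hi : i ≤ n) :
    Sp (Ψ^[K.card] β) (U i) (x i) (y i) (V i) := by
  have main : ∀ d i, i + d = n → s0 ≤ i → Sp (Ψ^[(PS K U V n i).card] β) (U i) (x i) (y i) (V i) := by
    intro d
    induction d with
    | zero =>
      intro i hi _
      have : i = n := by omega
      subst this
      exact hs.mono (P.it_le hβ _) C.top.2.2.1 C.top.2.2.2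
    | succ d ih =>
      intro i hi h0
      have hin : i < n := by omega
      have k := ih (i+1) (by omega) (by omega)
      have st := C.st i hin
      have bd := C.bd (i := i+1) (by omega)
      have bd' := C.bd (i := i) (by omega)
      rcases st.2.2.2.2.2 with h | h
      · have := M.sp_np W st h bd.2.2.1 bd.2.2.2 k
        exact this.mono (P.it_mono hβ (Finset.card_le_card (PS_anti (Nat.le_succ i)))) bd'.2.2.1 bd'.2.2.2
      · have := P.sp_pass W (hβ.trans (P.it_le hβ _)) st h bd.2.2.1 bd.2.2.2 k
        rw [← Function.iterate_succ_apply' (f := Ψ)] at this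
        obtain ⟨z, hz, e, he, hS, q1, q2, q3, q4, q5⟩ := h
        exact this.mono (P.it_mono hβ (PS_lt N h0 hin hz ⟨q2, q3⟩)) bd'.2.2.1 bd'.2.2.2
  have bd' := C.bd hi
  refine (main (n - i) i (by omega) h0).mono (P.it_mono hβ ?_) bd'.2.2.1 bd'.2.2.2
  exact Finset.card_le_card (fun z hz => (by simp only [PS, Finset.mem_filter] at hz; exact hz.1))

/-- forward distortion bound -/
def Fw (f : ℝ → ℝ) (x y U V : ℕ → ℝ) (i n : ℕ) (θ C : ℝ) : Prop :=
  ∀ s ∈ Ioo (U i) (V i), ∀ t ∈ Ioo (U i) (V i),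
    s ∈ Icc (x i - θ * (y i - x i)) (y i + θ * (y i - x i)) →
    t ∈ Icc (x i - θ * (y i - x i)) (y i + θ * (y i - x i)) →
    |f^[n-i] s - f^[n-i] t| * (y i - x i) ≤ C * (y n - x n) * |s - t|

theorem nearJ {a b s τ : ℝ} (hab : a < b) (hτ : 0 ≤ τ) (hs : s ∈ Icc (a - τ) (b + τ)) :
    ∃ p ∈ Icc a b, |s - p| ≤ τ := by
  rcases lt_or_ge s a with h | h
  · exact ⟨a, ⟨le_rfl, hab.le⟩, abs_le.2 ⟨by linarith [hs.1], by linarith⟩⟩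
  rcases lt_or_ge b s with h' | h'
  · exact ⟨b, ⟨hab.le, le_rfl⟩, abs_le.2 ⟨by linarith, by linarith [hs.2]⟩⟩
  · exact ⟨s, ⟨h, h'⟩, by simpa using hτ⟩

theorem Fw.near (M : MM f K) (W : WSeq f K x y) (C : Chain f K x y n U V) {i j : ℕ} {θ θ' C1 : ℝ}
    (hij : i ≤ j) (hj : j ≤ n) (H : Fw f x y U V i j θ C1) (hθ : 0 ≤ θ') (hθ' : θ' ≤ θ)
    (hC : 0 ≤ C1) {s : ℝ}
    (hs : s ∈ Ioo (U i) (V i)) (hs' : s ∈ Icc (x i - θ' * (y i - x i)) (y i + θ' * (y i - x i))) :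
    f^[j-i] s ∈ Icc (x j - C1 * θ' * (y j - x j)) (y j + C1 * θ' * (y j - x j)) := by
  have hl := W.lt i
  have hlj := W.lt j
  have e0 : 0 ≤ θ' * (y i - x i) := mul_nonneg hθ (by linarith)
  have e1 : θ' * (y i - x i) ≤ θ * (y i - x i) := mul_le_mul_of_nonneg_right hθ' (by linarith)
  obtain ⟨p, hp, hsp⟩ := nearJ hl e0 hs'
  have hpT := C.J (hij.trans hj) hp
  have k := H s hs p hpT ⟨by linarith [hs'.1], by linarith [hs'.2]⟩ ⟨by linarith [hp.1], by linarith [hp.2]⟩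
  have k2 : |f^[j-i] s - f^[j-i] p| * (y i - x i) ≤ (C1 * θ' * (y j - x j)) * (y i - x i) := by
    refine k.trans ?_
    have := mul_le_mul_of_nonneg_left hsp (mul_nonneg hC (sub_nonneg.2 hlj.le))
    linarith
  have k3 := le_of_mul_le_mul_right k2 (by linarith)
  have m := M.wmaps_it W i (j-i) hp
  rw [show i + (j - i) = j by omega] at m
  have := abs_le.1 k3
  exact ⟨by linarith [m.1], by linarith [m.2]⟩

theorem Fw.comp (M : MM f K) (W : WSeq f K x y) (C : Chain f K x y n U V) {i j : ℕ} {θ1 C1 θ2 C2 : ℝ}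
    (hij : i ≤ j) (hj : j ≤ n) (H1 : Fw f x y U V i j θ1 C1) (H2 : Fw f x y U V j n θ2 C2)
    (hC1 : 1 ≤ C1) (hC2 : 1 ≤ C2) (h1 : 0 < θ1) (h2 : 0 < θ2) :
    Fw f x y U V i n (min θ1 (θ2 / C1)) (C1 * C2) := by
  intro s hs t ht hs' ht'
  have hC1' : 0 < C1 := by linarith
  set θ := min θ1 (θ2 / C1) with hθ
  have t0 : 0 < θ := lt_min h1 (by positivity)
  have t1 : θ ≤ θ1 := min_le_left _ _
  have t2 : C1 * θ ≤ θ2 := by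
    have : θ ≤ θ2 / C1 := min_le_right _ _
    rw [le_div_iff₀ hC1'] at this; linarith
  have hli := W.lt i
  have hlj := W.lt j
  have hln := W.lt n
  have ns := Fw.near M W C hij hj H1 t0.le t1 hC1'.le hs hs'
  have nt := Fw.near M W C hij hj H1 t0.le t1 hC1'.le ht ht'
  have g : C1 * θ * (y j - x j) ≤ θ2 * (y j - x j) := mul_le_mul_of_nonneg_right t2 (by linarith)
  have g1 : θ * (y i - x i) ≤ θ1 * (y i - x i) := mul_le_mul_of_nonneg_right t1 (by linarith)
  have mt := C.mt (i := i) (j - i) (by omega)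
  rw [show i + (j - i) = j by omega] at mt
  have k2 := H2 _ (mt hs) _ (mt ht) ⟨by linarith [ns.1], by linarith [ns.2]⟩ ⟨by linarith [nt.1], by linarith [nt.2]⟩
  have k1 := H1 s hs t ht ⟨by linarith [hs'.1], by linarith [hs'.2]⟩ ⟨by linarith [ht'.1], by linarith [ht'.2]⟩
  rw [← Function.iterate_add_apply, ← Function.iterate_add_apply, show n - j + (j - i) = n - i by omega] at k2
  have a1 := mul_le_mul_of_nonneg_right k2 (show 0 ≤ y i - x i by linarith)
  have a2 := mul_le_mul_of_nonneg_left k1 (show 0 ≤ C2 * (y n - x n) from mul_nonneg (by linarith) (by linarith))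
  refine le_of_mul_le_mul_right (a := y j - x j) ?_ (by linarith)
  nlinarith

theorem Fw.weak {i j : ℕ} {θ θ' C C' : ℝ} (W : WSeq f K x y) (H : Fw f x y U V i j θ C) (h : θ' ≤ θ) (h' : C ≤ C') :
    Fw f x y U V i j θ' C' := by
  intro s hs t ht hs' ht'
  have hli := W.lt i
  have hlj := W.lt j
  have g1 : θ' * (y i - x i) ≤ θ * (y i - x i) := mul_le_mul_of_nonneg_right h (by linarith)
  refine (H s hs t ht ⟨by linarith [hs'.1], by linarith [hs'.2]⟩ ⟨by linarith [ht'.1], by linarith [ht'.2]⟩).trans ?_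
  exact mul_le_mul_of_nonneg_right (mul_le_mul_of_nonneg_right h' (by linarith)) (abs_nonneg _)

/-- monotone runs -/
theorem MM.run (M : MM f K) (W : WSeq f K x y) (C : Chain f K x y n U V) (d : ℕ) : ∀ i, i + d ≤ n →
    (∀ k, i ≤ k → k < i + d → ∀ z ∈ K, z ∉ Ioo (U k) (V k)) →
    CRE (f^[d]) (U i) (V i) ∧ (StrictMonoOn (f^[d]) (Icc (U i) (V i)) ∨ StrictAntiOn (f^[d]) (Icc (U i) (V i))) ∧
    ((f^[d] (U i) = U (i+d) ∧ f^[d] (V i) = V (i+d)) ∨ (f^[d] (U i) = V (i+d) ∧ f^[d] (V i) = U (i+d))) := by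
  induction d with
  | zero =>
    intro i hi hn
    refine ⟨?_, Or.inl fun a _ b _ h => by simpa using h, Or.inl (by simp)⟩
    intro p a b q h1 h2 h3 h4 h5
    simp only [Function.iterate_zero, id]
    rw [abs_of_pos (by linarith : 0 < a - p), abs_of_pos (by linarith : 0 < q - b), abs_of_pos (by linarith : 0 < q - p),
      abs_of_pos (by linarith : 0 < b - a)]
  | succ d ih =>
    intro i hi hn
    obtain ⟨c1, c2, c3⟩ := ih (i+1) (by omega) (fun k h1 h2 => hn k (by omega) (by omega))
    rw [show i + 1 + d = i + (d + 1) by omega] at c3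
    have st := C.st i (by omega)
    obtain ⟨s1, s2, s3, s4, s5, s6⟩ := st
    have hn0 := hn i le_rfl (by omega)
    have np : NPs f K (U i) (V i) (U (i+1)) (V (i+1)) := by
      rcases s6 with h | ⟨z, hz, e, he, hS, q1, q2, q3, q4, q5⟩
      · exact h
      · exact absurd ⟨q2, q3⟩ (hn0 z hz)
    have cre := M.cre s1 s2 np.1
    have mono := M.lapmono s1 s2 np.1
    have bd := C.bd (i := i+1) (by omega)
    have bd0 := C.bd (i := i) (by omega)
    have l0 := W.lt i
    have l1 := W.lt (i+1)
    have hUV : U i < V i := by linarith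
    have hUV' : U (i+1) < V (i+1) := by linarith [bd.2.2.1, bd.2.2.2]
    have mU : U i ∈ Icc (U i) (V i) := left_mem_Icc.2 hUV.le
    have mV : V i ∈ Icc (U i) (V i) := right_mem_Icc.2 hUV.le
    have hmt : MapsTo f (Icc (U i) (V i)) (Icc (U (i+1)) (V (i+1))) := by
      intro t ht
      rcases mono with h | h
      · have a := h.monotoneOn mU ht ht.1
        have b := h.monotoneOn ht mV ht.2
        rcases np.2 with ⟨e1, e2⟩ | ⟨e1, e2⟩ <;> rw [e1] at a <;> rw [e2] at b
        · exact ⟨a, b⟩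
        · exact ⟨by linarith, by linarith⟩
      · have a := h.antitoneOn mU ht ht.1
        have b := h.antitoneOn ht mV ht.2
        rcases np.2 with ⟨e1, e2⟩ | ⟨e1, e2⟩ <;> rw [e1] at a <;> rw [e2] at b
        · exact ⟨by linarith, by linarith⟩
        · exact ⟨b, a⟩
    refine ⟨cre.comp c1 mono hmt, ?_, ?_⟩
    · rw [Function.iterate_succ]
      rcases mono with h | h <;> rcases c2 with h' | h'
      · exact Or.inl (h'.comp h hmt)
      · exact Or.inr (h'.comp_strictMonoOn h hmt)
      · exact Or.inr (h'.comp_strictAntiOn h hmt)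
      · exact Or.inl (h'.comp h hmt)
    · rw [Function.iterate_succ_apply, Function.iterate_succ_apply]
      rcases np.2 with ⟨e1, e2⟩ | ⟨e1, e2⟩ <;> rw [e1, e2]
      · exact c3
      · exact c3.symm.imp And.symm And.symm

theorem MM.run_fw (M : MM f K) (W : WSeq f K x y) (C : Chain f K x y n U V) {i j : ℕ} (hij : i ≤ j) (hj : j ≤ n)
    (hn : ∀ k, i ≤ k → k < j → ∀ z ∈ K, z ∉ Ioo (U k) (V k)) {B : ℝ} (hB : 0 ≤ B)
    (hs : Sp B (U j) (x j) (y j) (V j)) : Fw f x y U V i j (1 / (2 * (B + 1))) (8 * B + 4) := by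
  intro s hs1 t ht1 hs2 ht2
  obtain ⟨c1, c2, c3⟩ := M.run W C (j - i) i (by omega) (fun k a b => hn k a (by omega))
  have e1 := W.it_endp i (j - i)
  rw [show i + (j - i) = j by omega] at c3 e1
  have bd := C.bd (hij.trans hj)
  have bj := C.bd hj
  have li := W.lt i
  have lj := W.lt j
  have mU : U i ∈ Icc (U i) (V i) := ⟨by linarith, by linarith⟩
  have mV : V i ∈ Icc (U i) (V i) := ⟨by linarith, by linarith⟩
  have mx : x i ∈ Icc (U i) (V i) := ⟨by linarith, by linarith⟩
  have my : y i ∈ Icc (U i) (V i) := ⟨by linarith, by linarith⟩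
  have hL := hs.left bj.2.2.1 lj bj.2.2.2
  have hR := hs.right bj.2.2.1 lj bj.2.2.2
  have hJ : |f^[j-i] (y i) - f^[j-i] (x i)| = y j - x j := by
    rcases e1 with ⟨a, b⟩ | ⟨a, b⟩ <;> rw [a, b]
    · exact abs_of_pos (by linarith)
    · rw [abs_sub_comm]; exact abs_of_pos (by linarith)
  have two : |f^[j-i] (y i) - f^[j-i] (x i)| ≤ B * |f^[j-i] (V i) - f^[j-i] (y i)| ∧
      |f^[j-i] (y i) - f^[j-i] (x i)| ≤ B * |f^[j-i] (x i) - f^[j-i] (U i)| := by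
    rw [hJ]
    have ax : x j - U j ≤ |x j - U j| := le_abs_self _
    have ay : V j - y j ≤ |V j - y j| := le_abs_self _
    have hx : B * (x j - U j) ≤ B * |x j - U j| := mul_le_mul_of_nonneg_left ax hB
    have hy : B * (V j - y j) ≤ B * |V j - y j| := mul_le_mul_of_nonneg_left ay hB
    rcases c2 with h | h
    · have q1 := h mU mx bd.2.2.1
      have q2 := h mx my li
      have q3 := h my mV bd.2.2.2
      rcases c3 with ⟨p1, p2⟩ | ⟨p1, p2⟩ <;> rcases e1 with ⟨p3, p4⟩ | ⟨p3, p4⟩ <;>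
        rw [p1, p3] at q1 <;> rw [p3, p4] at q2 <;> rw [p4, p2] at q3 <;> rw [p1, p2, p3, p4] <;>
        first
        | (exfalso; linarith)
        | exact ⟨by linarith, by linarith⟩
    · have q1 := h mU mx bd.2.2.1
      have q2 := h mx my li
      have q3 := h my mV bd.2.2.2
      rcases c3 with ⟨p1, p2⟩ | ⟨p1, p2⟩ <;> rcases e1 with ⟨p3, p4⟩ | ⟨p3, p4⟩ <;>
        rw [p1, p3] at q1 <;> rw [p3, p4] at q2 <;> rw [p4, p2] at q3 <;> rw [p1, p2, p3, p4] <;>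
        first
        | (exfalso; linarith)
        | (rw [abs_sub_comm (U j), abs_sub_comm (y j)]; exact ⟨by linarith, by linarith⟩)
  have k := run_abs c1 c2 (Ioo_subset_Icc_self ht1) (Ioo_subset_Icc_self hs1) li bd.2.2.2 bd.2.2.1
    (by positivity : 0 ≤ 1 / (2 * (B + 1))) ht2 hs2 hB two.1 two.2 (by
      have : B + 1 ≠ 0 := by linarith
      field_simp; exact le_rfl)
  rwa [hJ] at k

theorem MM.step_fw (M : MM f K) (W : WSeq f K x y) : ∃ D, 1 ≤ D ∧ ∀ n U V, Chain f K x y n U V → ∀ i < n,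
    Fw f x y U V i (i+1) 1 D := by
  obtain ⟨D, hD, hd⟩ := M.dist2
  refine ⟨D, hD, fun n U V C i hi => ?_⟩
  intro s hs1 t ht1 hs2 ht2
  have li := W.lt i
  have k := hd (x i) (y i) (W.pos i).le li (W.lt1 i).le
    (fun z hz h => W.noK i z hz ⟨h.1.le, h.2.le⟩) s (C.sub hi.le hs1) t (C.sub hi.le ht1)
    (by linarith [hs2.1]) (by linarith [hs2.2]) (by linarith [ht2.1]) (by linarith [ht2.2])
  rw [W.abs_endp] at k
  simpa using k

theorem MM.fwd (M : MM f K) (W : WSeq f K x y) {B : ℝ} (hB : 0 ≤ B) (r : ℕ) :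
    ∃ θ D : ℝ, 0 < θ ∧ 1 ≤ D ∧ ∀ n U V, Chain f K x y n U V → ∀ i, i ≤ n →
      (∀ j, i ≤ j → j ≤ n → Sp B (U j) (x j) (y j) (V j)) → NRep K U V i n →
      (PS K U V n i).card ≤ r → Fw f x y U V i n θ D := by
  obtain ⟨D0, hD0, hst⟩ := M.step_fw W
  have hB1 : 1 ≤ 8 * B + 4 := by linarith
  have hB2 : 0 < 1 / (2 * (B + 1)) := by positivity
  induction r with
  | zero =>
    refine ⟨_, _, hB2, hB1, fun n U V C i hi hs N hc => ?_⟩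
    refine M.run_fw W C hi le_rfl (fun k h1 h2 z hz hzk => ?_) hB (hs n hi le_rfl)
    have : z ∈ PS K U V n i := by
      simp only [PS, Finset.mem_filter]; exact ⟨hz, k, h1, h2, hzk⟩
    rw [Finset.card_eq_zero.1 (Nat.le_zero.1 hc)] at this
    simp at this
  | succ r ih =>
    obtain ⟨θ, D, hθ, hD, H⟩ := ih
    set θ1 := min 1 (θ / D0) with hθ1
    have hθ1' : 0 < θ1 := lt_min one_pos (by positivity)
    have hDD : 1 ≤ D0 * D := one_le_mul_of_one_le_of_one_le hD0 hD
    refine ⟨min (1 / (2 * (B + 1))) (θ1 / (8 * B + 4)), (8 * B + 4) * (D0 * D),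
      lt_min hB2 (by positivity), one_le_mul_of_one_le_of_one_le hB1 hDD,
      fun n U V C i hi hs N hc => ?_⟩
    by_cases hp : ∃ j, i ≤ j ∧ j < n ∧ ∃ z ∈ K, z ∈ Ioo (U j) (V j)
    · classical
      let j := Nat.find hp
      obtain ⟨j1, j2, z, hz, hzj⟩ : i ≤ j ∧ j < n ∧ ∃ z ∈ K, z ∈ Ioo (U j) (V j) := Nat.find_spec hp
      have hmin : ∀ k, i ≤ k → k < j → ∀ z ∈ K, z ∉ Ioo (U k) (V k) := by
        intro k h1 h2 z hz hzk
        exact Nat.find_min hp h2 ⟨h1, by omega, z, hz, hzk⟩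
      have F1 := M.run_fw W C j1 j2.le hmin hB (hs j j1 j2.le)
      have F2 := hst n U V C j j2
      have F3 := H n U V C (j+1) (by omega) (fun k h1 h2 => hs k (by omega) h2)
        (fun a b h1 => N a b (by omega)) (by
          have a1 := PS_lt N j1 j2 hz hzj
          have a2 := Finset.card_le_card (PS_anti (K := K) (U := U) (V := V) (n := n) j1)
          omega)
      have F4 := Fw.comp M W C (Nat.le_succ j) (by omega) F2 F3 hD0 hD one_pos hθ
      exact Fw.comp M W C j1 j2.le F1 F4 hB1 hDD hB2 hθ1'
    · push Not at hp
      refine (M.run_fw W C hi le_rfl (fun k h1 h2 z hz hzk => hp k h1 h2 z hz hzk) hB (hs n hi le_rfl)).weak W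
        (min_le_left _ _) ?_
      nlinarith

end
end WI

namespace WI
section
variable {f : ℝ → ℝ} {K : Finset ℝ} {x y : ℕ → ℝ}
open Filter Topology

theorem MM.final (M : MM f K) (W : WSeq f K x y) {β : ℝ}
    (H : ∀ δ > 0, ∃ u v k, 0 ≤ u ∧ v ≤ 1 ∧ u < x 0 ∧ y 0 < v ∧ Sp β u (x 0) (y 0) v ∧ Sm f (Ioo u v) k δ) :
    False := by
  have l0 := W.lt 0
  set B := max β 1 with hB
  have hB1 : 1 ≤ B := le_max_right _ _
  set τ := (y 0 - x 0) / (2 * B) with hτ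
  have τ0 : 0 < τ := div_pos (by linarith) (by linarith)
  have hτB : y 0 - x 0 = τ * (2 * B) := by rw [hτ]; field_simp
  have key : ∀ u v, u < x 0 → y 0 < v → Sp β u (x 0) (y 0) v → u < x 0 - τ ∧ y 0 + τ < v := by
    intro u v h1 h2 hs
    have hs' := hs.mono (le_max_left β 1) h1 h2
    have a := hs'.left h1 l0 h2
    have b := hs'.right h1 l0 h2
    rw [← hB, hτB] at a b
    constructor <;> nlinarith
  obtain ⟨u, v, k, h1, h2, h3, h4, h5, h6⟩ := H 1 one_pos
  obtain ⟨a1, a2⟩ := key u v h3 h4 h5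
  obtain ⟨ρ, hρ, hk⟩ := M.wmax W (i := 0) (a := x 0 - τ) (b := y 0 + τ) (by linarith) (by linarith) (by linarith)
    (by linarith) (Or.inl (by linarith))
  obtain ⟨u, v, k, h1, h2, h3, h4, h5, h6⟩ := H ρ hρ
  obtain ⟨a1, a2⟩ := key u v h3 h4 h5
  exact hk k (h6.mono (fun t ht => ⟨by linarith [ht.1], by linarith [ht.2]⟩))

theorem Chain.sm {n : ℕ} {U V : ℕ → ℝ} (C : Chain f K x y n U V) {i k : ℕ} {δ : ℝ} (hi : i ≤ n)
    (h : Sm f (Ioo (U n) (V n)) k δ) : Sm f (Ioo (U i) (V i)) (k + (n - i)) δ := by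
  intro a ha b hb
  have mt := C.mt (i := i) (n - i) (by omega)
  rw [show i + (n - i) = n by omega] at mt
  rw [Function.iterate_add_apply, Function.iterate_add_apply]
  exact h _ (mt ha) _ (mt hb)

theorem MM.fin_chain (M : MM f K) (W : WSeq f K x y) {Ψ : ℝ → ℝ} (P : PE f K Ψ) {c : ℝ}
    (hc : ∀ Y m, Trap f x y Y m → Cross f Y c) {n : ℕ} {U V : ℕ → ℝ} (C : Chain f K x y n U V)
    (F : Fresh x y n (Ioo (U n) (V n))) (hno : ∀ i < n, c ∉ Ioo (U i) (V i)) {β δ : ℝ} (hβ : 0 ≤ β)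
    (hs : Sp β (U n) (x n) (y n) (V n)) {k : ℕ} (hk : Sm f (Ioo (U n) (V n)) k δ) :
    ∃ u v k, 0 ≤ u ∧ v ≤ 1 ∧ u < x 0 ∧ y 0 < v ∧ Sp (Ψ^[K.card] β) u (x 0) (y 0) v ∧ Sm f (Ioo u v) k δ := by
  have bd := C.bd (Nat.zero_le n)
  refine ⟨U 0, V 0, k + (n - 0), bd.1, bd.2.1, bd.2.2.1, bd.2.2.2, ?_, C.sm (Nat.zero_le n) hk⟩
  refine M.spchain W P C (s0 := 0) ?_ hβ hs le_rfl (Nat.zero_le n)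
  intro i j _ hij hj z hz h1 h2
  exact M.norepeat W hc C F (s0 := 0) (fun i _ h => hno i h) (Nat.zero_le i) hij hj hz h1 h2

open MeasureTheory in
theorem WSeq.len (W : WSeq f K x y) {ε : ℝ} (hε : 0 < ε) : ∃ N, ∀ n ≥ N, y n - x n < ε := by
  have h1 : ∑' i, volume (Icc (x i) (y i)) ≠ ⊤ := by
    rw [← measure_iUnion (fun i j h => W.disj i j h) (fun i => measurableSet_Icc)]
    have : volume (⋃ i, Icc (x i) (y i)) ≤ volume (Icc (0:ℝ) 1) :=
      measure_mono (iUnion_subset fun i => W.sub i)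
    refine (this.trans_lt ?_).ne
    simp
  have h2 := ENNReal.tendsto_atTop_zero_of_tsum_ne_top h1
  have h3 := (ENNReal.tendsto_nhds_zero.1 h2) (ENNReal.ofReal (ε / 2)) (by simp; linarith)
  obtain ⟨N, hN⟩ := eventually_atTop.1 h3
  refine ⟨N, fun n hn => ?_⟩
  have := hN n hn
  rw [Real.volume_Icc, ENNReal.ofReal_le_ofReal_iff (by linarith)] at this
  linarith

theorem MM.near0 (M : MM f K) : ∃ η > 0, ∀ t, 0 < t → t < η → t < f t := by
  have hp := M.rep 0 (by simp) 1 le_rfl (by simp [M.f0])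
  rw [Function.iterate_one] at hp
  have hs := hasDerivAt_iff_tendsto_slope.1 (M.hd 0)
  have hs2 := hs.mono_left (nhdsWithin_mono (0:ℝ) (show Ioi (0:ℝ) ⊆ {0}ᶜ from fun t ht => by simpa using (ne_of_gt ht)))
  have h0 : 0 ≤ deriv f 0 := by
    refine ge_of_tendsto hs2 ?_
    filter_upwards [Ioo_mem_nhdsGT (show (0:ℝ) < 1 by norm_num)] with t ht
    rw [slope_def_field, M.f0]
    have := (M.maps ⟨ht.1.le, ht.2.le⟩).1
    exact div_nonneg (by linarith) (by linarith [ht.1])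
  rw [abs_of_nonneg h0] at hp
  obtain ⟨η, hη, h⟩ := (mem_nhdsGT_iff_exists_Ioo_subset).1 (hs2.eventually (lt_mem_nhds hp))
  refine ⟨η, hη, fun t h1 h2 => ?_⟩
  have := h ⟨h1, h2⟩
  simp only [mem_ofPred, slope_def_field, M.f0, sub_zero] at this
  rw [lt_div_iff₀ h1] at this
  linarith

theorem MM.near1 (M : MM f K) (h1 : f 1 = 1) : ∃ η > 0, ∀ t, t < 1 → 1 - η < t → f t < t := by
  have hp := M.rep 1 (by simp) 1 le_rfl (by simp [h1])
  rw [Function.iterate_one] at hp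
  have hs := hasDerivAt_iff_tendsto_slope.1 (M.hd 1)
  have hs2 := hs.mono_left (nhdsWithin_mono (1:ℝ) (show Iio (1:ℝ) ⊆ {1}ᶜ from fun t ht => by simpa using (ne_of_lt ht)))
  have h0 : 0 ≤ deriv f 1 := by
    refine ge_of_tendsto hs2 ?_
    filter_upwards [Ioo_mem_nhdsLT (show (0:ℝ) < 1 by norm_num)] with t ht
    rw [slope_def_field, h1]
    have := (M.maps ⟨ht.1.le, ht.2.le⟩).2
    exact div_nonneg_of_nonpos (by linarith) (by linarith [ht.2])
  rw [abs_of_nonneg h0] at hp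
  obtain ⟨η, hη, h⟩ := (mem_nhdsLT_iff_exists_Ioo_subset).1 (hs2.eventually (lt_mem_nhds hp))
  have hη' : η < 1 := hη
  refine ⟨1 - η, by linarith, fun t h2 h3 => ?_⟩
  have := h ⟨by linarith, h2⟩
  simp only [mem_ofPred, slope_def_field, h1] at this
  rw [lt_div_iff_of_neg (by linarith)] at this
  linarith

theorem MM.edge (M : MM f K) (W : WSeq f K x y) : ∃ C ≥ (1:ℝ), ∃ N, ∀ n ≥ N, y n - x n ≤ C * x n ∧
    y n - x n ≤ C * (1 - y n) := by
  obtain ⟨L, hL1, -, hL⟩ := M.lip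
  have nj : ∀ n, ∀ t ∈ Icc (x n) (y n), f t ∉ Icc (x n) (y n) := by
    intro n t ht h
    exact (W.disj (n+1) n (by omega)).le_bot ⟨M.wmaps W n ht, h⟩
  have left : ∃ N, ∀ n ≥ N, y n - x n ≤ L * x n := by
    obtain ⟨η, hη, h⟩ := M.near0
    obtain ⟨N, hN⟩ := W.len (half_pos hη)
    refine ⟨N, fun n hn => ?_⟩
    have l := hN n hn
    have p := W.pos n
    have lt := W.lt n
    rcases le_or_gt (η / 2) (x n) with h' | h'
    · nlinarith
    · have a := h (x n) p (by linarith)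
      have b := nj n (x n) (left_mem_Icc.2 lt.le)
      have b' : y n < f (x n) := by
        by_contra hh; push Not at hh; exact b ⟨a.le, hh⟩
      have e := hL (x n) ⟨p.le, by linarith [W.lt1 n]⟩ 0 (by simp)
      rw [M.f0, sub_zero, sub_zero, abs_of_pos p] at e
      linarith [le_abs_self (f (x n))]
  obtain ⟨N, hN⟩ := left
  have right : ∃ C' ≥ (1:ℝ), ∃ N', ∀ n ≥ N', y n - x n ≤ C' * (1 - y n) := by
    rcases M.f1 with h1 | h1
    · obtain ⟨C, hC, hd⟩ := M.dist
      have r := M.reg 1 (by simp) (fun h => by have := (M.sub 1 h).2; linarith)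
      have r0 : 0 < |deriv f 1| := abs_pos.2 r
      refine ⟨max 1 (C * L * L / |deriv f 1|), le_max_left _ _, N, fun n hn => ?_⟩
      have lt := W.lt n
      have l1 := W.lt1 n
      have pos := W.pos n
      rcases le_or_gt (y n - x n) (1 - y n) with h | h
      · have := mul_le_mul_of_nonneg_right (le_max_left 1 (C * L * L / |deriv f 1|)) (show 0 ≤ 1 - y n by linarith)
        linarith
      · have k := hd (x n) (y n) pos.le lt l1.le (fun z hz hh => W.noK n z hz ⟨hh.1.le, hh.2.le⟩) 1 (by simp)
          (by linarith) (by linarith)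
        rw [W.abs_endp] at k
        have k2 := hN (n+1) (by omega)
        have k3 : x (n+1) ≤ f (y n) := (M.wmaps W n (right_mem_Icc.2 lt.le)).1
        have k4 := hL (y n) ⟨by linarith, l1.le⟩ 1 (by simp)
        rw [h1, sub_zero, abs_sub_comm, abs_of_pos (by linarith : 0 < 1 - y n)] at k4
        have k5 : x (n+1) ≤ L * (1 - y n) := by linarith [le_abs_self (f (y n))]
        have k6 : |deriv f 1| * (y n - x n) ≤ C * (L * (L * (1 - y n))) :=
          k.trans (mul_le_mul_of_nonneg_left (k2.trans (mul_le_mul_of_nonneg_left k5 (by linarith))) (by linarith))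
        have k7 : y n - x n ≤ (C * L * L / |deriv f 1|) * (1 - y n) := by
          rw [div_mul_eq_mul_div, le_div_iff₀ r0]; linarith
        exact enl k7 (le_max_right _ _) (by linarith)
    · obtain ⟨η, hη, h⟩ := M.near1 h1
      obtain ⟨N', hN'⟩ := W.len (half_pos hη)
      refine ⟨L, hL1, N', fun n hn => ?_⟩
      have l := hN' n hn
      have p := W.lt1 n
      have lt := W.lt n
      rcases le_or_gt (η / 2) (1 - y n) with h' | h'
      · nlinarith
      · have a := h (y n) p (by linarith)
        have b := nj n (y n) (right_mem_Icc.2 lt.le)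
        have b' : f (y n) < x n := by
          by_contra hh; push Not at hh; exact b ⟨hh, a.le⟩
        have e := hL (y n) ⟨by linarith [W.pos n], p.le⟩ 1 (by simp)
        rw [h1, abs_sub_comm, abs_sub_comm (y n), abs_of_pos (by linarith : 0 < 1 - y n)] at e
        linarith [le_abs_self (1 - f (y n))]
  obtain ⟨C', hC', N', hN'⟩ := right
  refine ⟨max L C', hL1.trans (le_max_left _ _), max N N', fun n hn => ⟨?_, ?_⟩⟩
  · exact enl (hN n (le_trans (le_max_left _ _) hn)) (le_max_left _ _) (W.pos n).le
  · exact enl (hN' n (le_trans (le_max_right _ _) hn)) (le_max_right _ _) (by linarith [W.lt1 n])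

theorem exists_record {g : ℕ → ℝ} (hg : ∀ n, 0 < g n) (hlim : ∀ ε > 0, ∃ N, ∀ n ≥ N, g n < ε) (N : ℕ)
    {δ : ℝ} (hδ : 0 < δ) : ∃ n ≥ N, g n < δ ∧ ∀ m < n, g n < g m := by
  have : ∀ N : ℕ, ∃ μ > 0, ∀ m < N, μ ≤ g m := by
    intro N
    induction N with
    | zero => exact ⟨1, one_pos, by simp⟩
    | succ N ih =>
      obtain ⟨μ, h1, h2⟩ := ih
      refine ⟨min μ (g N), lt_min h1 (hg N), fun m hm => ?_⟩
      rcases Nat.lt_succ_iff_lt_or_eq.1 hm with h | rfl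
      · exact (min_le_left _ _).trans (h2 m h)
      · exact min_le_right _ _
  obtain ⟨μ, h1, h2⟩ := this N
  classical
  have hex : ∃ n, g n < min δ μ := by
    obtain ⟨N', h⟩ := hlim (min δ μ) (lt_min hδ h1)
    exact ⟨N', h N' le_rfl⟩
  have hsp := Nat.find_spec hex
  refine ⟨Nat.find hex, ?_, hsp.trans_le (min_le_left _ _), fun m hm => ?_⟩
  · by_contra hcon
    push Not at hcon
    have := h2 _ hcon
    linarith [hsp.trans_le (min_le_right δ μ)]
  · have := Nat.find_min hex hm
    push Not at this
    exact hsp.trans_le this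

def Quiet (f : ℝ → ℝ) (K : Finset ℝ) (x y : ℕ → ℝ) (c : ℝ) : Prop :=
  ∃ ρ > 0, ∀ a e, Icc (x a) (y a) ⊆ S f K c e → ∀ k, ¬ Sm f (S f K c e) k ρ

theorem Sm.lt {S : Set ℝ} {k : ℕ} {e e' : ℝ} (h : Sm f S k e) (he : e ≤ e') : Sm f S k e' :=
  fun a ha b hb => (h a ha b hb).trans_le he

theorem MM.quiet_case (M : MM f K) (W : WSeq f K x y) {c : ℝ} (hcK : c ∈ K)
    (hc : ∀ Y m, Trap f x y Y m → Cross f Y c) (hq : Quiet f K x y c) : False := by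
  obtain ⟨ρ1, hρ1, hq⟩ := hq
  obtain ⟨ρ2, hρ2, hlap⟩ := M.lapconst W
  obtain ⟨Ψ, P⟩ := M.passest
  have P : PE f K Ψ := P
  obtain ⟨C, hC, N, hN⟩ := M.edge W
  refine M.final W (β := Ψ^[K.card] (2 * C + C ^ 2)) fun δ hδ => ?_
  set δ' := min δ (min ρ1 ρ2) with hδ'
  have d0 : 0 < δ' := lt_min hδ (lt_min hρ1 hρ2)
  obtain ⟨n, hn, hsmall, hrec⟩ := exists_record (g := fun i => y i - x i) (fun i => by linarith [W.lt i])
    (fun ε hε => W.len hε) N (δ := δ' / 3) (by linarith)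
  obtain ⟨e1, e2⟩ := hN n hn
  have lt := W.lt n
  have C0 : 0 < C := by linarith
  set d := (y n - x n) / C with hd
  have hdC : C * d = y n - x n := by rw [hd]; field_simp
  have hd0 : 0 < d := div_pos (by linarith) C0
  have hd1 : d ≤ y n - x n := by nlinarith
  have hdx : d ≤ x n := by rw [← hdC] at e1; exact le_of_mul_le_mul_left e1 C0
  have hdy : d ≤ 1 - y n := by rw [← hdC] at e2; exact le_of_mul_le_mul_left e2 C0
  have sm : Sm f (Ioo (x n - d) (y n + d)) 0 δ' := by
    intro a ha b hb
    simp only [Function.iterate_zero, id]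
    rw [abs_lt]
    constructor <;> linarith [ha.1, ha.2, hb.1, hb.2]
  obtain ⟨U, V, Ch, hU, hV⟩ := M.exists_chain W hlap n (k := 0) (U' := x n - d) (V' := y n + d) (by linarith)
    (by linarith) (by linarith) (by linarith) (sm.lt ((min_le_right _ _).trans (min_le_right _ _)))
  have F : Fresh x y n (Ioo (U n) (V n)) := by
    intro m hm hsub
    rw [hU, hV] at hsub
    have lm := W.lt m
    have a1 := hsub (left_mem_Icc.2 lm.le)
    have a2 := hsub (right_mem_Icc.2 lm.le)
    have r := hrec m hm
    have dj := W.disj n m (by omega)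
    rw [Set.disjoint_left] at dj
    rcases lt_or_ge (y m) (x n) with h | h
    · linarith [a1.1]
    rcases lt_or_ge (y n) (x m) with h' | h'
    · linarith [a2.2]
    rcases le_or_gt (x m) (x n) with h'' | h''
    · exact dj (left_mem_Icc.2 lt.le) ⟨h'', h⟩
    · exact dj ⟨h''.le, h'⟩ (left_mem_Icc.2 lm.le)
  rw [← hU, ← hV] at sm
  have := M.fin_chain W P hc Ch F (fun i hi hci => ?_) (β := 2 * C + C ^ 2) (by positivity) ?_ (sm.lt (min_le_left δ _))
  · exact this
  · obtain ⟨e, he, hS⟩ := Ch.isS M hi hcK hci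
    have J := Ch.J hi.le
    rw [hS] at J
    refine hq i e J (0 + (n - i)) ?_
    rw [← hS]
    exact (Ch.sm hi.le sm).lt ((min_le_right _ _).trans (min_le_left _ _))
  · rw [hU, hV]
    exact Sp.of C0.le (by linarith) lt (by linarith) (by linarith) (by linarith)

end
end WI

namespace WI
section
variable {f : ℝ → ℝ} {K : Finset ℝ} {x y : ℕ → ℝ}
open Filter Topology

def lv (f : ℝ → ℝ) (c t : ℝ) : ℝ := |f t - f c|
def lamU (f : ℝ → ℝ) (c : ℝ) (x y : ℕ → ℝ) (i : ℕ) : ℝ := max (lv f c (x i)) (lv f c (y i))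
def lamL (f : ℝ → ℝ) (c : ℝ) (x y : ℕ → ℝ) (i : ℕ) : ℝ := min (lv f c (x i)) (lv f c (y i))
def Nb (K : Finset ℝ) (c : ℝ) (x y : ℕ → ℝ) (i : ℕ) : Prop := lo K c < x i ∧ y i < hi K c

theorem MM.lvl (M : MM f K) (W : WSeq f K x y) {c : ℝ} (hcK : c ∈ K) {i : ℕ} (h : Nb K c x y i) :
    0 < lamL f c x y i ∧ lamL f c x y i < lamU f c x y i ∧
    lamU f c x y i - lamL f c x y i = y (i+1) - x (i+1) ∧
    ((c < x i ∧ lv f c (y i) = lamU f c x y i ∧ lv f c (x i) = lamL f c x y i) ∨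
     (y i < c ∧ lv f c (x i) = lamU f c x y i ∧ lv f c (y i) = lamL f c x y i)) ∧
    ∀ t ∈ Icc (x i) (y i), lamL f c x y i ≤ lv f c t ∧ lv f c t ≤ lamU f c x y i := by
  obtain ⟨h1, h2, h3, h4, -, -⟩ := M.near hcK
  obtain ⟨l1, l2, l3⟩ := M.lev hcK
  have lt := W.lt i
  have hl := h.1
  have hr := h.2
  have lc : lv f c c = 0 := by simp [lv]
  have dif : |lv f c (y i) - lv f c (x i)| = y (i+1) - x (i+1) := by
    rw [← W.abs_endp i]
    unfold lv
    rcases l3 with l | l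
    · rw [l (y i) ⟨by linarith, by linarith⟩, l (x i) ⟨by linarith, by linarith⟩]; congr 1; ring
    · rw [l (y i) ⟨by linarith, by linarith⟩, l (x i) ⟨by linarith, by linarith⟩, abs_sub_comm]; congr 1; ring
  have side : c < x i ∨ y i < c := by
    by_contra hcon
    push Not at hcon
    exact W.noK i c hcK ⟨hcon.1, hcon.2⟩
  rcases side with s | s
  · have e1 : lv f c c < lv f c (x i) := l2 ⟨le_rfl, by linarith⟩ ⟨s.le, by linarith⟩ s
    have e2 : lv f c (x i) < lv f c (y i) := l2 ⟨s.le, by linarith⟩ ⟨by linarith, by linarith⟩ lt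
    have eU : lamU f c x y i = lv f c (y i) := max_eq_right e2.le
    have eL : lamL f c x y i = lv f c (x i) := min_eq_left e2.le
    rw [abs_of_pos (by linarith)] at dif
    rw [eU, eL]
    refine ⟨by linarith, e2, dif, Or.inl ⟨s, rfl, rfl⟩, fun t ht => ⟨?_, ?_⟩⟩
    · exact l2.monotoneOn ⟨s.le, by linarith⟩ ⟨by linarith [ht.1], by linarith [ht.2]⟩ ht.1
    · exact l2.monotoneOn ⟨by linarith [ht.1], by linarith [ht.2]⟩ ⟨by linarith, by linarith⟩ ht.2
  · have e1 : lv f c c < lv f c (y i) := l1 ⟨by linarith, by linarith⟩ ⟨by linarith, le_rfl⟩ s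
    have e2 : lv f c (y i) < lv f c (x i) := l1 ⟨by linarith, by linarith⟩ ⟨by linarith, by linarith⟩ lt
    have eU : lamU f c x y i = lv f c (x i) := max_eq_left e2.le
    have eL : lamL f c x y i = lv f c (y i) := min_eq_right e2.le
    rw [abs_of_neg (by linarith)] at dif
    rw [eU, eL]
    refine ⟨by linarith, e2, by linarith, Or.inr ⟨s, rfl, rfl⟩, fun t ht => ⟨?_, ?_⟩⟩
    · exact l1.antitoneOn ⟨by linarith [ht.1], by linarith [ht.2]⟩ ⟨by linarith, by linarith⟩ ht.2
    · exact l1.antitoneOn ⟨by linarith, by linarith⟩ ⟨by linarith [ht.1], by linarith [ht.2]⟩ ht.1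

theorem MM.lvl_img (M : MM f K) (W : WSeq f K x y) {c : ℝ} (hcK : c ∈ K) :
    ((∀ i, Nb K c x y i → x (i+1) = f c + lamL f c x y i ∧ y (i+1) = f c + lamU f c x y i) ∧
      ∀ t ∈ Icc (lo K c) (hi K c), f t = f c + lv f c t) ∨
    ((∀ i, Nb K c x y i → x (i+1) = f c - lamU f c x y i ∧ y (i+1) = f c - lamL f c x y i) ∧
      ∀ t ∈ Icc (lo K c) (hi K c), f t = f c - lv f c t) := by
  obtain ⟨l1, l2, l3⟩ := M.lev hcK
  rcases l3 with l | l
  · left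
    have l' : ∀ t ∈ Icc (lo K c) (hi K c), f t = f c + lv f c t := fun t ht => by
      have := l t ht; unfold lv; linarith
    refine ⟨fun i h => ?_, l'⟩
    obtain ⟨a1, a2, a3, a4, -⟩ := M.lvl W hcK h
    have lt := W.lt i
    have lt' := W.lt (i+1)
    have ex := l' (x i) ⟨h.1.le, by linarith [h.2]⟩
    have ey := l' (y i) ⟨by linarith [h.1], h.2.le⟩
    rcases a4 with ⟨-, b1, b2⟩ | ⟨-, b1, b2⟩ <;> rcases W.endp i with ⟨e1, e2⟩ | ⟨e1, e2⟩ <;>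
      rw [← b1, ← b2] <;> constructor <;> linarith
  · right
    have l' : ∀ t ∈ Icc (lo K c) (hi K c), f t = f c - lv f c t := fun t ht => by
      have := l t ht; unfold lv; linarith
    refine ⟨fun i h => ?_, l'⟩
    obtain ⟨a1, a2, a3, a4, -⟩ := M.lvl W hcK h
    have lt := W.lt i
    have lt' := W.lt (i+1)
    have ex := l' (x i) ⟨h.1.le, by linarith [h.2]⟩
    have ey := l' (y i) ⟨by linarith [h.1], h.2.le⟩
    rcases a4 with ⟨-, b1, b2⟩ | ⟨-, b1, b2⟩ <;> rcases W.endp i with ⟨e1, e2⟩ | ⟨e1, e2⟩ <;>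
      rw [← b1, ← b2] <;> constructor <;> linarith

theorem MM.lvl_sep (M : MM f K) (W : WSeq f K x y) {c : ℝ} (hcK : c ∈ K) {i j : ℕ} (h : Nb K c x y i)
    (h' : Nb K c x y j) (hl : lamU f c x y i < lamU f c x y j) : lamU f c x y i < lamL f c x y j := by
  by_contra hcon
  push Not at hcon
  have hij : i ≠ j := by rintro rfl; exact lt_irrefl _ hl
  have d := Set.disjoint_left.1 (W.disj (i+1) (j+1) (by omega))
  obtain ⟨a1, a2, -⟩ := M.lvl W hcK h
  obtain ⟨b1, b2, -⟩ := M.lvl W hcK h'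
  rcases M.lvl_img W hcK with ⟨H, -⟩ | ⟨H, -⟩
  · obtain ⟨p, q⟩ := H i h
    obtain ⟨p', q'⟩ := H j h'
    exact d (right_mem_Icc.2 (W.lt (i+1)).le) ⟨by linarith, by linarith⟩
  · obtain ⟨p, q⟩ := H i h
    obtain ⟨p', q'⟩ := H j h'
    exact d (left_mem_Icc.2 (W.lt (i+1)).le) ⟨by linarith, by linarith⟩

theorem MM.lvl_S (M : MM f K) (W : WSeq f K x y) {c : ℝ} (hcK : c ∈ K) {i : ℕ} {e : ℝ} :
    Icc (x i) (y i) ⊆ S f K c e ↔ Nb K c x y i ∧ lamU f c x y i < e := by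
  have lt := W.lt i
  constructor
  · intro h
    have a := h (left_mem_Icc.2 lt.le)
    have b := h (right_mem_Icc.2 lt.le)
    exact ⟨⟨a.1, b.2.1⟩, max_lt a.2.2 b.2.2⟩
  · rintro ⟨h, h'⟩ t ht
    exact ⟨by linarith [h.1, ht.1], by linarith [h.2, ht.2], ((M.lvl W hcK h).2.2.2.2 t ht).2.trans_lt h'⟩

theorem MM.deeper (M : MM f K) (W : WSeq f K x y) {c : ℝ} (hcK : c ∈ K) (hq : ¬ Quiet f K x y c) {i : ℕ}
    (h : Nb K c x y i) : ∃ a, Nb K c x y a ∧ lamU f c x y a < lamU f c x y i := by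
  obtain ⟨h1, h2, h3, h4, -, -⟩ := M.near hcK
  obtain ⟨l1, l2, l3⟩ := M.lev hcK
  have lt := W.lt i
  have hl := h.1
  have hr := h.2
  unfold Quiet at hq
  push Not at hq
  have main : ∀ p q, 0 ≤ p → q ≤ 1 → p ≤ x i → y i ≤ q → (p < x i ∨ y i < q) →
      (∀ t ∈ Icc p q, lo K c < t ∧ t < hi K c ∧ |f t - f c| ≤ lamU f c x y i) →
      ∃ a, Nb K c x y a ∧ lamU f c x y a < lamU f c x y i := by
    intro p q p0 q1 hp hq' hne hsub
    obtain ⟨ρ, hρ, hk⟩ := M.wmax W p0 q1 hp hq' hne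
    obtain ⟨a, e, hJ, k, hsm⟩ := hq ρ hρ
    obtain ⟨n1, n2⟩ := (M.lvl_S W hcK).1 hJ
    refine ⟨a, n1, ?_⟩
    rcases le_or_gt e (lamU f c x y i) with h' | h'
    · linarith
    · exact absurd (hsm.mono fun t ht => ⟨(hsub t ht).1, (hsub t ht).2.1, (hsub t ht).2.2.trans_lt h'⟩) (hk k)
  obtain ⟨-, -, -, a4, -⟩ := M.lvl W hcK h
  rcases a4 with ⟨s, b1, b2⟩ | ⟨s, b1, b2⟩
  · refine main c (y i) (by linarith) (by linarith) s.le le_rfl (Or.inl s) fun t ht => ⟨by linarith [ht.1],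
      by linarith [ht.2], ?_⟩
    rw [← b1]
    exact l2.monotoneOn ⟨ht.1, by linarith [ht.2]⟩ ⟨by linarith, by linarith⟩ ht.2
  · refine main (x i) c (by linarith) (by linarith) le_rfl s.le (Or.inr s) fun t ht => ⟨by linarith [ht.1],
      by linarith [ht.2], ?_⟩
    rw [← b1]
    exact l1.antitoneOn ⟨by linarith, by linarith⟩ ⟨by linarith [ht.1], by linarith [ht.2]⟩ ht.1

theorem MM.select (M : MM f K) (W : WSeq f K x y) {c : ℝ} (hcK : c ∈ K) (hq : ¬ Quiet f K x y c) {δ : ℝ}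
    (hδ : 0 < δ) : ∃ q n k, Nb K c x y q ∧ Nb K c x y n ∧ lamU f c x y n < lamU f c x y q ∧
      (∀ m < n, Nb K c x y m → lamU f c x y q ≤ lamU f c x y m) ∧
      y (n+1) - x (n+1) ≤ y (q+1) - x (q+1) ∧ Sm f (S f K c (lamU f c x y q)) k δ := by
  classical
  have hq' := hq
  unfold Quiet at hq'
  push Not at hq'
  obtain ⟨a, e, hJ, k, hsm⟩ := hq' δ hδ
  have hex : ∃ q, Nb K c x y q ∧ lamU f c x y q < e := ⟨a, (M.lvl_S W hcK).1 hJ⟩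
  let A : Set ℕ := {q | Nb K c x y q ∧ lamU f c x y q < e ∧ ∀ m < q, Nb K c x y m → lamU f c x y q < lamU f c x y m}
  have hq0 : Nat.find hex ∈ A := by
    obtain ⟨h1, h2⟩ := Nat.find_spec hex
    refine ⟨h1, h2, fun m hm hN => ?_⟩
    have := Nat.find_min hex hm
    push Not at this
    exact h2.trans_le (this hN)
  set q0 := Nat.find hex
  have hpos : 0 < y (q0+1) - x (q0+1) := by linarith [W.lt (q0+1)]
  obtain ⟨N, hN⟩ := W.len hpos
  let B : Set ℕ := {q | q ∈ A ∧ y (q0+1) - x (q0+1) ≤ y (q+1) - x (q+1)}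
  have hB : BddAbove B := ⟨N, fun q hq => by
    by_contra hcon
    push Not at hcon
    have := hN (q+1) (by omega)
    linarith [hq.2]⟩
  have hm : sSup B ∈ B := Nat.sSup_mem ⟨q0, hq0, le_rfl⟩ hB
  set q := sSup B
  obtain ⟨⟨q1, q2, q3⟩, q4⟩ := hm
  have hex2 := M.deeper W hcK hq q1
  obtain ⟨n1, n2⟩ := Nat.find_spec hex2
  have nmin : ∀ m < Nat.find hex2, Nb K c x y m → lamU f c x y q ≤ lamU f c x y m := by
    intro m hm hN
    have := Nat.find_min hex2 hm
    push Not at this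
    exact this hN
  set n := Nat.find hex2
  refine ⟨q, n, k, q1, n1, n2, nmin, ?_, hsm.mono (S_mono q2.le)⟩
  have hnA : n ∈ A := ⟨n1, n2.trans q2, fun m hm hN => n2.trans_le (nmin m hm hN)⟩
  have hqn : q < n := by
    rcases lt_trichotomy q n with h | h | h
    · exact h
    · rw [← h] at n2; exact absurd n2 (lt_irrefl _)
    · exact absurd (q3 n h n1) (not_lt.2 n2.le)
  by_contra hcon
  push Not at hcon
  have : n ∈ B := ⟨hnA, by linarith⟩
  have := le_csSup hB this
  change n ≤ q at this
  omega

theorem sm_closure (M : MM f K) {a b : ℝ} (hab : a < b) {k : ℕ} {δ ρ : ℝ} (h : Sm f (Ioo a b) k δ) (hρ : δ < ρ) :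
    Sm f (Icc a b) k ρ := by
  have cl : IsClosed {p : ℝ × ℝ | |f^[k] p.1 - f^[k] p.2| ≤ δ} :=
    isClosed_le (((M.itcont k).comp continuous_fst).sub ((M.itcont k).comp continuous_snd)).abs continuous_const
  have sub : Ioo a b ×ˢ Ioo a b ⊆ {p : ℝ × ℝ | |f^[k] p.1 - f^[k] p.2| ≤ δ} := fun p hp => (h _ hp.1 _ hp.2).le
  have := closure_minimal sub cl
  rw [closure_prod_eq, closure_Ioo hab.ne] at this
  intro s hs t ht
  exact (this (show (s, t) ∈ Icc a b ×ˢ Icc a b from ⟨hs, ht⟩)).trans_lt hρ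

theorem Sp.pullabs {h : ℝ → ℝ} {u a b w b0 : ℝ} (H : CRE h u w) (h1 : u < a) (h0 : a < b) (h2 : b < w)
    (hb : 0 ≤ b0) (p1 : 0 < |h a - h u|) (p2 : 0 < |h w - h b|) (p3 : 0 < |h b - h a|)
    (q1 : |h b - h a| ≤ b0 * |h a - h u|) (q2 : |h b - h a| ≤ b0 * |h w - h b|) :
    Sp (2 * b0 + b0 ^ 2) u a b w := by
  have k := H u a b w le_rfl h1 h0 h2 le_rfl
  set A := |h a - h u|
  set J := |h b - h a|
  set R := |h w - h b|
  have tri : |h w - h u| ≤ A + J + R := by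
    have := abs_add_three (h a - h u) (h b - h a) (h w - h b)
    rwa [show h a - h u + (h b - h a) + (h w - h b) = h w - h u by ring] at this
  have s := Sp.of (u := 0) (a := A) (c := A + J) (w := A + J + R) hb p1 (by linarith) (by linarith)
    (by linarith) (by linarith)
  unfold Sp at *
  have pos : 0 < (a - u) * (w - b) := mul_pos (by linarith) (by linarith)
  have k2 : (w - u) * (b - a) * (A * R) ≤ ((2 * b0 + b0 ^ 2) * ((a - u) * (w - b))) * (A * R) := by
    refine k.trans ?_
    have t1 : |h w - h u| * J ≤ (2 * b0 + b0 ^ 2) * (A * R) := by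
      refine (mul_le_mul_of_nonneg_right tri p3.le).trans ?_
      have e : (A + J + R - 0) * (A + J - A) = (A + J + R) * J := by ring
      have e' : (A - 0) * (A + J + R - (A + J)) = A * R := by ring
      rw [e, e'] at s
      exact s
    calc _ ≤ ((2 * b0 + b0 ^ 2) * (A * R)) * ((a - u) * (w - b)) := mul_le_mul_of_nonneg_right t1 pos.le
      _ = _ := by ring
  exact le_of_mul_le_mul_right k2 (mul_pos p1 p2)

end
end WI

namespace WI
section
variable {f : ℝ → ℝ} {K : Finset ℝ} {x y : ℕ → ℝ}
open Filter Topology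

theorem MM.lv_sub (M : MM f K) {c : ℝ} (hcK : c ∈ K) {s t : ℝ} (hs : s ∈ Icc (lo K c) (hi K c))
    (ht : t ∈ Icc (lo K c) (hi K c)) : |f s - f t| = |lv f c s - lv f c t| := by
  obtain ⟨-, -, l⟩ := M.lev hcK
  unfold lv
  rcases l with l | l
  · rw [l s hs, l t ht]; congr 1; ring
  · rw [l s hs, l t ht, abs_sub_comm]; congr 1; ring

theorem MM.top (M : MM f K) (W : WSeq f K x y) {Ψ : ℝ → ℝ} (P : PE f K Ψ) {c : ℝ} (hcK : c ∈ K) {ρ δ : ℝ}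
    (hρ : ∀ i k, ¬ Sm f (Icc (lo K (x i)) (hi K (x i))) k ρ) (hδ : δ < ρ) {q n k : ℕ}
    (hq : Nb K c x y q) (hn : Nb K c x y n) (hl : lamU f c x y n < lamU f c x y q)
    (ha : y (n+1) - x (n+1) ≤ y (q+1) - x (q+1)) (hsm : Sm f (S f K c (lamU f c x y q)) k δ) :
    ∃ u v, S f K c (lamU f c x y q) = Ioo u v ∧ 0 ≤ u ∧ v ≤ 1 ∧ u < x n ∧ y n < v ∧ Sp (Ψ 1) u (x n) (y n) v := by
  obtain ⟨h1, h2, h3, h4, -, -⟩ := M.near hcK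
  obtain ⟨l1, l2, -⟩ := M.lev hcK
  obtain ⟨a1, a2, a3, -⟩ := M.lvl W hcK hq
  obtain ⟨b1, b2, b3, b4, -⟩ := M.lvl W hcK hn
  have sep := M.lvl_sep W hcK hn hq hl
  obtain ⟨u, v, e1, e2, e3, e4, e5, e6, e7⟩ := M.S_Ioo hcK (show 0 < lamU f c x y q by linarith)
  have lt := W.lt n
  have J : Icc (x n) (y n) ⊆ Ioo u v := by rw [← e1]; exact (M.lvl_S W hcK).2 ⟨hn, hl⟩
  have ju := (J (left_mem_Icc.2 lt.le)).1
  have jv := (J (right_mem_Icc.2 lt.le)).2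
  refine ⟨u, v, e1, by linarith, by linarith, ju, jv, ?_⟩
  rw [e1] at hsm
  refine P.2.2 (x n) (y n) c (lamU f c x y q) u v 1 zero_le_one hcK lt e2 e3 e4 e5 ju jv ?_
  have x0 := W.pos n
  have y1 := W.lt1 n
  have hnl := hn.1
  have hnr := hn.2
  have hK : x n ∉ K := fun h => W.noK n _ h (left_mem_Icc.2 lt.le)
  rcases b4 with ⟨s, t1, t2⟩ | ⟨s, t1, t2⟩
  · left
    have outer : |f v - f c| = lamU f c x y q := by
      rcases e7 with ⟨hv, -⟩ | hv
      · exfalso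
        refine hρ n k (((sm_closure M (by linarith) hsm hδ)).mono ?_)
        have r1 : c ≤ lo K (x n) := le_lo hcK s
        have r2 : hi K (x n) ≤ hi K c := by
          rcases (hi_spec (K := K) (t := c) (by linarith)).1 with h | h
          · rw [h]; exact hi_le1 (by linarith)
          · exact hi_le h (by linarith)
        exact fun t ht => ⟨by linarith [ht.1], by linarith [ht.2]⟩
      · exact hv
    refine ⟨s, outer, e6.imp And.left id, ?_⟩
    rw [one_mul, W.abs_endp, M.lv_sub hcK ⟨by linarith, by linarith⟩ ⟨by linarith, by linarith⟩, t1]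
    have : lv f c v = lamU f c x y q := outer
    rw [this, abs_of_pos (by linarith)]
    linarith
  · right
    have outer : |f u - f c| = lamU f c x y q := by
      rcases e6 with ⟨hv, -⟩ | hv
      · exfalso
        refine hρ n k (((sm_closure M (by linarith) hsm hδ)).mono ?_)
        have r1 : hi K (x n) ≤ c := hi_le hcK (by linarith)
        have r2 : lo K c ≤ lo K (x n) := by
          rcases (lo_spec (K := K) (t := c) (by linarith)).1 with h | h
          · rw [h]; exact lo_nonneg (by linarith)
          · exact le_lo h (by linarith)
        exact fun t ht => ⟨by linarith [ht.1], by linarith [ht.2]⟩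
      · exact hv
    refine ⟨s, outer, e7.imp And.left id, ?_⟩
    rw [one_mul, W.abs_endp, M.lv_sub hcK ⟨by linarith, by linarith⟩ ⟨by linarith, by linarith⟩, t1]
    have : lv f c u = lamU f c x y q := outer
    rw [this, abs_of_pos (by linarith)]
    linarith

/-- harmless passage through `c` -/
theorem MM.harmless (M : MM f K) (W : WSeq f K x y) {Ψ : ℝ → ℝ} (P : PE f K Ψ) {c : ℝ} (hcK : c ∈ K)
    (hc : ∀ Y m, Trap f x y Y m → Cross f Y c) {ρ δ : ℝ}
    (hρ : ∀ i k, ¬ Sm f (Icc (lo K (x i)) (hi K (x i))) k ρ) (hδ : δ ≤ ρ) {n k a : ℕ} {U V : ℕ → ℝ}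
    (C : Chain f K x y n U V) (F : Fresh x y n (Ioo (U n) (V n))) (hsm : Sm f (Ioo (U n) (V n)) k δ)
    (ha : a < n) (hca : c ∈ Ioo (U a) (V a)) {b0 : ℝ} (hb0 : 0 ≤ b0)
    (hs : Sp b0 (U (a+1)) (x (a+1)) (y (a+1)) (V (a+1)))
    (hh : y (a+1) - x (a+1) ≤ b0 * lamL f c x y a) :
    ∃ u v k, 0 ≤ u ∧ v ≤ 1 ∧ u < x 0 ∧ y 0 < v ∧ Sp (Ψ^[K.card] (2 * b0 + b0 ^ 2)) u (x 0) (y 0) v ∧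
      Sm f (Ioo u v) k δ := by
  obtain ⟨h1, h2, h3, h4, -, -⟩ := M.near hcK
  obtain ⟨l1, l2, -⟩ := M.lev hcK
  have st := C.st a ha
  have bd := C.bd ha.le
  have bd' := C.bd (i := a+1) (by omega)
  obtain ⟨e, he, hS⟩ := C.isS M ha hcK hca
  have J := C.J ha.le
  rw [hS] at J
  obtain ⟨nb, lam⟩ := (M.lvl_S W hcK).1 J
  obtain ⟨b1, b2, b3, b4, -⟩ := M.lvl W hcK nb
  have lt := W.lt a
  have lt' := W.lt (a+1)
  have Fa := Fresh.lower M W C F ha.le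
  have hL := hs.left bd'.2.2.1 lt' bd'.2.2.2
  have hR := hs.right bd'.2.2.1 lt' bd'.2.2.2
  have cl : lo K c ≤ U a ∧ V a ≤ hi K c := by
    have hsub : Ioo (U a) (V a) ⊆ Ioo (lo K c) (hi K c) := by rw [hS]; exact fun t ht => ⟨ht.1, ht.2.1⟩
    have := (Ioo_subset_Ioo_iff (by linarith [hca.1, hca.2])).1 hsub
    exact this
  have gen : ∀ p q, ((q = y (a+1)) ∨ (q = x (a+1))) → (p = U (a+1) ∨ p = V (a+1)) →
      y (a+1) - x (a+1) ≤ b0 * |p - q| := by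
    intro p q hq hp
    rcases hp with rfl | rfl
    · refine hL.trans (mul_le_mul_of_nonneg_left ?_ hb0)
      rw [abs_sub_comm]; refine le_trans ?_ (le_abs_self _)
      rcases hq with rfl | rfl <;> linarith
    · refine hR.trans (mul_le_mul_of_nonneg_left ?_ hb0)
      refine le_trans ?_ (le_abs_self _)
      rcases hq with rfl | rfl <;> linarith
  have ex : f (x a) = y (a+1) ∨ f (x a) = x (a+1) := by
    rcases W.endp a with ⟨a, b⟩ | ⟨a, b⟩ <;> simp [a]
  have ey : f (y a) = y (a+1) ∨ f (y a) = x (a+1) := by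
    rcases W.endp a with ⟨a, b⟩ | ⟨a, b⟩ <;> simp [b]
  have ps : (c < x a → f (V a) = U (a+1) ∨ f (V a) = V (a+1)) ∧
      (y a < c → f (U a) = U (a+1) ∨ f (U a) = V (a+1)) := by
    rcases st.2.2.2.2.2 with h | ⟨z, hz, e, he, hS, q1, q2, q3, q4, q5⟩
    · exact absurd hca (h.1 c hcK)
    · have : c = z := only hcK (by linarith [hca.1]) (by linarith [hca.2])
      subst this
      rcases q5 with ⟨r, -, r', -⟩ | ⟨r, -, r', -⟩
      · exact ⟨fun _ => r', fun h => by linarith⟩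
      · exact ⟨fun h => by linarith, fun _ => r'⟩
  have half : ∃ u v, U a ≤ u ∧ v ≤ V a ∧ u < x a ∧ y a < v ∧ c ∉ Ioo u v ∧ Sp (2 * b0 + b0 ^ 2) u (x a) (y a) v := by
    have pJ : 0 < |f (y a) - f (x a)| := by rw [W.abs_endp]; linarith
    rcases b4 with ⟨s, t1, t2⟩ | ⟨s, t1, t2⟩
    · refine ⟨c, V a, hca.1.le, le_rfl, s, bd.2.2.2, fun h => lt_irrefl _ h.1, ?_⟩
      have g := gen _ _ ey (ps.1 s)
      have noK : ∀ z ∈ K, ¬ (c < z ∧ z < V a) := fun z hz hh => by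
        have := only hz (by linarith [hh.1]) (by linarith [hh.2, cl.2] : z < hi K c)
        linarith [hh.1]
      refine Sp.pullabs (M.cre (by linarith) bd.2.1 noK) s lt bd.2.2.2 hb0 ?_ ?_ pJ ?_ ?_
      · change 0 < lv f c (x a); rw [t2]; exact b1
      · rcases (abs_nonneg (f (V a) - f (y a))).eq_or_lt with h | h
        · rw [← h] at g; linarith
        · exact h
      · change _ ≤ b0 * lv f c (x a); rw [t2, W.abs_endp]; exact hh
      · rw [W.abs_endp]; exact g
    · refine ⟨U a, c, le_rfl, hca.2.le, bd.2.2.1, s, fun h => lt_irrefl _ h.2, ?_⟩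
      have g := gen _ _ ex (ps.2 s)
      have noK : ∀ z ∈ K, ¬ (U a < z ∧ z < c) := fun z hz hh => by
        have := only hz (by linarith [hh.1, cl.1]) (by linarith [hh.2] : z < hi K c)
        linarith [hh.2]
      refine Sp.pullabs (M.cre bd.1 (by linarith) noK) bd.2.2.1 lt s hb0 ?_ ?_ pJ ?_ ?_
      · rw [abs_sub_comm]
        rcases (abs_nonneg (f (U a) - f (x a))).eq_or_lt with h | h
        · rw [← h] at g; linarith
        · exact h
      · rw [abs_sub_comm]; change 0 < lv f c (y a); rw [t2]; exact b1
      · rw [W.abs_endp, abs_sub_comm]; exact g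
      · rw [abs_sub_comm (f c)]; change _ ≤ b0 * lv f c (y a); rw [t2, W.abs_endp]; exact hh
  obtain ⟨u, v, c1, c2, c3, c4, c5, c6⟩ := half
  have sub : Ioo u v ⊆ Ioo (U a) (V a) := Ioo_subset_Ioo c1 c2
  have sma : Sm f (Ioo u v) (k + (n - a)) δ := (C.sm ha.le hsm).mono sub
  obtain ⟨U2, V2, C2, hU, hV⟩ := M.exists_chain W hρ a (U' := u) (V' := v) (by linarith) (by linarith) c3 c4
    (sma.lt hδ)
  have F2 : Fresh x y a (Ioo (U2 a) (V2 a)) := by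
    rw [hU, hV]
    exact fun m hm h => Fa m hm (h.trans sub)
  have hno : ∀ i < a, c ∉ Ioo (U2 i) (V2 i) := by
    classical
    by_contra hcon
    push Not at hcon
    obtain ⟨i0, hi0, hci0⟩ := hcon
    let A : Set ℕ := {i | i < a ∧ c ∈ Ioo (U2 i) (V2 i)}
    have hA : BddAbove A := ⟨a, fun i hi => hi.1.le⟩
    have hm : sSup A ∈ A := Nat.sSup_mem ⟨i0, hi0, hci0⟩ hA
    set a' := sSup A
    obtain ⟨m1, m2⟩ := hm
    have big : ∀ i, a' < i → i < a → c ∉ Ioo (U2 i) (V2 i) := by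
      intro i h h' hc
      have : i ≤ a' := le_csSup hA ⟨h', hc⟩
      omega
    obtain ⟨e', he', hS'⟩ := C2.isS M m1 hcK m2
    have ee : e < e' := by
      by_contra hcon
      push Not at hcon
      refine Fa a' m1 ((C2.J m1.le).trans ?_)
      rw [hS', hS]; exact S_mono hcon
    have sub2 : Ioo u v ⊆ Ioo (U2 a') (V2 a') := by
      refine sub.trans ?_
      rw [hS', hS]; exact S_mono ee.le
    have mtr : ∀ r, a' + r ≤ a → MapsTo (f^[r]) (Ioo u v) (Ioo (U2 (a'+r)) (V2 (a'+r))) :=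
      fun r hr t ht => C2.mt r hr (sub2 ht)
    have trap : Trap f x y (Ioo u v) (a - a') := by
      refine ⟨?_, ordConnected_Ioo, by omega, ?_, a, fun t ht => ⟨by linarith [ht.1], by linarith [ht.2]⟩⟩
      · exact sub.trans (C.sub ha.le)
      · have := mtr (a - a') (by omega)
        rwa [show a' + (a - a') = a by omega, hU, hV] at this
    obtain ⟨r, hr, s, hs, t, ht, k1, k2⟩ := cross_mod trap.one trap.mt (hc _ _ trap)
    rcases Nat.eq_zero_or_pos r with rfl | hr0
    · exact c5 ⟨hs.1.trans k1, k2.trans ht.2⟩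
    · exact big (a' + r) (by omega) (by omega)
        ⟨(mtr r (by omega) hs).1.trans k1, k2.trans (mtr r (by omega) ht).2⟩
  refine M.fin_chain W P hc C2 F2 hno (by positivity) ?_ (k := k + (n - a)) ?_
  · rw [hU, hV]; exact c6
  · rw [hU, hV]; exact sma

end
end WI

namespace WI
section
variable {f : ℝ → ℝ} {K : Finset ℝ} {x y : ℕ → ℝ}
open Filter Topology

theorem iter_contract {F : ℝ → ℝ} {T : Set ℝ} (hm : MapsTo F T T)
    (hF : ∀ s ∈ T, ∀ t ∈ T, |F s - F t| ≤ 1 / 2 * |s - t|) (k : ℕ) :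
    ∀ s ∈ T, ∀ t ∈ T, |F^[k] s - F^[k] t| ≤ (1 / 2) ^ k * |s - t| := by
  induction k with
  | zero => intro s _ t _; simp
  | succ k ih =>
    intro s hs t ht
    rw [Function.iterate_succ_apply, Function.iterate_succ_apply, pow_succ, mul_assoc]
    exact (ih _ (hm hs) _ (hm ht)).trans (mul_le_mul_of_nonneg_left (hF s hs t ht) (by positivity))

/-- Lipschitz bound on a symmetric critical neighbourhood -/
theorem MM.coreLip (M : MM f K) : ∃ D, 1 ≤ D ∧ ∀ c ∈ K, ∀ μ > 0, ∀ u v, S f K c μ = Ioo u v →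
    ∀ s ∈ Ioo u v, ∀ t ∈ Ioo u v, |f s - f t| * (v - u) ≤ 2 * D * μ * |s - t| := by
  obtain ⟨D, hD, hd⟩ := M.dist2
  refine ⟨D, hD, fun c hcK μ hμ u v hS s hs t ht => ?_⟩
  obtain ⟨h1, h2, h3, h4, -, -⟩ := M.near hcK
  obtain ⟨u', v', e1, e2, e3, e4, e5, e6, e7⟩ := M.S_Ioo hcK hμ
  have huv : u' = u ∧ v' = v := by
    have hh : Ioo u' v' = Ioo u v := e1.symm.trans hS
    have ne : u' < v' := by linarith
    have ne' : u < v := hs.1.trans hs.2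
    have a := (Ioo_subset_Ioo_iff ne).1 hh.le
    have b := (Ioo_subset_Ioo_iff ne').1 hh.ge
    exact ⟨le_antisymm b.1 a.1, le_antisymm a.2 b.2⟩
  obtain ⟨rfl, rfl⟩ := huv
  have m1 : ∀ r ∈ Ioo u' v', r ∈ Icc (0:ℝ) 1 := fun r hr => ⟨by linarith [hr.1], by linarith [hr.2]⟩
  have fin : ∀ p q, p < q → v' - u' ≤ 2 * (q - p) → |f q - f p| ≤ μ →
      |f s - f t| * (q - p) ≤ D * |f q - f p| * |s - t| → |f s - f t| * (v' - u') ≤ 2 * D * μ * |s - t| := by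
    intro p q hpq h5 h6 h7
    have g1 := mul_le_mul_of_nonneg_left h5 (abs_nonneg (f s - f t))
    have g2 : D * |f q - f p| * |s - t| ≤ D * μ * |s - t| :=
      mul_le_mul_of_nonneg_right (mul_le_mul_of_nonneg_left h6 (by linarith)) (abs_nonneg _)
    linarith
  rcases le_total (c - u') (v' - c) with h | h
  · have ev : |f v' - f c| ≤ μ := e7.elim And.right le_of_eq
    refine fin c v' e4 (by linarith) ev (hd c v' (by linarith) e4 (by linarith) ?_ s (m1 s hs) t (m1 t ht) ?_ ?_ ?_ ?_)
    · intro z hz hh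
      have := only hz (by linarith [hh.1]) (by linarith [hh.2] : z < hi K c)
      linarith [hh.1]
    · linarith [hs.1]
    · linarith [hs.2]
    · linarith [ht.1]
    · linarith [ht.2]
  · have ev : |f c - f u'| ≤ μ := by rw [abs_sub_comm]; exact e6.elim And.right le_of_eq
    refine fin u' c e3 (by linarith) ev (hd u' c (by linarith) e3 (by linarith) ?_ s (m1 s hs) t (m1 t ht) ?_ ?_ ?_ ?_)
    · intro z hz hh
      have := only hz (by linarith [hh.1]) (by linarith [hh.2] : z < hi K c)
      linarith [hh.2]
    · linarith [hs.1]
    · linarith [hs.2]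
    · linarith [ht.1]
    · linarith [ht.2]

theorem MM.harmful (M : MM f K) (W : WSeq f K x y) {c : ℝ} (hcK : c ∈ K) {θ D : ℝ} (hθ : 0 < θ) (hD : 1 ≤ D) :
    ∃ ε > 0, ∀ n U V, Chain f K x y n U V → ∀ a < n, c ∈ Ioo (U a) (V a) → Fw f x y U V (a+1) n θ D →
      Nb K c x y n → lamU f c x y n < lamL f c x y a → Ioo (U n) (V n) ⊆ Ioo (lo K c) (hi K c) →
      lamL f c x y a ≤ ε * (y (a+1) - x (a+1)) → False := by
  obtain ⟨D1, hD1, hlip⟩ := M.coreLip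
  obtain ⟨D2, hD2, hd⟩ := M.dist2
  have Dp : 0 < D := by linarith
  have D1p : 0 < D1 := by linarith
  have D2p : 0 < D2 := by linarith
  set ε := min (1/2) (min θ (min (1 / (12 * D * D1)) (1 / (D * D2)))) with hε
  have ε0 : 0 < ε := by
    refine lt_min (by norm_num) (lt_min hθ (lt_min (by positivity) (by positivity)))
  have ε1 : ε ≤ 1/2 := min_le_left _ _
  have ε2 : ε ≤ θ := (min_le_right _ _).trans (min_le_left _ _)
  have ε3 : ε ≤ 1 / (12 * D * D1) := (min_le_right _ _).trans ((min_le_right _ _).trans (min_le_left _ _))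
  have ε4 : ε ≤ 1 / (D * D2) := (min_le_right _ _).trans ((min_le_right _ _).trans (min_le_right _ _))
  rw [le_div_iff₀ (by positivity)] at ε3 ε4
  refine ⟨ε, ε0, fun n U V C a ha hca Fwd hn hlam htop hh => ?_⟩
  obtain ⟨h1, h2, h3, h4, -, -⟩ := M.near hcK
  obtain ⟨e, he, hS⟩ := C.isS M ha hcK hca
  have J := C.J ha.le
  rw [hS] at J
  obtain ⟨nb, lam⟩ := (M.lvl_S W hcK).1 J
  obtain ⟨b1, b2, b3, b4, -⟩ := M.lvl W hcK nb
  obtain ⟨n1, n2, n3, n4, n5⟩ := M.lvl W hcK hn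
  have lt1 := W.lt (a+1)
  have ltn := W.lt n
  have ltn1 := W.lt (n+1)
  set A := lamL f c x y a with hA
  set L := y (a+1) - x (a+1) with hLdef
  have L0 : 0 < L := by rw [hLdef]; linarith
  have AL : A ≤ 1/2 * L := hh.trans (mul_le_mul_of_nonneg_right ε1 L0.le)
  obtain ⟨u, v, s1, s2, s3, s4, s5, -, -⟩ := M.S_Ioo hcK (show 0 < 3 * A by linarith)
  have core_sub : Ioo u v ⊆ Ioo (U a) (V a) := by
    rw [← s1, hS]; exact S_mono (by linarith)
  have Jn : Icc (x n) (y n) ⊆ Ioo u v := by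
    rw [← s1]; exact (M.lvl_S W hcK).2 ⟨hn, by linarith⟩
  have jx := (Jn (left_mem_Icc.2 ltn.le)).1
  have jy := (Jn (right_mem_Icc.2 ltn.le)).2
  set F := f^[n - a] with hF
  have hFe : ∀ t, F t = f^[n - (a+1)] (f t) := by
    intro t
    rw [hF, show n - a = (n - (a+1)) + 1 by omega, Function.iterate_succ_apply]
  have mt1 : MapsTo f (Ioo u v) (Ioo (U (a+1)) (V (a+1))) := fun t ht => (C.st a ha).2.2.2.2.1 (core_sub ht)
  have mtn : MapsTo F (Ioo u v) (Ioo (U n) (V n)) := by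
    have := C.mt (i := a) (n - a) (by omega)
    rw [show a + (n - a) = n by omega] at this
    exact fun t ht => this (core_sub ht)
  have lvlt : ∀ t ∈ Ioo u v, lv f c t < 3 * A := fun t ht => by
    have : t ∈ S f K c (3 * A) := by rw [s1]; exact ht
    exact this.2.2
  have nearI : ∀ t ∈ Ioo u v, f t ∈ Icc (x (a+1) - ε * L) (y (a+1) + ε * L) := by
    intro t ht
    have l0 : 0 ≤ lv f c t := abs_nonneg _
    have l1 := lvlt t ht
    have tI : t ∈ Icc (lo K c) (hi K c) := ⟨by linarith [ht.1], by linarith [ht.2]⟩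
    rcases M.lvl_img W hcK with ⟨p, q⟩ | ⟨p, q⟩
    · obtain ⟨p1, p2⟩ := p a nb
      rw [q t tI]
      constructor <;> linarith
    · obtain ⟨p1, p2⟩ := p a nb
      rw [q t tI]
      constructor <;> linarith
  have wide : ∀ t ∈ Ioo u v, f t ∈ Icc (x (a+1) - θ * L) (y (a+1) + θ * L) := by
    intro t ht
    have := nearI t ht
    have g := mul_le_mul_of_nonneg_right ε2 L0.le
    exact ⟨by linarith [this.1], by linarith [this.2]⟩
  have contr : ∀ s ∈ Ioo u v, ∀ t ∈ Ioo u v, |F s - F t| ≤ 1 / 2 * |s - t| := by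
    intro s hs t ht
    have k1 := Fwd (f s) (mt1 hs) (f t) (mt1 ht) (wide s hs) (wide t ht)
    rw [← hFe, ← hFe] at k1
    change _ * L ≤ _ at k1
    have k2 := hlip c hcK (3 * A) (by linarith) u v s1 s hs t ht
    have w0 : 0 < v - u := by linarith
    have st0 := abs_nonneg (s - t)
    have jl : y n - x n ≤ v - u := by linarith
    have g1 : |F s - F t| * L * (v - u) ≤ D * (y n - x n) * (2 * D1 * (3 * A) * |s - t|) := by
      have r1 := mul_le_mul_of_nonneg_right k1 w0.le
      have r2 := mul_le_mul_of_nonneg_left k2 (show 0 ≤ D * (y n - x n) from mul_nonneg Dp.le (by linarith))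
      linarith
    have g2 : D * (y n - x n) * (2 * D1 * (3 * A) * |s - t|) ≤ D * (v - u) * (2 * D1 * (3 * (ε * L)) * |s - t|) := by
      have r1 : D * (y n - x n) ≤ D * (v - u) := mul_le_mul_of_nonneg_left jl Dp.le
      have r2 : 2 * D1 * (3 * A) * |s - t| ≤ 2 * D1 * (3 * (ε * L)) * |s - t| := by gcongr
      exact mul_le_mul r1 r2 (by positivity) (by positivity)
    have g3 : D * (v - u) * (2 * D1 * (3 * (ε * L)) * |s - t|) = (ε * (12 * D * D1)) * (1/2 * |s - t| * (L * (v - u))) := by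
      ring
    have g4 : (ε * (12 * D * D1)) * (1/2 * |s - t| * (L * (v - u))) ≤ 1 * (1/2 * |s - t| * (L * (v - u))) :=
      mul_le_mul_of_nonneg_right ε3 (by positivity)
    have g5 : |F s - F t| * (L * (v - u)) ≤ 1/2 * |s - t| * (L * (v - u)) := by linarith
    exact le_of_mul_le_mul_right g5 (mul_pos L0 w0)
  have mcore : MapsTo F (Ioo u v) (Ioo u v) := by
    intro t ht
    rw [← s1]
    have hb := htop (mtn ht)
    refine ⟨hb.1, hb.2, ?_⟩
    have nr := Fw.near M W C (i := a+1) (j := n) (by omega) le_rfl Fwd ε0.le ε2 Dp.le (mt1 ht) (nearI t ht)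
    rw [← hFe] at nr
    have Dε : D * ε ≤ 1 := by nlinarith
    have w0 : 0 ≤ D * ε * (y n - x n) := by
      have : 0 ≤ y n - x n := by linarith
      positivity
    obtain ⟨p, hp, hFp⟩ := nearJ ltn w0 nr
    have F01 : F t ∈ Icc (0:ℝ) 1 := C.sub le_rfl (mtn ht)
    have g : D * ε * (y n - x n) ≤ 1 * (y n - x n) := mul_le_mul_of_nonneg_right Dε (by linarith)
    have k := hd (x n) (y n) (W.pos n).le ltn (W.lt1 n).le
      (fun z hz h => W.noK n z hz ⟨h.1.le, h.2.le⟩) (F t) F01 p (W.sub n hp)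
      (by linarith [nr.1]) (by linarith [nr.2]) (by linarith [hp.1]) (by linarith [hp.2])
    rw [W.abs_endp] at k
    have k2 : |f (F t) - f p| * (y n - x n) ≤ (y (n+1) - x (n+1)) * (y n - x n) := by
      refine k.trans ?_
      have r1 := mul_le_mul_of_nonneg_left hFp (show 0 ≤ D2 * (y (n+1) - x (n+1)) from mul_nonneg D2p.le (by linarith))
      have r2 := mul_le_mul_of_nonneg_right ε4 (show 0 ≤ (y (n+1) - x (n+1)) * (y n - x n) from
        mul_nonneg (by linarith) (by linarith))
      linarith
    have k3 := le_of_mul_le_mul_right k2 (by linarith)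
    have k4 := (n5 p hp).2
    have k5 : |f (F t) - f c| ≤ |f (F t) - f p| + |f p - f c| := abs_sub_le _ _ _
    change |f p - f c| ≤ _ at k4
    linarith
  obtain ⟨ρ, hρ, hk⟩ := M.wmax W (i := n) (a := (u + x n) / 2) (b := y n) (by linarith) (W.lt1 n).le
    (by linarith) le_rfl (Or.inl (by linarith))
  obtain ⟨k, hkk⟩ := exists_pow_lt_of_lt_one hρ (show (1/2 : ℝ) < 1 by norm_num)
  refine hk ((n - a) * k) ?_
  intro s hs t ht
  have s' : s ∈ Ioo u v := ⟨by linarith [hs.1], by linarith [hs.2]⟩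
  have t' : t ∈ Ioo u v := ⟨by linarith [ht.1], by linarith [ht.2]⟩
  have := iter_contract mcore contr k s s' t t'
  rw [hF, ← Function.iterate_mul] at this
  refine this.trans_lt (lt_of_le_of_lt ?_ hkk)
  have : |s - t| ≤ 1 := abs_le.2 ⟨by linarith [s'.1, t'.2], by linarith [s'.2, t'.1]⟩
  have p : (0:ℝ) ≤ (1/2)^k := by positivity
  nlinarith

theorem MM.nonquiet_case (M : MM f K) (W : WSeq f K x y) {c : ℝ} (hcK : c ∈ K)
    (hc : ∀ Y m, Trap f x y Y m → Cross f Y c) (hq : ¬ Quiet f K x y c) : False := by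
  obtain ⟨ρ, hρ0, hlap⟩ := M.lapconst W
  obtain ⟨Ψ, P⟩ := M.passest
  have P : PE f K Ψ := P
  have Ψ1 : 0 ≤ Ψ 1 := zero_le_one.trans (P.1 1 zero_le_one)
  set B := Ψ^[K.card] (Ψ 1) with hB
  have B0 : 0 ≤ B := Ψ1.trans (P.it_le Ψ1 _)
  obtain ⟨θ, D, hθ, hD, hfwd⟩ := M.fwd W B0 K.card
  obtain ⟨ε, hε, hharm⟩ := M.harmful W hcK hθ hD
  set b0 := max B (1 / ε) with hb0
  have b00 : 0 ≤ b0 := B0.trans (le_max_left _ _)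
  refine M.final W (β := max B (Ψ^[K.card] (2 * b0 + b0 ^ 2))) fun δ hδ => ?_
  set δ' := min δ (ρ / 2) with hδ'
  have d0 : 0 < δ' := lt_min hδ (by linarith)
  have d1 : δ' < ρ := (min_le_right _ _).trans_lt (by linarith)
  obtain ⟨q, n, k, q1, q2, q3, q4, q5, q6⟩ := M.select W hcK hq d0
  obtain ⟨u, v, t1, t2, t3, t4, t5, t6⟩ := M.top W P hcK hlap d1 q1 q2 q3 q5 q6
  rw [t1] at q6
  obtain ⟨U, V, C, hU, hV⟩ := M.exists_chain W hlap n t2 t3 t4 t5 (q6.lt d1.le)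
  have F : Fresh x y n (Ioo (U n) (V n)) := by
    intro m hm h
    rw [hU, hV, ← t1] at h
    obtain ⟨r1, r2⟩ := (M.lvl_S W hcK).1 h
    linarith [q4 m hm r1]
  have hs : Sp (Ψ 1) (U n) (x n) (y n) (V n) := by rw [hU, hV]; exact t6
  have hsm : Sm f (Ioo (U n) (V n)) k δ' := by rw [hU, hV]; exact q6
  by_cases hno : ∀ i < n, c ∉ Ioo (U i) (V i)
  · obtain ⟨u, v, k, r1, r2, r3, r4, r5, r6⟩ := M.fin_chain W P hc C F hno Ψ1 hs hsm
    exact ⟨u, v, k, r1, r2, r3, r4, r5.mono (le_max_left _ _) r3 r4, r6.lt (min_le_left _ _)⟩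
  · push Not at hno
    obtain ⟨i0, hi0, hci0⟩ := hno
    let A : Set ℕ := {i | i < n ∧ c ∈ Ioo (U i) (V i)}
    have hA : BddAbove A := ⟨n, fun i hi => hi.1.le⟩
    have hm : sSup A ∈ A := Nat.sSup_mem ⟨i0, hi0, hci0⟩ hA
    set a := sSup A
    obtain ⟨m1, m2⟩ := hm
    have big : ∀ i, a + 1 ≤ i → i < n → c ∉ Ioo (U i) (V i) := by
      intro i h h' hc
      have : i ≤ a := le_csSup hA ⟨h', hc⟩
      omega
    have N : NRep K U V (a+1) n := fun i j h1 h2 h3 z hz h4 h5 =>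
      M.norepeat W hc C F (s0 := a+1) big h1 h2 h3 hz h4 h5
    have sp : ∀ j, a + 1 ≤ j → j ≤ n → Sp B (U j) (x j) (y j) (V j) :=
      fun j h1 h2 => M.spchain W P C N Ψ1 hs h1 h2
    have bd := C.bd (i := a+1) (by omega)
    obtain ⟨e, he, hS⟩ := C.isS M m1 hcK m2
    have J := C.J m1.le
    rw [hS] at J
    obtain ⟨nb, lam⟩ := (M.lvl_S W hcK).1 J
    have sep := M.lvl_sep W hcK q2 nb (q3.trans_le (q4 a m1 nb))
    rcases le_or_gt (lamL f c x y a) (ε * (y (a+1) - x (a+1))) with h | h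
    · exfalso
      refine hharm n U V C a m1 m2 (hfwd n U V C (a+1) (by omega) sp N ?_) q2 sep ?_ h
      · exact Finset.card_le_card (fun z hz => (by simp only [PS, Finset.mem_filter] at hz; exact hz.1))
      · rw [hU, hV, ← t1]; exact fun t ht => ⟨ht.1, ht.2.1⟩
    · have hb : y (a+1) - x (a+1) ≤ b0 * lamL f c x y a := by
        have l0 := (M.lvl W hcK nb).1
        refine enl ?_ (le_max_right _ _) l0.le
        rw [div_mul_eq_mul_div, le_div_iff₀ hε]; linarith
      obtain ⟨u, v, k, r1, r2, r3, r4, r5, r6⟩ := M.harmless W P hcK hc hlap d1.le C F hsm m1 m2 b00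
        ((sp (a+1) le_rfl (by omega)).mono (le_max_left _ _) bd.2.2.1 bd.2.2.2) hb
      exact ⟨u, v, k, r1, r2, r3, r4, r5.mono (le_max_right _ _) r3 r4, r6.lt (min_le_left _ _)⟩

theorem MM.no_wandering (M : MM f K) {a b : ℝ} (ha : 0 ≤ a) (hab : a < b) (hb : b ≤ 1)
    (hnc : NC f K (Icc a b)) : False := by
  obtain ⟨x, y, W⟩ := M.exists_wseq ha hab hb hnc
  obtain ⟨c, hcK, hc⟩ := M.core W
  by_cases hq : Quiet f K x y c
  · exact M.quiet_case W hcK hc hq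
  · exact M.nonquiet_case W hcK hc hq

end
end WI

namespace WI
section
variable {f : ℝ → ℝ} {K : Finset ℝ} {x y : ℕ → ℝ}
open Filter Topology

theorem lt_card_iff {l : ℕ} {c : Fin l → ℝ} (hc : StrictMono c) (p : ℝ) (i : Fin l) :
    (i : ℕ) < (Finset.univ.filter fun i => c i < p).card ↔ c i < p := by
  constructor
  · intro h
    by_contra hn
    have : (Finset.univ.filter fun i => c i < p) ⊆ Finset.Iio i := by
      intro j hj
      simp only [Finset.mem_filter, Finset.mem_univ, true_and] at hj
      rw [Finset.mem_Iio]
      exact hc.lt_iff_lt.1 (hj.trans_le (not_lt.1 hn))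
    have := Finset.card_le_card this
    rw [Fin.card_Iio] at this
    omega
  · intro h
    have : Finset.Iic i ⊆ (Finset.univ.filter fun i => c i < p) := by
      intro j hj
      simp only [Finset.mem_filter, Finset.mem_univ, true_and]
      rw [Finset.mem_Iic] at hj
      exact (hc.monotone hj).trans_lt h
    have := Finset.card_le_card this
    rw [Fin.card_Iic] at this
    omega

theorem card_crit {l : ℕ} {c : Fin l → ℝ} (hc : StrictMono c) (i : Fin l) :
    (Finset.univ.filter fun j => c j < c i).card = i := by
  have : (Finset.univ.filter fun j => c j < c i) = Finset.Iio i := by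
    ext j; simp [hc.lt_iff_lt]
  rw [this, Fin.card_Iio]

theorem card_crit_le {l : ℕ} {c : Fin l → ℝ} (hc : StrictMono c) (i : Fin l) :
    (Finset.univ.filter fun j => c j ≤ c i).card = i + 1 := by
  have : (Finset.univ.filter fun j => c j ≤ c i) = Finset.Iic i := by
    ext j; simp [hc.le_iff_le]
  rw [this, Fin.card_Iic]

theorem symAt_crit {l : ℕ} {c : Fin l → ℝ} (hc : StrictMono c) (i : Fin l) :
    symAt l c (c i) = Sum.inr i := by
  have h : ∃ j, c i = c j := ⟨i, rfl⟩
  have e : symAt l c (c i) = Sum.inr h.choose := dif_pos h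
  rw [e, ← hc.injective h.choose_spec]

theorem symAt_lap {l : ℕ} {c : Fin l → ℝ} {p : ℝ} (h : ¬ ∃ j, p = c j) :
    symAt l c p = Sum.inl ⟨(Finset.univ.filter fun i => c i < p).card,
      Nat.lt_succ_of_le (le_trans (Finset.card_filter_le _ _) (by simp))⟩ := by
  exact dif_neg h

theorem symVal_symAt {l : ℕ} {c : Fin l → ℝ} (hc : StrictMono c) (p : ℝ) :
    symVal (symAt l c p) = ((Finset.univ.filter fun i => c i < p).card : ℤ) +
      (Finset.univ.filter fun i => c i ≤ p).card := by
  by_cases h : ∃ j, p = c j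
  · obtain ⟨j, rfl⟩ := h
    rw [symAt_crit hc, card_crit hc, card_crit_le hc]
    simp only [symVal, Sum.elim_inr]; push_cast; ring
  · rw [symAt_lap h]
    have : (Finset.univ.filter fun i => c i ≤ p) = (Finset.univ.filter fun i => c i < p) := by
      ext j
      simp only [Finset.mem_filter, Finset.mem_univ, true_and]
      exact ⟨fun h1 => lt_of_le_of_ne h1 fun h2 => h ⟨j, h2.symm⟩, le_of_lt⟩
    rw [this]
    simp only [symVal, Sum.elim_inl]; ring

theorem symVal_mono {l : ℕ} {c : Fin l → ℝ} (hc : StrictMono c) {p q : ℝ} (h : p ≤ q) :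
    symVal (symAt l c p) ≤ symVal (symAt l c q) := by
  rw [symVal_symAt hc, symVal_symAt hc]
  have h1 : (Finset.univ.filter fun i => c i < p).card ≤
      (Finset.univ.filter fun i => c i < q).card :=
    Finset.card_le_card fun i hi => by
      simp only [Finset.mem_filter, Finset.mem_univ, true_and] at hi ⊢; linarith
  have h2 : (Finset.univ.filter fun i => c i ≤ p).card ≤
      (Finset.univ.filter fun i => c i ≤ q).card :=
    Finset.card_le_card fun i hi => by
      simp only [Finset.mem_filter, Finset.mem_univ, true_and] at hi ⊢; linarith
  omega

theorem symVal_inj {l : ℕ} {u v : MSym l} (h : symVal u = symVal v) : u = v := by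
  rcases u with u | u <;> rcases v with v | v <;>
    simp only [symVal, Sum.elim_inl, Sum.elim_inr] at h
  · congr 1; apply Fin.ext; omega
  · omega
  · omega
  · congr 1; apply Fin.ext; omega

theorem lapPts_crit_left {l : ℕ} (c : Fin l → ℝ) (i : Fin l) :
    lapPts l c i.castSucc.succ = c i := by
  have := i.isLt
  unfold lapPts
  rw [dif_neg (by simp), dif_neg (by simp; omega)]
  congr 1

theorem lapPts_crit_right {l : ℕ} (c : Fin l → ℝ) (i : Fin l) :
    lapPts l c i.succ.castSucc = c i := by
  have := i.isLt
  unfold lapPts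
  rw [dif_neg (by simp), dif_neg (by simp; omega)]
  congr 1

theorem mem_lap {l : ℕ} {c : Fin l → ℝ} (hc : StrictMono c) {p : ℝ} (hp : p ∈ Icc (0:ℝ) 1)
    {j : Fin (l + 1)} (h : symAt l c p = Sum.inl j) : p ∈ lap l c j := by
  by_cases hk : ∃ i, p = c i
  · obtain ⟨i, rfl⟩ := hk
    rw [symAt_crit hc] at h
    exact absurd h (by simp)
  rw [symAt_lap hk] at h
  have hj := congrArg Fin.val (Sum.inl.inj h)
  simp only at hj
  have hlt := j.isLt
  constructor
  · unfold lapPts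
    split_ifs with h0 hl
    · exact hp.1
    · simp at hl; omega
    · apply ((lt_card_iff hc p _).1 _).le
      simp at h0 ⊢
      have : (j : ℕ) ≠ 0 := fun h => h0 (Fin.ext h)
      omega
  · unfold lapPts
    split_ifs with h0 hl
    · simp at h0
    · exact hp.2
    · by_contra hcon
      have := (lt_card_iff hc p _).2 (not_le.1 hcon)
      simp at this
      omega

theorem sgn_lap {l : ℕ} {f : ℝ → ℝ} {c : Fin l → ℝ} {s : Fin (l + 1) → Bool}
    (hc : StrictMono c) (hcm : ∀ i, c i ∈ Ioo (0:ℝ) 1)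
    (hm : MapsTo f (Icc 0 1) (Icc 0 1)) (hf0 : f 0 = 0)
    (hs : ∀ i : Fin l, s i.castSucc ≠ s i.succ)
    (hl : ∀ i, if s i then StrictMonoOn f (lap l c i) else StrictAntiOn f (lap l c i)) :
    ∀ n (h : n < l + 1), ((-1 : ℤ) ^ n = 1 ∧ s ⟨n, h⟩ = true) ∨
      ((-1 : ℤ) ^ n = -1 ∧ s ⟨n, h⟩ = false) := by
  intro n
  induction n with
  | zero =>
    intro h
    left
    refine ⟨by simp, ?_⟩
    by_contra hcon
    have h1 := hl ⟨0, h⟩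
    rw [if_neg hcon] at h1
    have e0 : lapPts l c (Fin.castSucc ⟨0, h⟩) = 0 := by unfold lapPts; rw [dif_pos (by simp)]
    have e1 : 0 < lapPts l c (Fin.succ ⟨0, h⟩) ∧ lapPts l c (Fin.succ ⟨0, h⟩) ≤ 1 := by
      unfold lapPts; rw [dif_neg (by simp)]
      split_ifs with h2
      · norm_num
      · exact ⟨(hcm _).1, (hcm _).2.le⟩
    have := h1 (show (0:ℝ) ∈ lap l c ⟨0, h⟩ from ⟨e0.le, e1.1.le⟩)
      (show lapPts l c (Fin.succ ⟨0, h⟩) ∈ lap l c ⟨0, h⟩ from ⟨by rw [e0]; exact e1.1.le, le_rfl⟩) e1.1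
    have h3 := (hm ⟨e1.1.le, e1.2⟩).1
    linarith
  | succ n ih =>
    intro h
    have h2 := hs ⟨n, by omega⟩
    simp only [Fin.castSucc_mk, Fin.succ_mk] at h2
    rcases ih (by omega) with ⟨a, b⟩ | ⟨a, b⟩
    · right; rw [b] at h2; exact ⟨by rw [pow_succ, a]; norm_num, by simpa using h2.symm⟩
    · left; rw [b] at h2; exact ⟨by rw [pow_succ, a]; norm_num, by simpa using h2.symm⟩

theorem sigLex_asymm {l : ℕ} {u v : ℕ → MSym l} (h : sigLexLt l u v) (h' : sigLexLt l v u) :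
    False := by
  obtain ⟨n, h1, h2⟩ := h
  obtain ⟨m, k1, k2⟩ := h'
  have e1 : ∏ i ∈ Finset.range n, symSgn (u i) = ∏ i ∈ Finset.range n, symSgn (v i) :=
    Finset.prod_congr rfl fun i hi => by rw [h1 i (Finset.mem_range.1 hi)]
  have e2 : ∏ i ∈ Finset.range m, symSgn (v i) = ∏ i ∈ Finset.range m, symSgn (u i) :=
    Finset.prod_congr rfl fun i hi => by rw [k1 i (Finset.mem_range.1 hi)]
  rcases lt_trichotomy n m with h | h | h
  · rw [e1, k1 n h] at h2; exact lt_irrefl _ h2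
  · subst h; exact lt_asymm h2 k2
  · rw [e2, h1 m h] at k2; exact lt_irrefl _ k2

theorem MM.of_modal {l : ℕ} {f : ℝ → ℝ} {c : Fin l → ℝ}
    (hmodal : IsLModal l f c)
    (hf0 : f 0 = 0)
    (hsmooth : ContDiff ℝ 3 f)
    (hreg : ∀ x ∈ Icc (0:ℝ) 1, (∀ i, x ≠ c i) → deriv f x ≠ 0)
    (hS : ∀ x ∈ Icc (0:ℝ) 1, (∀ i, x ≠ c i) → schwarzian f x < 0)
    (hnf : ∀ i, NonFlatAt f (c i))
    (hrep : ∀ p ∈ Icc (0:ℝ) 1, ∀ n : ℕ, 1 ≤ n → f^[n] p = p → 1 < |deriv (f^[n]) p|) :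
    MM f (Finset.univ.image c) := by
  obtain ⟨hc, hcm, hm, -, hf1, s, hs, hl⟩ := hmodal
  have hK : ∀ x, x ∉ Finset.univ.image c → ∀ i, x ≠ c i := by
    intro x hx i e
    exact hx (Finset.mem_image.2 ⟨i, Finset.mem_univ _, e.symm⟩)
  have hK' : ∀ x ∈ Finset.univ.image c, ∃ i, c i = x := by
    intro x hx
    obtain ⟨i, -, e⟩ := Finset.mem_image.1 hx
    exact ⟨i, e⟩
  refine ⟨hsmooth, hm, ?_, hf0, by simpa using hf1, fun x hx hk => hreg x hx (hK x hk),
    fun x hx hk => hS x hx (hK x hk), ?_, ?_, hrep⟩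
  · intro k hk
    obtain ⟨i, rfl⟩ := hK' k hk
    exact hcm i
  · intro k hk a b ha hak hkb hb hz
    obtain ⟨i, rfl⟩ := hK' k hk
    have hz' : ∀ j, a < c j → c j < b → j = i := fun j h1 h2 =>
      hc.injective (hz _ (Finset.mem_image.2 ⟨j, Finset.mem_univ _, rfl⟩) h1 h2)
    have hi := i.isLt
    have s1 : Icc a (c i) ⊆ lap l c i.castSucc := by
      apply Icc_subset_Icc _ (lapPts_crit_left c i).ge
      unfold lapPts
      split_ifs with h0 h1
      · exact ha
      · simp at h1; omega
      · by_contra hcon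
        push Not at hcon
        simp only [Fin.val_castSucc] at h0
        have hlt : (⟨(i : ℕ) - 1, by omega⟩ : Fin l) < i := by rw [Fin.lt_def]; simp; omega
        have := hz' _ hcon ((hc hlt).trans hkb)
        exact hlt.ne this
    have s2 : Icc (c i) b ⊆ lap l c i.succ := by
      apply Icc_subset_Icc (lapPts_crit_right c i).le
      unfold lapPts
      split_ifs with h0 h1
      · simp at h0
      · exact hb
      · by_contra hcon
        push Not at hcon
        simp only [Fin.val_succ] at h1
        have hlt : i < (⟨(i : ℕ) + 1, by omega⟩ : Fin l) := by rw [Fin.lt_def]; simp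
        have := hz' ⟨(i : ℕ) + 1, by omega⟩ (hak.trans (hc hlt)) (by simpa using hcon)
        exact hlt.ne this.symm
    have hsi := hs i
    have l1 := hl i.castSucc
    have l2 := hl i.succ
    cases e1 : s i.castSucc <;> cases e2 : s i.succ <;> rw [e1] at l1 hsi <;>
      rw [e2] at l2 hsi <;> simp at l1 l2 hsi
    · exact Or.inr ⟨l1.mono s1, l2.mono s2⟩
    · exact Or.inl ⟨l1.mono s1, l2.mono s2⟩
  · intro k hk
    obtain ⟨i, rfl⟩ := hK' k hk
    exact hnf i

theorem order_track {l : ℕ} {f : ℝ → ℝ} {c : Fin l → ℝ}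
    (hmodal : IsLModal l f c) (hf0 : f 0 = 0) {x y : ℝ} (hx : x ∈ Icc (0:ℝ) 1)
    (hy : y ∈ Icc (0:ℝ) 1) (hxy : x < y) (n : ℕ)
    (hn : ∀ i < n, itin l c f x i = itin l c f y i) :
    (∏ i ∈ Finset.range n, symSgn (itin l c f x i) = 1 ∧ f^[n] x < f^[n] y) ∨
    (∏ i ∈ Finset.range n, symSgn (itin l c f x i) = -1 ∧ f^[n] y < f^[n] x) := by
  obtain ⟨hc, hcm, hm, -, -, s, hs, hl⟩ := hmodal
  induction n with
  | zero => left; simpa using hxy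
  | succ n ih =>
    have ih := ih fun i hi => hn i (hi.trans n.lt_succ_self)
    have hX := hm.iterate n hx
    have hY := hm.iterate n hy
    have e := hn n n.lt_succ_self
    have hne : f^[n] x ≠ f^[n] y := by rcases ih with h | h; exacts [h.2.ne, h.2.ne']
    rw [Finset.prod_range_succ, Function.iterate_succ_apply', Function.iterate_succ_apply']
    simp only [itin] at e
    by_cases hk : ∃ i, f^[n] x = c i
    · exfalso
      obtain ⟨i, hi⟩ := hk
      rw [hi, symAt_crit hc] at e
      by_cases hk2 : ∃ j, f^[n] y = c j
      · obtain ⟨j, hj⟩ := hk2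
        rw [hj, symAt_crit hc] at e
        rw [hi, hj, Sum.inr.inj e] at hne
        exact hne rfl
      · rw [symAt_lap hk2] at e; cases e
    obtain ⟨j, hj⟩ : ∃ j, symAt l c (f^[n] x) = Sum.inl j := ⟨_, symAt_lap hk⟩
    have m1 := mem_lap hc hX hj
    have m2 := mem_lap hc hY (e ▸ hj)
    have e3 : symSgn (itin l c f x n) = (-1) ^ (j : ℕ) := by simp only [itin]; rw [hj]; rfl
    rw [e3]
    have hlj := hl j
    rcases sgn_lap hc hcm hm hf0 hs hl j j.isLt with ⟨a, b⟩ | ⟨a, b⟩ <;> rw [a] <;>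
      simp only [Fin.eta] at b <;> rw [b] at hlj <;> simp at hlj <;>
      rcases ih with ⟨p, q⟩ | ⟨p, q⟩ <;> rw [p]
    · left; exact ⟨by norm_num, hlj m1 m2 q⟩
    · right; exact ⟨by norm_num, hlj m2 m1 q⟩
    · right; exact ⟨by norm_num, hlj m1 m2 q⟩
    · left; exact ⟨by norm_num, hlj m2 m1 q⟩

theorem itin_between {l : ℕ} {f : ℝ → ℝ} {c : Fin l → ℝ}
    (hmodal : IsLModal l f c) (hf0 : f 0 = 0) {x y : ℝ} (hx : x ∈ Icc (0:ℝ) 1)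
    (hy : y ∈ Icc (0:ℝ) 1) (hn : ∀ i, itin l c f x i = itin l c f y i)
    {s : ℝ} (hs1 : x < s) (hs2 : s < y) (n : ℕ) : itin l c f x n = itin l c f s n := by
  have hs : s ∈ Icc (0:ℝ) 1 := ⟨hx.1.trans hs1.le, hs2.le.trans hy.2⟩
  induction n using Nat.strong_induction_on with
  | _ n ih =>
    have hc := hmodal.1
    have t1 := order_track hmodal hf0 hx hs hs1 n ih
    have t2 := order_track hmodal hf0 hs hy hs2 n fun i hi => (ih i hi).symm.trans (hn i)
    have ep : ∏ i ∈ Finset.range n, symSgn (itin l c f x i) =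
        ∏ i ∈ Finset.range n, symSgn (itin l c f s i) :=
      Finset.prod_congr rfl fun i hi => by rw [ih i (Finset.mem_range.1 hi)]
    rw [← ep] at t2
    have e := congrArg symVal (hn n)
    apply symVal_inj
    simp only [itin] at e ⊢
    rcases t1 with ⟨p, q⟩ | ⟨p, q⟩ <;> rcases t2 with ⟨p', q'⟩ | ⟨p', q'⟩
    · have := symVal_mono hc q.le
      have := symVal_mono hc q'.le
      omega
    · rw [p] at p'; norm_num at p'
    · rw [p] at p'; norm_num at p'
    · have := symVal_mono hc q.le
      have := symVal_mono hc q'.le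
      omega

theorem sigLex_of_lt {l : ℕ} {f : ℝ → ℝ} {c : Fin l → ℝ}
    (hmodal : IsLModal l f c) (hf0 : f 0 = 0) (M : MM f (Finset.univ.image c))
    {x y : ℝ} (hx : x ∈ Icc (0:ℝ) 1) (hy : y ∈ Icc (0:ℝ) 1) (hxy : x < y) :
    sigLexLt l (itin l c f x) (itin l c f y) := by
  have hc := hmodal.1
  by_cases hall : ∀ i, itin l c f x i = itin l c f y i
  · exfalso
    refine M.no_wandering hx.1 hxy hy.2 (M.nc_of_avoid ?_)
    intro t s hs hk
    obtain ⟨j, -, hj⟩ := Finset.mem_image.1 hk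
    have e : itin l c f x t = itin l c f s t := by
      rcases hs.1.eq_or_lt with h | h
      · rw [h]
      rcases hs.2.eq_or_lt with h' | h'
      · rw [h']; exact hall t
      exact itin_between hmodal hf0 hx hy hall h h' t
    have key : ∀ z, itin l c f z t = Sum.inr j → f^[t] z = c j := by
      intro z hz
      simp only [itin] at hz
      by_cases hk : ∃ i, f^[t] z = c i
      · obtain ⟨i, hi⟩ := hk
        rw [hi, symAt_crit hc] at hz
        rw [hi, Sum.inr.inj hz]
      · rw [symAt_lap hk] at hz; cases hz
    have es : itin l c f s t = Sum.inr j := by simp only [itin]; rw [← hj, symAt_crit hc]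
    have h1 := key x (e.trans es)
    have h2 := key y ((hall t).symm.trans (e.trans es))
    rcases order_track hmodal hf0 hx hy hxy t fun i _ => hall i with h | h <;>
      rw [h1, h2] at h <;> exact lt_irrefl _ h.2
  · push Not at hall
    classical
    obtain ⟨n, hn, hlt⟩ : ∃ n, itin l c f x n ≠ itin l c f y n ∧
        ∀ i < n, itin l c f x i = itin l c f y i :=
      ⟨Nat.find hall, Nat.find_spec hall, fun i hi => by simpa using Nat.find_min hall hi⟩
    refine ⟨n, hlt, ?_⟩
    have ep : ∏ i ∈ Finset.range n, symSgn (itin l c f x i) =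
        ∏ i ∈ Finset.range n, symSgn (itin l c f y i) :=
      Finset.prod_congr rfl fun i hi => by rw [hlt i (Finset.mem_range.1 hi)]
    rw [← ep]
    have hne : symVal (itin l c f x n) ≠ symVal (itin l c f y n) := fun h => hn (symVal_inj h)
    rcases order_track hmodal hf0 hx hy hxy _ hlt with ⟨p, q⟩ | ⟨p, q⟩ <;> rw [p] <;>
      simp only [itin] at hne ⊢
    · have := symVal_mono hc q.le
      omega
    · have := symVal_mono hc q.le
      omega

end
end WI
/-- For a `C³` `l`-modal map with `f 0 = 0`, negative Schwarzian derivative, non-flat at each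
critical point, and all periodic points repelling, the itinerary map is strictly increasing:
`x < y` iff `ι(x) ≺ ι(y)` in the signed lexicographic order. -/
theorem itinerary_strict_mono
    (l : ℕ) (f : ℝ → ℝ) (c : Fin l → ℝ)
    (hmodal : IsLModal l f c)
    (hf0 : f 0 = 0)
    (hsmooth : ContDiff ℝ 3 f)
    (hreg : ∀ x ∈ Icc (0:ℝ) 1, (∀ i, x ≠ c i) → deriv f x ≠ 0)
    (hS : ∀ x ∈ Icc (0:ℝ) 1, (∀ i, x ≠ c i) → schwarzian f x < 0)
    (hnf : ∀ i, NonFlatAt f (c i))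
    (hrep : ∀ p ∈ Icc (0:ℝ) 1, ∀ n : ℕ, 1 ≤ n → f^[n] p = p → 1 < |deriv (f^[n]) p|) :
    ∀ x ∈ Icc (0:ℝ) 1, ∀ y ∈ Icc (0:ℝ) 1,
      (x < y ↔ sigLexLt l (itin l c f x) (itin l c f y)) := by
  intro x hx y hy
  have M := WI.MM.of_modal hmodal hf0 hsmooth hreg hS hnf hrep
  constructor
  · exact WI.sigLex_of_lt hmodal hf0 M hx hy
  · intro h
    rcases lt_trichotomy x y with h1 | h1 | h1
    · exact h1
    · subst h1; exact (WI.sigLex_asymm h h).elim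
    · exact (WI.sigLex_asymm h (WI.sigLex_of_lt hmodal hf0 M hy hx h1)).elim
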